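/- Let (v, B, p) be a smooth solution of the stationary MHD system in ℝ³: −Δv + (v·∇)v = −∇p + (B·∇)B, −Δv B + (v·∇)B − (B·∇)v = 0, ∇·v = ∇·B = 0. Suppose there exist smooth matrix potentials Φ, Ψ : ℝ³ → ℝ^{3×3} with ∇·Φ = v, ∇·Ψ = B and ⨍_{B(r)} |Φ − Φ_{B(r)}|⁶ dx + ⨍_{B(r)} |Ψ − Ψ_{B(r)}|⁶ dx ≤ C r for all r > 1. Then v ≡ 0, B ≡ 0, and p is constant. -/

import Mathlib

open MeasureTheory

noncomputable abbrev E3 : Type := EuclideanSpace ℝ (Fin 3)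

/-- Partial derivative `∂_i f (x)`. -/
noncomputable def pd (f : E3 → ℝ) (i : Fin 3) (x : E3) : ℝ :=
  fderiv ℝ f x (EuclideanSpace.single i 1)

/-- Laplacian `Δf = ∑_i ∂_i∂_i f`. -/
noncomputable def lap (f : E3 → ℝ) (x : E3) : ℝ :=
  ∑ i, pd (fun y => pd f i y) i x

/-- Divergence of a vector field. -/
noncomputable def divg (F : E3 → Fin 3 → ℝ) (x : E3) : ℝ :=
  ∑ i, pd (fun y => F y i) i x

/-- Divergence of a matrix field: `(∇·Φ)_j = ∑_i ∂_i Φ_{ij}`. -/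
noncomputable def matDiv (Φ : E3 → Fin 3 → Fin 3 → ℝ) (x : E3) (j : Fin 3) : ℝ :=
  ∑ i, pd (fun y => Φ y i j) i x

section PartialDerivatives

variable {f g : E3 → ℝ}

lemma pd_add_apply {x : E3} (hf : DifferentiableAt ℝ f x) (hg : DifferentiableAt ℝ g x) (i : Fin 3) :
    pd (fun y => f y + g y) i x = pd f i x + pd g i x := by
  simp only [pd]
  rw [fderiv_fun_add hf hg]; rfl

lemma pd_sub_apply {x : E3} (hf : DifferentiableAt ℝ f x) (hg : DifferentiableAt ℝ g x) (i : Fin 3) :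
    pd (fun y => f y - g y) i x = pd f i x - pd g i x := by
  simp only [pd]
  rw [fderiv_fun_sub hf hg]; rfl

lemma pd_mul_apply {x : E3} (hf : DifferentiableAt ℝ f x) (hg : DifferentiableAt ℝ g x) (i : Fin 3) :
    pd (fun y => f y * g y) i x = pd f i x * g x + f x * pd g i x := by
  simp only [pd]
  rw [fderiv_fun_mul hf hg]
  simp
  ring

lemma pd_const_mul (hf : Differentiable ℝ f) (c : ℝ) (i : Fin 3) :
    pd (fun y => c * f y) i = fun x => c * pd f i x := by
  funext x
  simp only [pd]
  rw [fderiv_const_mul (hf x)]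
  simp

lemma pd_sum_apply {ι : Type*} (s : Finset ι) {F : ι → E3 → ℝ} {x : E3}
    (hF : ∀ j ∈ s, DifferentiableAt ℝ (F j) x) (i : Fin 3) :
    pd (fun y => ∑ j ∈ s, F j y) i x = ∑ j ∈ s, pd (F j) i x := by
  simp only [pd]
  rw [fderiv_fun_sum hF]
  simp

lemma pd_const (c : ℝ) (i : Fin 3) : pd (fun _ => c) i = fun _ => 0 := by
  funext x
  simp [pd]

lemma continuous_pd (hf : ContDiff ℝ 1 f) (i : Fin 3) : Continuous (pd f i) :=
  (hf.continuous_fderiv one_ne_zero).clm_apply continuous_const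

lemma contDiff_pd {m n : WithTop ℕ∞} (hf : ContDiff ℝ n f) (h : m + 1 ≤ n) (i : Fin 3) :
    ContDiff ℝ m (pd f i) :=
  (hf.fderiv_right h).clm_apply contDiff_const

lemma contDiff_pd_top (hf : ContDiff ℝ (⊤ : ℕ∞) f) (i : Fin 3) : ContDiff ℝ (⊤ : ℕ∞) (pd f i) :=
  contDiff_pd hf (by norm_cast) i

lemma hasCompactSupport_pd (hf : HasCompactSupport f) (i : Fin 3) : HasCompactSupport (pd f i) :=
  (hf.fderiv ℝ).comp_left (g := fun L : E3 →L[ℝ] ℝ => L (EuclideanSpace.single i 1)) rfl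

lemma pd_eq_zero_of_notMem_tsupport {x : E3} (hx : x ∉ tsupport f) (i : Fin 3) : pd f i x = 0 := by
  have : fderiv ℝ f x = 0 := by
    by_contra h
    exact hx (support_fderiv_subset ℝ (Function.mem_support.2 h))
  simp [pd, this]

lemma tsupport_pd_subset (i : Fin 3) : tsupport (pd f i) ⊆ tsupport f := by
  refine closure_minimal (fun x hx => ?_) (isClosed_tsupport f)
  by_contra h
  exact hx (pd_eq_zero_of_notMem_tsupport h i)

lemma fderiv_eq_sum_pd (x y : E3) : fderiv ℝ f x y = ∑ i, y i * pd f i x := by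
  conv_lhs => rw [← (EuclideanSpace.basisFun (Fin 3) ℝ).sum_repr y]
  simp [pd, map_sum]

lemma norm_fderiv_le_sum (x : E3) : ‖fderiv ℝ f x‖ ≤ ∑ i, |pd f i x| := by
  refine ContinuousLinearMap.opNorm_le_bound _ (Finset.sum_nonneg fun _ _ => abs_nonneg _) fun y => ?_
  rw [fderiv_eq_sum_pd, Finset.sum_mul]
  refine (norm_sum_le _ _).trans (Finset.sum_le_sum fun i _ => ?_)
  rw [norm_mul, mul_comm]
  exact mul_le_mul_of_nonneg_left (PiLp.norm_apply_le y i) (abs_nonneg _)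

lemma integral_mul_pd (hf : ContDiff ℝ 1 f) (hg : ContDiff ℝ 1 g) (hc : HasCompactSupport g)
    (i : Fin 3) : ∫ x, f x * pd g i x = - ∫ x, pd f i x * g x := by
  refine integral_mul_fderiv_eq_neg_fderiv_mul_of_integrable (𝕜 := ℝ) ?_ ?_ ?_
    (fun x _ => hf.differentiable one_ne_zero x) (fun x _ => hg.differentiable one_ne_zero x)
  · exact ((continuous_pd hf i).mul hg.continuous).integrable_of_hasCompactSupport hc.mul_left
  · exact (hf.continuous.mul (continuous_pd hg i)).integrable_of_hasCompactSupport
      (hasCompactSupport_pd hc i).mul_left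
  · exact (hf.continuous.mul hg.continuous).integrable_of_hasCompactSupport hc.mul_left

lemma integral_pd_mul (hf : ContDiff ℝ 1 f) (hg : ContDiff ℝ 1 g) (hc : HasCompactSupport g)
    (i : Fin 3) : ∫ x, pd f i x * g x = - ∫ x, f x * pd g i x := by
  rw [integral_mul_pd hf hg hc, neg_neg]

end PartialDerivatives

section LebesgueBounds

open scoped ENNReal

/-- `f` is measurable on `s` and its `L^p(s)` norm is at most `a`. -/
structure LpBound (p : ℝ≥0∞) (s : Set E3) (f : E3 → ℝ) (a : ℝ) : Prop where
  meas : AEStronglyMeasurable f (volume.restrict s)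
  nonneg : 0 ≤ a
  le : eLpNorm f p (volume.restrict s) ≤ ENNReal.ofReal a

variable {p q r : ℝ≥0∞} {s t : Set E3} {f g : E3 → ℝ} {a b c : ℝ}

namespace LpBound

lemma mono (h : LpBound p s f a) (hab : a ≤ b) : LpBound p s f b :=
  ⟨h.meas, h.nonneg.trans hab, h.le.trans (ENNReal.ofReal_le_ofReal hab)⟩

lemma mono_set (h : LpBound p t f a) (hst : s ⊆ t) : LpBound p s f a :=
  ⟨h.meas.mono_measure (Measure.restrict_mono hst le_rfl), h.nonneg,
    (eLpNorm_mono_measure _ (Measure.restrict_mono hst le_rfl)).trans h.le⟩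

lemma of_abs_le (h : LpBound p s g a) (hs : MeasurableSet s)
    (hf : AEStronglyMeasurable f (volume.restrict s))
    (hfg : ∀ x ∈ s, |f x| ≤ |g x|) : LpBound p s f a :=
  ⟨hf, h.nonneg, (eLpNorm_mono_ae ((ae_restrict_iff' hs).2 (.of_forall hfg))).trans h.le⟩

lemma congr (h : LpBound p s g a) (hs : MeasurableSet s) (hfg : ∀ x ∈ s, f x = g x) :
    LpBound p s f a := by
  have hae : g =ᵐ[volume.restrict s] f :=
    (ae_restrict_iff' hs).2 (.of_forall fun x hx => (hfg x hx).symm)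
  exact ⟨h.meas.congr hae, h.nonneg, by rw [← eLpNorm_congr_ae hae]; exact h.le⟩

lemma abs (h : LpBound p s f a) : LpBound p s (fun x => |f x|) a :=
  ⟨h.meas.norm, h.nonneg, by
    have := eLpNorm_norm (p := p) f (μ := volume.restrict s)
    simp only [Real.norm_eq_abs] at this
    rw [this]; exact h.le⟩

lemma add (hp : 1 ≤ p) (hf : LpBound p s f a) (hg : LpBound p s g b) :
    LpBound p s (fun x => f x + g x) (a + b) :=
  ⟨hf.meas.add hg.meas, add_nonneg hf.nonneg hg.nonneg, by
    rw [ENNReal.ofReal_add hf.nonneg hg.nonneg]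
    exact (eLpNorm_add_le hf.meas hg.meas hp).trans (add_le_add hf.le hg.le)⟩

lemma const_mul (hf : LpBound p s f a) (c : ℝ) : LpBound p s (fun x => c * f x) (|c| * a) :=
  ⟨hf.meas.const_mul c, mul_nonneg (abs_nonneg c) hf.nonneg, by
    have : (fun x => c * f x) = c • f := rfl
    rw [this, eLpNorm_const_smul, ENNReal.ofReal_mul (abs_nonneg c), ← Real.norm_eq_abs,
      ofReal_norm]
    gcongr
    exact hf.le⟩

lemma zero : LpBound p s (fun _ => 0) 0 := ⟨aestronglyMeasurable_const, le_rfl, by simp⟩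

lemma sum {ι : Type*} (hp : 1 ≤ p) (S : Finset ι) {F : ι → E3 → ℝ} {A : ι → ℝ}
    (h : ∀ i ∈ S, LpBound p s (F i) (A i)) :
    LpBound p s (fun x => ∑ i ∈ S, F i x) (∑ i ∈ S, A i) := by
  classical
  induction S using Finset.induction_on with
  | empty => simpa using zero
  | insert i S hi ih =>
    simp only [Finset.sum_insert hi]
    exact (h i (Finset.mem_insert_self _ _)).add hp
      (ih fun j hj => h j (Finset.mem_insert_of_mem hj))

lemma mul [ENNReal.HolderTriple p q r] (hf : LpBound p s f a) (hg : LpBound q s g b) :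
    LpBound r s (fun x => f x * g x) (a * b) :=
  ⟨hf.meas.mul hg.meas, mul_nonneg hf.nonneg hg.nonneg, by
    rw [ENNReal.ofReal_mul hf.nonneg]
    exact (eLpNorm_smul_le_mul_eLpNorm (p := p) (q := q) (r := r) hg.meas hf.meas).trans
      (mul_le_mul' hf.le hg.le)⟩

/-- Multiplication by a bounded function. -/
lemma bdd_mul (hg : LpBound p s g b) (hs : MeasurableSet s)
    (hf : AEStronglyMeasurable f (volume.restrict s)) (h : ∀ x ∈ s, |f x| ≤ c) (hc : 0 ≤ c) :
    LpBound p s (fun x => f x * g x) (c * b) := by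
  have := (hg.const_mul c)
  rw [abs_of_nonneg hc] at this
  refine this.of_abs_le hs (hf.mul hg.meas) fun x hx => ?_
  rw [abs_mul, abs_mul, abs_of_nonneg hc]
  exact mul_le_mul_of_nonneg_right (h x hx) (abs_nonneg _)

lemma univ_of_eq_zero (h : LpBound p s f a) (hs : MeasurableSet s) (hf : ∀ x, x ∉ s → f x = 0) :
    LpBound p Set.univ f a := by
  have : f = s.indicator f := by
    funext x
    by_cases hx : x ∈ s
    · simp [hx]
    · simp [hx, hf x hx]
  refine ⟨?_, h.nonneg, ?_⟩
  · rw [Measure.restrict_univ, this]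
    exact (aestronglyMeasurable_indicator_iff hs).2 h.meas
  · rw [Measure.restrict_univ, this, eLpNorm_indicator_eq_eLpNorm_restrict hs]
    exact h.le

lemma abs_integral_le (h : LpBound 1 s f a) : |∫ x in s, f x| ≤ a := by
  have h1 := (enorm_integral_le_lintegral_enorm (μ := volume.restrict s) f)
  rw [← eLpNorm_one_eq_lintegral_enorm] at h1
  have := h1.trans h.le
  rw [← ofReal_norm, ENNReal.ofReal_le_ofReal_iff h.nonneg] at this
  exact this

/-- Integral over the whole space of a function vanishing off `s`. -/
lemma abs_integral_le_of_eq_zero (h : LpBound 1 s f a) (hf : ∀ x, x ∉ s → f x = 0) :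
    |∫ x, f x| ≤ a := by
  rw [← setIntegral_eq_integral_of_forall_compl_eq_zero (s := s) hf]
  exact h.abs_integral_le

lemma lintegral_le (h : LpBound p s f a) (h0 : p ≠ 0) (ht : p ≠ ⊤) :
    ∫⁻ x in s, ‖f x‖ₑ ^ p.toReal ≤ ENNReal.ofReal a ^ p.toReal := by
  have := h.le
  rw [eLpNorm_eq_lintegral_rpow_enorm_toReal h0 ht] at this
  have hp := ENNReal.toReal_pos h0 ht
  rwa [one_div, ENNReal.rpow_inv_le_iff hp] at this

lemma of_lintegral_le (h0 : p ≠ 0) (ht : p ≠ ⊤) (ha : 0 ≤ a)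
    (hf : AEStronglyMeasurable f (volume.restrict s))
    (h : ∫⁻ x in s, ‖f x‖ₑ ^ p.toReal ≤ ENNReal.ofReal a ^ p.toReal) : LpBound p s f a := by
  refine ⟨hf, ha, ?_⟩
  rw [eLpNorm_eq_lintegral_rpow_enorm_toReal h0 ht]
  have hp := ENNReal.toReal_pos h0 ht
  rwa [one_div, ENNReal.rpow_inv_le_iff hp]

lemma lintegral_eq {n : ℕ} (hi : IntegrableOn (fun x => |f x| ^ n) s) :
    ∫⁻ x in s, ‖f x‖ₑ ^ ((n : ℝ≥0∞)).toReal = ENNReal.ofReal (∫ x in s, |f x| ^ n) := by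
  rw [ofReal_integral_eq_lintegral_ofReal hi (.of_forall fun x => by positivity)]
  refine lintegral_congr fun x => ?_
  rw [ENNReal.ofReal_pow (abs_nonneg _), ENNReal.toReal_natCast, ENNReal.rpow_natCast,
    ← Real.norm_eq_abs, ofReal_norm]

lemma integral_pow_le {n : ℕ} (hn : n ≠ 0) (h : LpBound n s f a)
    (hi : IntegrableOn (fun x => |f x| ^ n) s) : ∫ x in s, |f x| ^ n ≤ a ^ n := by
  have := h.lintegral_le (by exact_mod_cast hn) (by simp)
  rw [lintegral_eq hi, ENNReal.toReal_natCast, ENNReal.rpow_natCast,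
    ← ENNReal.ofReal_pow h.nonneg, ENNReal.ofReal_le_ofReal_iff (pow_nonneg h.nonneg _)] at this
  exact this

lemma of_integral_pow_le {n : ℕ} (hn : n ≠ 0) (ha : 0 ≤ a)
    (hf : AEStronglyMeasurable f (volume.restrict s))
    (hi : IntegrableOn (fun x => |f x| ^ n) s) (h : ∫ x in s, |f x| ^ n ≤ a ^ n) :
    LpBound n s f a := by
  refine of_lintegral_le (by exact_mod_cast hn) (by simp) ha hf ?_
  rw [lintegral_eq hi, ENNReal.toReal_natCast, ENNReal.rpow_natCast, ← ENNReal.ofReal_pow ha]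
  exact ENNReal.ofReal_le_ofReal h

/-- Comparison of exponents on a set of finite measure. -/
lemma of_le_exponent (hpq : p ≤ q) (h : LpBound q s f a) {V : ℝ} (hV : 0 ≤ V)
    (hs : volume s ^ (1 / p.toReal - 1 / q.toReal) ≤ ENNReal.ofReal V) :
    LpBound p s f (a * V) := by
  refine ⟨h.meas, mul_nonneg h.nonneg hV, ?_⟩
  have := eLpNorm_le_eLpNorm_mul_rpow_measure_univ hpq h.meas
  rw [Measure.restrict_apply_univ] at this
  rw [ENNReal.ofReal_mul h.nonneg]
  exact this.trans (mul_le_mul' h.le hs)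

lemma union (hp : 1 ≤ p) (hs : MeasurableSet s) (ht : MeasurableSet t)
    (h1 : LpBound p s f a) (h2 : LpBound p (t \ s) f b) : LpBound p t f (a + b) := by
  have e1 : LpBound p Set.univ (s.indicator f) a := by
    refine ⟨?_, h1.nonneg, ?_⟩
    · rw [Measure.restrict_univ]; exact (aestronglyMeasurable_indicator_iff hs).2 h1.meas
    · rw [Measure.restrict_univ, eLpNorm_indicator_eq_eLpNorm_restrict hs]; exact h1.le
  have e2 : LpBound p Set.univ ((t \ s).indicator f) b := by
    refine ⟨?_, h2.nonneg, ?_⟩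
    · rw [Measure.restrict_univ]
      exact (aestronglyMeasurable_indicator_iff (ht.diff hs)).2 h2.meas
    · rw [Measure.restrict_univ, eLpNorm_indicator_eq_eLpNorm_restrict (ht.diff hs)]; exact h2.le
  refine ((e1.add hp e2).mono_set (Set.subset_univ t)).congr ht fun x hx => ?_
  by_cases hxs : x ∈ s <;> simp [hxs, hx]

lemma exists_of_continuous (hf : Continuous f) (x : E3) (ρ : ℝ) :
    ∃ a, LpBound p (Metric.ball x ρ) f a := by
  obtain ⟨c, hc⟩ := (isCompact_closedBall x ρ).exists_bound_of_continuousOn hf.continuousOn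
  have : MemLp f p (volume.restrict (Metric.ball x ρ)) := by
    have : IsFiniteMeasure (volume.restrict (Metric.ball x ρ)) :=
      ⟨by rw [Measure.restrict_apply_univ]; exact measure_ball_lt_top⟩
    exact MemLp.of_bound hf.aestronglyMeasurable c ((ae_restrict_iff' measurableSet_ball).2
      (.of_forall fun y hy => hc y (Metric.ball_subset_closedBall hy)))
  exact ⟨(eLpNorm f p (volume.restrict (Metric.ball x ρ))).toReal, this.1, ENNReal.toReal_nonneg,
    by rw [ENNReal.ofReal_toReal this.2.ne]⟩

end LpBound

/-- Powers of the volume of a ball of radius at most `2 m ^ 6`. -/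
lemma exists_volume_ball_rpow_le : ∃ V : ℝ, 1 ≤ V ∧ ∀ m ρ : ℝ, 0 ≤ m → ρ ≤ 2 * m ^ 6 →
    ∀ (x : E3) (k : ℕ) (c : ℝ), c = k / 18 → k ≤ 18 →
    volume (Metric.ball x ρ) ^ c ≤ ENNReal.ofReal (V * m ^ k) := by
  set V : ℝ := max 1 (8 * (volume (Metric.ball (0 : E3) 1)).toReal) with hV
  have hV1 : 1 ≤ V := le_max_left _ _
  refine ⟨V, hV1, fun m ρ hm hρ x k c hc hk => ?_⟩
  have hc0 : 0 ≤ c := by rw [hc]; positivity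
  have hc1 : c ≤ 1 := by
    rw [hc, div_le_one (by norm_num)]; exact_mod_cast hk
  have hvol : volume (Metric.ball x ρ) ≤ ENNReal.ofReal (V * m ^ 18) := by
    refine (measure_mono (Metric.ball_subset_ball hρ)).trans ?_
    rw [Measure.addHaar_ball _ _ (by positivity)]
    have : Module.finrank ℝ E3 = 3 := by simp
    rw [this, ← ENNReal.ofReal_toReal
      (measure_ball_lt_top (μ := volume) (x := (0:E3)) (r := 1)).ne,
      ← ENNReal.ofReal_mul (by positivity)]
    refine ENNReal.ofReal_le_ofReal ?_
    have : 8 * (volume (Metric.ball (0 : E3) 1)).toReal ≤ V := le_max_right _ _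
    calc _ = (8 * (volume (Metric.ball (0 : E3) 1)).toReal) * m ^ 18 := by ring
      _ ≤ _ := by gcongr
  refine (ENNReal.rpow_le_rpow hvol hc0).trans ?_
  rw [ENNReal.ofReal_rpow_of_nonneg (by positivity) hc0]
  refine ENNReal.ofReal_le_ofReal ?_
  rw [Real.mul_rpow (by positivity) (by positivity)]
  have e : (m ^ 18) ^ c = m ^ k := by
    rw [← Real.rpow_natCast, ← Real.rpow_mul hm, hc, ← Real.rpow_natCast]
    congr 1
    push_cast; ring
  rw [e]
  refine mul_le_mul_of_nonneg_right ?_ (by positivity)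
  calc V ^ c ≤ V ^ (1:ℝ) := Real.rpow_le_rpow_of_exponent_le hV1 hc1
    _ = V := Real.rpow_one V

/-- Comparison of Lebesgue norms on balls of radius at most `2 m ^ 6`. -/
lemma exists_lpBound_ball_compare : ∃ V : ℝ, 1 ≤ V ∧ ∀ m ρ : ℝ, 0 ≤ m → ρ ≤ 2 * m ^ 6 →
    ∀ (x : E3) (p q : ℝ≥0∞) (k : ℕ), p ≤ q → 1 / p.toReal - 1 / q.toReal = k / 18 → k ≤ 18 →
    ∀ f a, LpBound q (Metric.ball x ρ) f a → LpBound p (Metric.ball x ρ) f (V * m ^ k * a) := by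
  obtain ⟨V, hV, h⟩ := exists_volume_ball_rpow_le
  refine ⟨V, hV, fun m ρ hm hρ x p q k hpq hk hk' f a hf => ?_⟩
  rw [mul_comm]
  exact hf.of_le_exponent hpq (by positivity) (h m ρ hm hρ x k _ hk hk')

/-- Lebesgue norms of bounded functions on balls of radius at most `2 m ^ 6`. -/
lemma exists_lpBound_ball_of_bdd : ∃ V : ℝ, 1 ≤ V ∧ ∀ m ρ : ℝ, 0 ≤ m → ρ ≤ 2 * m ^ 6 →
    ∀ (x : E3) (p : ℝ≥0∞) (k : ℕ), 1 / p.toReal = k / 18 → k ≤ 18 →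
    ∀ (f : E3 → ℝ) (c : ℝ), AEStronglyMeasurable f (volume.restrict (Metric.ball x ρ)) → 0 ≤ c →
    (∀ y ∈ Metric.ball x ρ, |f y| ≤ c) → LpBound p (Metric.ball x ρ) f (V * m ^ k * c) := by
  obtain ⟨V, hV, h⟩ := exists_lpBound_ball_compare
  refine ⟨V, hV, fun m ρ hm hρ x p k hk hk' f c hf hc hb => ?_⟩
  refine h m ρ hm hρ x p ⊤ k le_top (by simpa using hk) hk' f c ⟨hf, hc, ?_⟩
  rw [eLpNorm_exponent_top]
  refine eLpNormEssSup_le_of_ae_bound ((ae_restrict_iff' measurableSet_ball).2 (.of_forall ?_))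
  exact hb

end LebesgueBounds

section Averaging

open scoped ENNReal

/-- The parameter domain of the averaging operators. -/
def avgDom : Set (E3 × ℝ) := Metric.closedBall (0 : E3) 1 ×ˢ Set.Icc (0 : ℝ) 1

/-- Average of translates of `f` along `θ` with weight `κ`. -/
noncomputable def avg (κ : E3 × ℝ → ℝ) (θ : E3 × ℝ → E3) (f : E3 → ℝ) (x : E3) : ℝ :=
  ∫ ω in avgDom, κ ω * f (x - θ ω)

lemma isCompact_avgDom : IsCompact avgDom := (isCompact_closedBall _ _).prod isCompact_Icc

lemma measurableSet_avgDom : MeasurableSet avgDom := isCompact_avgDom.measurableSet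

/-- Total mass of the parameter domain. -/
noncomputable def avgMass : ℝ := (volume avgDom).toReal

lemma avgMass_nonneg : 0 ≤ avgMass := ENNReal.toReal_nonneg

lemma volume_avgDom : volume avgDom = ENNReal.ofReal avgMass :=
  (ENNReal.ofReal_toReal isCompact_avgDom.measure_lt_top.ne).symm

instance : IsFiniteMeasure ((volume : Measure (E3 × ℝ)).restrict avgDom) :=
  ⟨by rw [Measure.restrict_apply_univ]; exact isCompact_avgDom.measure_lt_top⟩

variable {κ : E3 × ℝ → ℝ} {θ : E3 × ℝ → E3} {f g : E3 → ℝ}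

lemma continuous_avg (hκ : Continuous κ) (hθ : Continuous θ) (hf : Continuous f) :
    Continuous (avg κ θ f) := by
  refine continuous_parametric_integral_of_continuous (f := fun x ω => κ ω * f (x - θ ω)) ?_
    isCompact_avgDom
  exact (hκ.comp continuous_snd).mul (hf.comp (continuous_fst.sub (hθ.comp continuous_snd)))

lemma integrable_avg (hκ : Continuous κ) (hθ : Continuous θ) (hf : Continuous f) (x : E3) :
    IntegrableOn (fun ω => κ ω * f (x - θ ω)) avgDom :=
  (hκ.mul (hf.comp (continuous_const.sub hθ))).continuousOn.integrableOn_compact isCompact_avgDom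

lemma hasFDerivAt_avg (hκ : Continuous κ) (hθ : Continuous θ) (hf : ContDiff ℝ 1 f) (x : E3) :
    HasFDerivAt (avg κ θ f) (∫ ω in avgDom, κ ω • fderiv ℝ f (x - θ ω)) x := by
  have hF' : Continuous fun z : E3 × (E3 × ℝ) => κ z.2 • fderiv ℝ f (z.1 - θ z.2) :=
    (hκ.comp continuous_snd).smul ((hf.continuous_fderiv one_ne_zero).comp
      (continuous_fst.sub (hθ.comp continuous_snd)))
  obtain ⟨c, hc⟩ := ((isCompact_closedBall x 1).prod isCompact_avgDom).exists_bound_of_continuousOn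
    hF'.continuousOn
  refine hasFDerivAt_integral_of_dominated_of_fderiv_le (𝕜 := ℝ) (bound := fun _ => c)
    (F' := fun x ω => κ ω • fderiv ℝ f (x - θ ω)) (Metric.ball_mem_nhds x one_pos) ?_ ?_ ?_ ?_ ?_ ?_
  · refine .of_forall fun y => ?_
    exact (integrable_avg hκ hθ hf.continuous y).aestronglyMeasurable
  · exact integrable_avg hκ hθ hf.continuous x
  · exact (hF'.comp (Continuous.prodMk_right x)).aestronglyMeasurable
  · refine (ae_restrict_iff' measurableSet_avgDom).2 (.of_forall fun ω hω y hy => ?_)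
    exact hc (y, ω) ⟨Metric.ball_subset_closedBall hy, hω⟩
  · exact integrable_const c
  · refine .of_forall fun ω y _ => ?_
    have h1 : HasFDerivAt (fun z => f (z - θ ω)) (fderiv ℝ f (y - θ ω)) y := by
      have := (hf.differentiable one_ne_zero (y - θ ω)).hasFDerivAt
      exact this.comp y ((hasFDerivAt_id y).sub_const (θ ω))
    exact h1.const_mul (κ ω)

lemma pd_avg (hκ : Continuous κ) (hθ : Continuous θ) (hf : ContDiff ℝ 1 f) (i : Fin 3) :
    pd (avg κ θ f) i = avg κ θ (pd f i) := by
  funext x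
  rw [pd, (hasFDerivAt_avg hκ hθ hf x).fderiv, ContinuousLinearMap.integral_apply]
  · rfl
  · have : Continuous fun ω => κ ω • fderiv ℝ f (x - θ ω) :=
      hκ.smul ((hf.continuous_fderiv one_ne_zero).comp (continuous_const.sub hθ))
    exact this.continuousOn.integrableOn_compact isCompact_avgDom

lemma contDiff_one_of_pd (hd : Differentiable ℝ f) (h : ∀ i, Continuous (pd f i)) :
    ContDiff ℝ 1 f := by
  rw [contDiff_one_iff_fderiv]
  refine ⟨hd, ?_⟩
  have : fderiv ℝ f = fun x => ∑ i, pd f i x •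
      (EuclideanSpace.proj i : E3 →L[ℝ] ℝ) := by
    funext x
    ext y
    rw [fderiv_eq_sum_pd]
    simp [mul_comm]
  rw [this]
  exact continuous_finsetSum _ fun i _ => (h i).smul continuous_const

lemma contDiff_avg (hκ : Continuous κ) (hθ : Continuous θ) (hf : ContDiff ℝ 1 f) :
    ContDiff ℝ 1 (avg κ θ f) := by
  refine contDiff_one_of_pd (fun x => (hasFDerivAt_avg hκ hθ hf x).differentiableAt) fun i => ?_
  rw [pd_avg hκ hθ hf]
  exact continuous_avg hκ hθ (continuous_pd hf i)

lemma avg_eq_zero (hθ : ∀ ω ∈ avgDom, f (x - θ ω) = 0) : avg κ θ f x = 0 := by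
  refine setIntegral_eq_zero_of_forall_eq_zero fun ω hω => ?_
  rw [hθ ω hω, mul_zero]

/-- The averaging operators are bounded on Lebesgue spaces, with a loss of domain. -/
lemma lpBound_avg {p : ℝ≥0∞} {k δ ρ a : ℝ} {x₀ : E3} (hp : 1 ≤ p) (hp' : p ≠ ⊤)
    (hκ : Continuous κ) (hθ : Continuous θ) (hf : Continuous f)
    (hk : ∀ ω ∈ avgDom, |κ ω| ≤ k) (hδ : ∀ ω ∈ avgDom, ‖θ ω‖ ≤ δ) (hk0 : 0 ≤ k)
    (h : LpBound p (Metric.ball x₀ (ρ + δ)) f a) :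
    LpBound p (Metric.ball x₀ ρ) (avg κ θ f) (k * avgMass * a) := by
  have hp0 : p ≠ 0 := (zero_lt_one.trans_le hp).ne'
  have hpp : 0 < p.toReal := ENNReal.toReal_pos hp0 hp'
  have hpp1 : 1 ≤ p.toReal := by
    rw [← ENNReal.toReal_one]; exact ENNReal.toReal_mono hp' hp
  have hM := avgMass_nonneg
  refine LpBound.of_lintegral_le hp0 hp' (mul_nonneg (mul_nonneg hk0 hM) h.nonneg)
    (continuous_avg hκ hθ hf).aestronglyMeasurable ?_
  have hcont : Continuous fun z : E3 × (E3 × ℝ) => f (z.1 - θ z.2) :=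
    hf.comp (continuous_fst.sub (hθ.comp continuous_snd))
  have pointwise : ∀ x, ‖avg κ θ f x‖ₑ ^ p.toReal ≤
      (ENNReal.ofReal k ^ p.toReal * ENNReal.ofReal avgMass ^ (p.toReal - 1)) *
        ∫⁻ ω in avgDom, ‖f (x - θ ω)‖ₑ ^ p.toReal := by
    intro x
    have c1 : Continuous fun ω => f (x - θ ω) := hf.comp (continuous_const.sub hθ)
    have e1 : ‖avg κ θ f x‖ₑ ≤ ENNReal.ofReal k * eLpNorm (fun ω => f (x - θ ω)) 1
        (volume.restrict avgDom) := by
      refine (enorm_integral_le_lintegral_enorm _).trans ?_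
      rw [eLpNorm_one_eq_lintegral_enorm, ← lintegral_const_mul' _ _ ENNReal.ofReal_ne_top]
      refine lintegral_mono_ae ((ae_restrict_iff' measurableSet_avgDom).2 (.of_forall ?_))
      intro ω hω
      rw [enorm_mul]
      gcongr
      rw [← ofReal_norm]
      exact ENNReal.ofReal_le_ofReal (hk ω hω)
    have e2 := eLpNorm_le_eLpNorm_mul_rpow_measure_univ hp
      (c1.aestronglyMeasurable (μ := volume.restrict avgDom))
    rw [Measure.restrict_apply_univ, volume_avgDom] at e2
    calc ‖avg κ θ f x‖ₑ ^ p.toReal ≤ (ENNReal.ofReal k * (eLpNorm (fun ω => f (x - θ ω)) p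
        (volume.restrict avgDom) * ENNReal.ofReal avgMass ^
          (1 / (1 : ℝ≥0∞).toReal - 1 / p.toReal))) ^ p.toReal := by
          gcongr
          exact e1.trans (by gcongr)
      _ = _ := by
        rw [ENNReal.mul_rpow_of_nonneg _ _ hpp.le, ENNReal.mul_rpow_of_nonneg _ _ hpp.le,
          ← ENNReal.rpow_mul, eLpNorm_eq_lintegral_rpow_enorm_toReal hp0 hp',
          ← ENNReal.rpow_mul, one_div_mul_cancel hpp.ne', ENNReal.rpow_one, mul_assoc]
        congr 1
        rw [mul_comm]
        congr 2
        simp only [ENNReal.toReal_one]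
        field_simp
  refine (lintegral_mono pointwise).trans ?_
  have hmeas : Measurable fun z : E3 × (E3 × ℝ) => ‖f (z.1 - θ z.2)‖ₑ ^ p.toReal :=
    (hcont.measurable.enorm).pow_const _
  rw [lintegral_const_mul _ (Measurable.lintegral_prod_right' hmeas),
    lintegral_lintegral_swap hmeas.aemeasurable]
  have inner : ∀ ω ∈ avgDom, ∫⁻ x in Metric.ball x₀ ρ, ‖f (x - θ ω)‖ₑ ^ p.toReal ≤
      ENNReal.ofReal a ^ p.toReal := by
    intro ω hω
    refine le_trans ?_ (h.lintegral_le hp0 hp')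
    have hmp := measurePreserving_sub_right (volume : Measure E3) (θ ω)
    have hsub : Metric.ball x₀ ρ ⊆ (fun x => x - θ ω) ⁻¹' Metric.ball x₀ (ρ + δ) := by
      intro x hx
      rw [Set.mem_preimage, Metric.mem_ball, dist_eq_norm] at *
      calc ‖x - θ ω - x₀‖ = ‖(x - x₀) - θ ω‖ := by congr 1; abel
        _ ≤ ‖x - x₀‖ + ‖θ ω‖ := norm_sub_le _ _
        _ < ρ + δ := add_lt_add_of_lt_of_le hx (hδ ω hω)
    calc _ ≤ ∫⁻ x in (fun x => x - θ ω) ⁻¹' Metric.ball x₀ (ρ + δ),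
            ‖f (x - θ ω)‖ₑ ^ p.toReal := lintegral_mono_set hsub
      _ = _ := (hmp.setLIntegral_comp_preimage measurableSet_ball
          ((hf.measurable.enorm).pow_const _))
  calc _ ≤ (ENNReal.ofReal k ^ p.toReal * ENNReal.ofReal avgMass ^ (p.toReal - 1)) *
        ∫⁻ ω in avgDom, ENNReal.ofReal a ^ p.toReal := by
        gcongr 1
        exact setLIntegral_mono' measurableSet_avgDom inner
    _ = ENNReal.ofReal k ^ p.toReal * (ENNReal.ofReal avgMass ^ (p.toReal - 1) *
        ENNReal.ofReal avgMass ^ (1 : ℝ)) * ENNReal.ofReal a ^ p.toReal := by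
        rw [setLIntegral_const, volume_avgDom, ENNReal.rpow_one]; ring
    _ = _ := by
        rw [← ENNReal.rpow_add_of_nonneg _ _ (by linarith) zero_le_one, sub_add_cancel,
          ENNReal.ofReal_mul (by positivity), ENNReal.ofReal_mul hk0,
          ENNReal.mul_rpow_of_nonneg _ _ hpp.le, ENNReal.mul_rpow_of_nonneg _ _ hpp.le]

lemma integrable_prod_avgDom {F : E3 → E3 × ℝ → ℝ} (hF : Continuous (Function.uncurry F)) {R : ℝ}
    (h : ∀ x, ∀ ω ∈ avgDom, R < ‖x‖ → F x ω = 0) :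
    Integrable (Function.uncurry F) (volume.prod (volume.restrict avgDom)) := by
  have h1 := hF.continuousOn.integrableOn_compact (μ := volume.prod volume)
    ((isCompact_closedBall (0 : E3) R).prod isCompact_avgDom)
  have h2 := h1.of_forall_sdiff_eq_zero (t := Set.univ ×ˢ avgDom)
    (MeasurableSet.univ.prod measurableSet_avgDom) fun z hz => by
      refine h z.1 z.2 hz.1.2 ?_
      by_contra hle
      exact hz.2 ⟨by simpa using hle, hz.1.2⟩
  rwa [IntegrableOn, ← Measure.prod_restrict, Measure.restrict_univ] at h2

/-- Transposition of averaging operators. -/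
lemma integral_mul_avg (hκ : Continuous κ) (hθ : Continuous θ) (hf : Continuous f)
    (hg : Continuous g) (hgc : HasCompactSupport g) :
    ∫ x, g x * avg κ θ f x = ∫ x, avg κ (fun ω => - θ ω) g x * f x := by
  obtain ⟨R, hR⟩ := hgc.isCompact.isBounded.subset_closedBall (0 : E3)
  have hg0 : ∀ x, R < ‖x‖ → g x = 0 := fun x hx => by
    by_contra h
    have := hR (subset_tsupport g h)
    simp at this
    linarith
  obtain ⟨δ, hδ⟩ := isCompact_avgDom.exists_bound_of_continuousOn hθ.continuousOn
  have i1 : Integrable (Function.uncurry fun (x : E3) (ω : E3 × ℝ) => g x * (κ ω * f (x - θ ω)))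
      (volume.prod (volume.restrict avgDom)) := by
    refine integrable_prod_avgDom (R := R) ?_ fun x ω _ hx => by rw [hg0 x hx, zero_mul]
    simp only [Function.uncurry_def]
    fun_prop
  have e1 : ∀ x, g x * avg κ θ f x = ∫ ω in avgDom, g x * (κ ω * f (x - θ ω)) := fun x => by
    rw [avg, integral_const_mul]
  have e2 : ∀ x, avg κ (fun ω => - θ ω) g x * f x =
      ∫ ω in avgDom, g (x + θ ω) * (κ ω * f x) := fun x => by
    rw [avg, ← integral_mul_const]
    refine integral_congr_ae (.of_forall fun ω => ?_)
    simp only [sub_neg_eq_add]; ring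
  simp only [e1, e2]
  have i2 : Integrable (Function.uncurry fun (x : E3) (ω : E3 × ℝ) =>
      g (x + θ ω) * (κ ω * f x)) (volume.prod (volume.restrict avgDom)) := by
    refine integrable_prod_avgDom (R := R + δ) ?_ fun x ω hω hx => ?_
    · simp only [Function.uncurry_def]
      fun_prop
    · rw [hg0, zero_mul]
      have h1 := hδ ω hω
      have h2 : ‖x‖ ≤ ‖x + θ ω‖ + ‖θ ω‖ := by simpa using norm_sub_le (x + θ ω) (θ ω)
      linarith
  rw [integral_integral_swap i1, integral_integral_swap i2]
  refine integral_congr_ae (.of_forall fun ω => ?_)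
  dsimp only
  rw [← integral_add_right_eq_self (fun x => g x * (κ ω * f (x - θ ω))) (θ ω)]
  simp

end Averaging

section Mollifier

open scoped ENNReal

/-- A fixed bump function on the unit ball. -/
noncomputable def unitBump : ContDiffBump (0 : E3) := ⟨1 / 2, 1, by norm_num, by norm_num⟩

/-- The fixed mollification kernel. -/
noncomputable def kern : E3 → ℝ := unitBump.normed volume

lemma contDiff_kern {n : ℕ∞} : ContDiff ℝ n kern := unitBump.contDiff_normed

lemma continuous_kern : Continuous kern := unitBump.continuous_normed

lemma hasCompactSupport_kern : HasCompactSupport kern := unitBump.hasCompactSupport_normed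

lemma integral_kern : ∫ y, kern y = 1 := unitBump.integral_normed

lemma kern_eq_zero {y : E3} (hy : 1 ≤ ‖y‖) : kern y = 0 := by
  by_contra h
  have : y ∈ Function.support kern := h
  rw [kern, unitBump.support_normed_eq] at this
  simp [unitBump] at this
  linarith

/-- Translation by a fixed fraction of the parameter. -/
def fullShift (δ : ℝ) (ω : E3 × ℝ) : E3 := δ • ω.1

/-- Translation by a variable fraction of the parameter. -/
def rayShift (δ : ℝ) (ω : E3 × ℝ) : E3 := (ω.2 * δ) • ω.1

/-- The moments of the kernel. -/
noncomputable def moment (i : Fin 3) (ω : E3 × ℝ) : ℝ := kern ω.1 * ω.1 i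

lemma continuous_fullShift (δ : ℝ) : Continuous (fullShift δ) := by
  unfold fullShift; fun_prop

lemma continuous_rayShift (δ : ℝ) : Continuous (rayShift δ) := by
  unfold rayShift; fun_prop

lemma continuous_moment (i : Fin 3) : Continuous (moment i) := by
  have := continuous_kern
  unfold moment; fun_prop

lemma continuous_kern_fst : Continuous fun ω : E3 × ℝ => kern ω.1 := continuous_kern.comp continuous_fst

lemma continuous_pd_kern_fst (i : Fin 3) : Continuous fun ω : E3 × ℝ => pd kern i ω.1 :=
  (continuous_pd (contDiff_kern (n := 1)) i).comp continuous_fst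

lemma norm_fullShift_le {δ : ℝ} (hδ : 0 ≤ δ) : ∀ ω ∈ avgDom, ‖fullShift δ ω‖ ≤ δ := by
  intro ω hω
  have h1 : ‖ω.1‖ ≤ 1 := by simpa using hω.1
  rw [fullShift, norm_smul, Real.norm_eq_abs, abs_of_nonneg hδ]
  nlinarith

lemma norm_rayShift_le {δ : ℝ} (hδ : 0 ≤ δ) : ∀ ω ∈ avgDom, ‖rayShift δ ω‖ ≤ δ := by
  intro ω hω
  have h1 : ‖ω.1‖ ≤ 1 := by simpa using hω.1
  have h2 := hω.2.1
  have h3 := hω.2.2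
  rw [rayShift, norm_smul, Real.norm_eq_abs, abs_of_nonneg (mul_nonneg h2 hδ)]
  calc ω.2 * δ * ‖ω.1‖ ≤ 1 * δ * 1 := by gcongr
    _ = δ := by ring

lemma exists_kern_bound : ∃ k : ℝ, 0 < k ∧ ∀ ω ∈ avgDom, |kern ω.1| ≤ k ∧
    (∀ i, |pd kern i ω.1| ≤ k) ∧ ∀ i, |moment i ω| ≤ k := by
  obtain ⟨a, ha⟩ := isCompact_avgDom.exists_bound_of_continuousOn continuous_kern_fst.continuousOn
  choose b hb using fun i => isCompact_avgDom.exists_bound_of_continuousOn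
    (continuous_pd_kern_fst i).continuousOn
  choose c hc using fun i => isCompact_avgDom.exists_bound_of_continuousOn
    (continuous_moment i).continuousOn
  refine ⟨1 + |a| + ∑ i, |b i| + ∑ i, |c i|, ?_, fun ω hω => ⟨?_, fun i => ?_, fun i => ?_⟩⟩
  · positivity
  all_goals
    have s1 : 0 ≤ ∑ i, |b i| := by positivity
    have s2 : 0 ≤ ∑ i, |c i| := by positivity
    have s0 := abs_nonneg a
  · have := ha ω hω
    rw [Real.norm_eq_abs] at this
    linarith [le_abs_self a]
  · have := hb i ω hω
    rw [Real.norm_eq_abs] at this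
    have h2 := Finset.single_le_sum (f := fun i => |b i|) (fun i _ => abs_nonneg _) (Finset.mem_univ i)
    linarith [le_abs_self (b i)]
  · have := hc i ω hω
    rw [Real.norm_eq_abs] at this
    have h2 := Finset.single_le_sum (f := fun i => |c i|) (fun i _ => abs_nonneg _) (Finset.mem_univ i)
    linarith [le_abs_self (c i)]

lemma setIntegral_avgDom_fst {F : E3 → ℝ} (hF : ∀ y, 1 < ‖y‖ → F y = 0) :
    ∫ ω in avgDom, F ω.1 = ∫ y, F y := by
  have : ∫ ω in avgDom, F ω.1 = ∫ ω in avgDom, F ω.1 * (fun _ => (1:ℝ)) ω.2 := by simp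
  rw [this, avgDom, Measure.volume_eq_prod, setIntegral_prod_mul F (fun _ => (1:ℝ))]
  rw [setIntegral_eq_integral_of_forall_compl_eq_zero]
  · simp
  · intro y hy
    exact hF y (by simpa using hy)

variable {f : E3 → ℝ} {δ : ℝ}

lemma pd_comp_sub_smul (hf : ContDiff ℝ 1 f) (x : E3) (i : Fin 3) :
    pd (fun y => f (x - δ • y)) i = fun y => - δ * pd f i (x - δ • y) := by
  funext y
  have h1 := (hf.differentiable one_ne_zero (x - δ • y)).hasFDerivAt
  have h2 : HasFDerivAt (fun y : E3 => x - δ • y) (-(δ • ContinuousLinearMap.id ℝ E3)) y :=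
    ((hasFDerivAt_id y).const_smul δ).const_sub x
  have h3 : HasFDerivAt (fun y => f (x - δ • y)) _ y := h1.comp y h2
  rw [pd, h3.fderiv]
  simp [pd]

lemma avg_kern_pd (hf : ContDiff ℝ 1 f) (hδ : δ ≠ 0) (i : Fin 3) :
    avg (fun ω => kern ω.1) (fullShift δ) (pd f i) =
      fun x => δ⁻¹ * avg (fun ω => pd kern i ω.1) (fullShift δ) f x := by
  funext x
  have e0 : ∀ y, 1 < ‖y‖ → pd kern i y = 0 := fun y hy => by
    refine pd_eq_zero_of_notMem_tsupport (fun h => ?_) i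
    have : tsupport kern ⊆ Metric.closedBall 0 1 := by
      refine closure_minimal (fun z hz => ?_) Metric.isClosed_closedBall
      by_contra h
      exact hz (kern_eq_zero (by simp at h; linarith))
    have := this h
    simp at this
    linarith
  have e1 : avg (fun ω => kern ω.1) (fullShift δ) (pd f i) x =
      ∫ y, kern y * pd f i (x - δ • y) :=
    setIntegral_avgDom_fst (F := fun y => kern y * pd f i (x - δ • y))
      fun y hy => by rw [kern_eq_zero hy.le, zero_mul]
  have e2 : avg (fun ω => pd kern i ω.1) (fullShift δ) f x =
      ∫ y, pd kern i y * f (x - δ • y) :=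
    setIntegral_avgDom_fst (F := fun y => pd kern i y * f (x - δ • y))
      fun y hy => by rw [e0 y hy, zero_mul]
  have e3 := integral_mul_pd (f := fun y => f (x - δ • y)) (g := kern) (by fun_prop)
    (contDiff_kern (n := 1)) hasCompactSupport_kern i
  rw [pd_comp_sub_smul hf] at e3
  rw [e1, e2]
  simp only [mul_comm (pd kern i _)]
  rw [e3, ← integral_neg, ← integral_const_mul]
  refine integral_congr_ae (.of_forall fun y => ?_)
  field_simp

/-- A function is its mollification plus a sum of averages of its derivatives. -/
lemma eq_avg_add_sum (hf : ContDiff ℝ 1 f) (δ : ℝ) (x : E3) :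
    f x = avg (fun ω => kern ω.1) (fullShift δ) f x
      + δ * ∑ i, avg (moment i) (rayShift δ) (pd f i) x := by
  have hfc := hf.continuous
  have e1 : ∫ ω in avgDom, kern ω.1 * f x = f x := by
    rw [setIntegral_avgDom_fst (F := fun y => kern y * f x)
      fun y hy => by rw [kern_eq_zero hy.le, zero_mul], integral_mul_const, integral_kern, one_mul]
  have e2 : δ * ∑ i, avg (moment i) (rayShift δ) (pd f i) x =
      ∫ ω in avgDom, kern ω.1 * ∑ i, δ * ω.1 i * pd f i (x - (ω.2 * δ) • ω.1) := by
    simp only [avg]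
    rw [← integral_finsetSum _ fun i _ => integrable_avg (continuous_moment i)
      (continuous_rayShift δ) (continuous_pd hf i) x, ← integral_const_mul]
    refine integral_congr_ae (.of_forall fun ω => ?_)
    simp only [moment, rayShift, Finset.mul_sum]
    refine Finset.sum_congr rfl fun i _ => ?_
    ring
  have e3 : ∫ ω in avgDom, kern ω.1 * ∑ i, δ * ω.1 i * pd f i (x - (ω.2 * δ) • ω.1) =
      ∫ ω in avgDom, kern ω.1 * (f x - f (x - δ • ω.1)) := by
    have c1 : Continuous fun ω : E3 × ℝ =>
        kern ω.1 * ∑ i, δ * ω.1 i * pd f i (x - (ω.2 * δ) • ω.1) := by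
      have := continuous_kern
      have h2 := fun i => continuous_pd hf i
      fun_prop
    have c2 : Continuous fun ω : E3 × ℝ => kern ω.1 * (f x - f (x - δ • ω.1)) := by
      have := continuous_kern
      fun_prop
    have i1 := c1.continuousOn.integrableOn_compact (μ := volume) isCompact_avgDom
    have i2 := c2.continuousOn.integrableOn_compact (μ := volume) isCompact_avgDom
    rw [avgDom, Measure.volume_eq_prod] at i1 i2 ⊢
    rw [setIntegral_prod _ i1, setIntegral_prod _ i2]
    refine integral_congr_ae (.of_forall fun y => ?_)
    dsimp only
    rw [integral_const_mul, integral_const_mul]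
    congr 1
    rw [setIntegral_const]
    simp only [Real.volume_real_Icc, sub_zero, zero_le_one, sup_of_le_left, one_smul]
    rw [integral_Icc_eq_integral_Ioc, ← intervalIntegral.integral_of_le zero_le_one]
    have hd : ∀ t : ℝ, HasDerivAt (fun t : ℝ => - f (x - (t * δ) • y))
        (∑ i, δ * y i * pd f i (x - (t * δ) • y)) t := by
      intro t
      have h1 := (hf.differentiable one_ne_zero (x - (t * δ) • y)).hasFDerivAt
      have h2 : HasDerivAt (fun t : ℝ => x - (t * δ) • y) (-(δ • y)) t := by
        have := (((hasDerivAt_id t).mul_const δ).smul_const y).const_sub x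
        simpa using this
      have h3 := (h1.comp_hasDerivAt t h2).neg
      refine h3.congr_deriv ?_
      rw [map_neg, neg_neg, map_smul, fderiv_eq_sum_pd, smul_eq_mul, Finset.mul_sum]
      refine Finset.sum_congr rfl fun i _ => by ring
    rw [intervalIntegral.integral_eq_sub_of_hasDerivAt (fun t _ => hd t)]
    · simp only [one_mul, zero_mul, zero_smul, sub_zero]; ring
    · have h2 := fun i => continuous_pd hf i
      refine Continuous.intervalIntegrable ?_ _ _
      fun_prop
  rw [e2, e3]
  have e4 : ∫ ω in avgDom, kern ω.1 * (f x - f (x - δ • ω.1)) =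
      (∫ ω in avgDom, kern ω.1 * f x) - avg (fun ω => kern ω.1) (fullShift δ) f x := by
    rw [avg, ← integral_sub]
    · refine integral_congr_ae (.of_forall fun ω => ?_)
      simp only [fullShift]; ring
    · exact (continuous_kern_fst.mul continuous_const).continuousOn.integrableOn_compact
        isCompact_avgDom
    · exact integrable_avg continuous_kern_fst (continuous_fullShift δ) hfc x
  rw [e4, e1]
  ring

end Mollifier

section SmoothedPotential

open scoped ENNReal

lemma differentiable_of_contDiff_one {f : E3 → ℝ} (hf : ContDiff ℝ 1 f) : Differentiable ℝ f :=
  hf.differentiable one_ne_zero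

/-- Potentials of a scalar function at the smoothing scale `δ`. -/
theorem exists_smoothed_potential : ∃ K : ℝ, 1 ≤ K ∧ ∀ (u : E3 → ℝ) (G : Fin 3 → E3 → ℝ),
    (∀ i, ContDiff ℝ 2 (G i)) → ContDiff ℝ 1 u → (∀ x, u x = ∑ i, pd (G i) i x) →
    ∀ (δ : ℝ), 0 < δ → ∃ H : Fin 3 → E3 → ℝ, (∀ i, ContDiff ℝ 1 (H i)) ∧
      (∀ x, u x = ∑ i, pd (H i) i x) ∧
      (∀ (p : ℝ≥0∞) (ρ a b : ℝ) (i : Fin 3), 1 ≤ p → p ≠ ⊤ →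
        LpBound p (Metric.ball 0 (ρ + δ)) (G i) a → LpBound p (Metric.ball 0 (ρ + δ)) u b →
        LpBound p (Metric.ball 0 ρ) (H i) (K * (a + δ * b))) ∧
      (∀ (p : ℝ≥0∞) (ρ a b : ℝ) (i k : Fin 3), 1 ≤ p → p ≠ ⊤ →
        LpBound p (Metric.ball 0 (ρ + δ)) (G i) a → LpBound p (Metric.ball 0 (ρ + δ)) (pd u k) b →
        LpBound p (Metric.ball 0 ρ) (pd (H i) k) (K * (δ⁻¹ * a + δ * b))) := by
  obtain ⟨k, hk0, hk⟩ := exists_kern_bound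
  have hM := avgMass_nonneg
  refine ⟨k * avgMass + 1, by nlinarith, fun u G hG hu huG δ hδ => ?_⟩
  have hG1 : ∀ i, ContDiff ℝ 1 (G i) := fun i => (hG i).of_le one_le_two
  have hGp : ∀ i j, ContDiff ℝ 1 (pd (G i) j) := fun i j => contDiff_pd (hG i) (by norm_num) j
  set A : Fin 3 → E3 → ℝ := fun i => avg (fun ω => kern ω.1) (fullShift δ) (G i) with hA
  set T : Fin 3 → E3 → ℝ := fun i => avg (moment i) (rayShift δ) u with hT
  have hA1 : ∀ i, ContDiff ℝ 1 (A i) := fun i =>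
    contDiff_avg continuous_kern_fst (continuous_fullShift δ) (hG1 i)
  have hT1 : ∀ i, ContDiff ℝ 1 (T i) := fun i =>
    contDiff_avg (continuous_moment i) (continuous_rayShift δ) hu
  have hpdA : ∀ i j, pd (A i) j = avg (fun ω => kern ω.1) (fullShift δ) (pd (G i) j) := fun i j =>
    pd_avg continuous_kern_fst (continuous_fullShift δ) (hG1 i) j
  have hpdT : ∀ i j, pd (T i) j = avg (moment i) (rayShift δ) (pd u j) := fun i j =>
    pd_avg (continuous_moment i) (continuous_rayShift δ) hu j
  have hpdH : ∀ i j, pd (fun y => A i y + δ * T i y) j = fun x => pd (A i) j x + δ * pd (T i) j x := by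
    intro i j
    funext x
    rw [pd_add_apply (differentiable_of_contDiff_one (hA1 i) x)
      ((differentiable_of_contDiff_one (hT1 i) x).const_mul δ),
      pd_const_mul (differentiable_of_contDiff_one (hT1 i))]
  have kA : ∀ ω ∈ avgDom, |kern ω.1| ≤ k := fun ω hω => (hk ω hω).1
  have kA' : ∀ i, ∀ ω ∈ avgDom, |pd kern i ω.1| ≤ k := fun i ω hω => (hk ω hω).2.1 i
  have kT : ∀ i, ∀ ω ∈ avgDom, |moment i ω| ≤ k := fun i ω hω => (hk ω hω).2.2 i
  refine ⟨fun i x => A i x + δ * T i x, fun i => (hA1 i).add (contDiff_const.mul (hT1 i)),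
    fun x => ?_, fun p ρ a b i hp hp' ha hb => ?_, fun p ρ a b i j hp hp' ha hb => ?_⟩
  · simp only [hpdH, Finset.sum_add_distrib, ← Finset.mul_sum, hpdA, hpdT]
    rw [eq_avg_add_sum hu δ x]
    congr 1
    simp only [avg]
    rw [← integral_finsetSum _ fun i _ => integrable_avg continuous_kern_fst
      (continuous_fullShift δ) (continuous_pd (hG1 i) i) x]
    simp only [huG, Finset.mul_sum]
  · have h1 := lpBound_avg hp hp' continuous_kern_fst (continuous_fullShift δ) (hG1 i).continuous
      kA (norm_fullShift_le hδ.le) hk0.le ha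
    have h2 := lpBound_avg hp hp' (continuous_moment i) (continuous_rayShift δ) hu.continuous
      (kT i) (norm_rayShift_le hδ.le) hk0.le hb
    refine (h1.add hp (h2.const_mul δ)).mono ?_
    rw [abs_of_pos hδ]
    have := add_nonneg ha.nonneg (mul_nonneg hδ.le hb.nonneg)
    linarith
  · have h1 := lpBound_avg hp hp' (continuous_pd_kern_fst j) (continuous_fullShift δ)
      (hG1 i).continuous (kA' j) (norm_fullShift_le hδ.le) hk0.le ha
    have h2 := lpBound_avg hp hp' (continuous_moment i) (continuous_rayShift δ) (continuous_pd hu j)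
      (kT i) (norm_rayShift_le hδ.le) hk0.le hb
    rw [hpdH, hpdA, hpdT, avg_kern_pd (hG1 i) hδ.ne']
    refine ((h1.const_mul δ⁻¹).add hp (h2.const_mul δ)).mono ?_
    have hd := inv_pos.2 hδ
    rw [abs_of_pos hδ, abs_of_pos hd]
    have := add_nonneg (mul_nonneg hd.le ha.nonneg) (mul_nonneg hδ.le hb.nonneg)
    linarith

end SmoothedPotential

section Cutoff

lemma exists_deriv_bound {χ : ℝ → ℝ} (hχ : ContDiff ℝ (⊤ : ℕ∞) χ)
    (hc : HasCompactSupport (deriv χ)) : ∃ K, ∀ x, |deriv χ x| ≤ K := by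
  have h : Continuous (deriv χ) := hχ.continuous_deriv (by simp)
  obtain ⟨K, hK⟩ := hc.exists_bound_of_continuous h
  exact ⟨K, hK⟩

lemma hasCompactSupport_deriv_smoothTransition : HasCompactSupport (deriv Real.smoothTransition) := by
  refine HasCompactSupport.intro (K := Set.Icc 0 1) isCompact_Icc fun x hx => ?_
  rw [Set.mem_Icc, not_and_or, not_le, not_le] at hx
  rcases hx with hx | hx
  · have : Real.smoothTransition =ᶠ[nhds x] fun _ => 0 := by
      filter_upwards [Iio_mem_nhds hx] with y hy
      exact Real.smoothTransition.zero_of_nonpos (le_of_lt hy)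
    rw [this.deriv_eq]; simp
  · have : Real.smoothTransition =ᶠ[nhds x] fun _ => 1 := by
      filter_upwards [Ioi_mem_nhds hx] with y hy
      exact Real.smoothTransition.one_of_one_le (le_of_lt hy)
    rw [this.deriv_eq]; simp

lemma pd_comp {χ : ℝ → ℝ} {h : E3 → ℝ} (hχ : Differentiable ℝ χ) (hh : Differentiable ℝ h)
    (i : Fin 3) (x : E3) : pd (fun y => χ (h y)) i x = deriv χ (h x) * pd h i x := by
  have := ((hχ (h x)).hasDerivAt.comp_hasFDerivAt x (hh x).hasFDerivAt)
  have e : HasFDerivAt (fun y => χ (h y)) (deriv χ (h x) • fderiv ℝ h x) x := this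
  rw [pd, e.fderiv]
  simp [pd]

lemma pd_coord (i j : Fin 3) : pd (fun y : E3 => y j) i = fun _ => if i = j then 1 else 0 := by
  funext x
  have : HasFDerivAt (fun y : E3 => y j) (EuclideanSpace.proj j : E3 →L[ℝ] ℝ) x :=
    (EuclideanSpace.proj j : E3 →L[ℝ] ℝ).hasFDerivAt
  rw [pd, this.fderiv]
  simp [eq_comm]

lemma pd_norm_sq (i : Fin 3) : pd (fun y : E3 => ‖y‖ ^ 2) i = fun x => 2 * x i := by
  funext x
  have h : HasFDerivAt (fun y : E3 => ‖y‖ ^ 2) _ x := (hasStrictFDerivAt_norm_sq x).hasFDerivAt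
  rw [pd, h.fderiv]
  simp [EuclideanSpace.inner_single_right]

/-- Smooth cutoff functions between concentric balls, with bounds on three derivatives. -/
theorem exists_cutoff : ∃ K : ℝ, 1 ≤ K ∧ ∀ s t : ℝ, 0 ≤ s → s < t → ∃ φ : E3 → ℝ,
    ContDiff ℝ (⊤ : ℕ∞) φ ∧ HasCompactSupport φ ∧ (∀ x, 0 ≤ φ x) ∧ (∀ x, φ x ≤ 1) ∧
    (∀ x ∈ Metric.ball (0 : E3) s, φ x = 1) ∧ tsupport φ ⊆ Metric.ball (0 : E3) t ∧
    (∀ i x, |pd φ i x| ≤ K / (t - s)) ∧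
    (∀ i j x, |pd (pd φ i) j x| ≤ K / (t - s) ^ 2) ∧
    (∀ i j k x, |pd (pd (pd φ i) j) k x| ≤ K / (t - s) ^ 3) := by
  set χ := Real.smoothTransition with hχdef
  have h0 : ContDiff ℝ (⊤ : ℕ∞) χ := Real.smoothTransition.contDiff
  have h1 : ContDiff ℝ (⊤ : ℕ∞) (deriv χ) := (contDiff_infty_iff_deriv.1 h0).2
  have h2 : ContDiff ℝ (⊤ : ℕ∞) (deriv (deriv χ)) := (contDiff_infty_iff_deriv.1 h1).2
  have c1 := hasCompactSupport_deriv_smoothTransition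
  obtain ⟨K1, hK1⟩ := exists_deriv_bound h0 c1
  obtain ⟨K2, hK2⟩ := exists_deriv_bound h1 c1.deriv
  obtain ⟨K3, hK3⟩ := exists_deriv_bound h2 c1.deriv.deriv
  have K1n : 0 ≤ K1 := (abs_nonneg _).trans (hK1 0)
  have K2n : 0 ≤ K2 := (abs_nonneg _).trans (hK2 0)
  have K3n : 0 ≤ K3 := (abs_nonneg _).trans (hK3 0)
  refine ⟨1 + 8 * K1 + 112 * K2 + 64 * K3, by linarith, fun s t hs hst => ?_⟩
  set e : ℝ := (t - s) / 2 with he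
  have he0 : 0 < e := by rw [he]; linarith
  set τ : ℝ := s + e with hτ
  have hτ0 : 0 < τ := by linarith
  have hτt : τ < t := by rw [hτ, he]; linarith
  set L : ℝ := τ ^ 2 - s ^ 2 with hL
  have hL1 : e * τ ≤ L := by rw [hL, hτ]; nlinarith
  have hL2 : e ^ 2 ≤ L := by rw [hL, hτ]; nlinarith
  have hL0 : 0 < L := lt_of_lt_of_le (by positivity) hL2
  set h : E3 → ℝ := fun x => L⁻¹ * τ ^ 2 + - L⁻¹ * ‖x‖ ^ 2 with hh
  have hhx : ∀ x, h x = (τ ^ 2 - ‖x‖ ^ 2) / L := fun x => by simp only [hh]; field_simp; ring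
  have hns : ContDiff ℝ (⊤ : ℕ∞) fun x : E3 => ‖x‖ ^ 2 := contDiff_norm_sq ℝ
  have hhs : ContDiff ℝ (⊤ : ℕ∞) h := contDiff_const.add (contDiff_const.mul hns)
  have hhd : Differentiable ℝ h := hhs.differentiable (by simp)
  set l : Fin 3 → E3 → ℝ := fun i x => (-(2 * L⁻¹)) * x i with hl
  have hpdh : ∀ i, pd h i = l i := by
    intro i
    funext x
    simp only [hh]
    rw [pd_add_apply (differentiableAt_const _) ((hns.differentiable (by simp) x).const_mul _),
      pd_const, pd_const_mul (hns.differentiable (by simp)), pd_norm_sq]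
    simp only [hl]; ring
  have hld : ∀ i, Differentiable ℝ (l i) := fun i => by simp only [hl]; fun_prop
  have hpdl : ∀ i j, pd (l i) j = fun _ => (-(2 * L⁻¹)) * if j = i then 1 else 0 := by
    intro i j
    simp only [hl]
    rw [pd_const_mul (by fun_prop), pd_coord]
  have comp_d : ∀ {η : ℝ → ℝ}, ContDiff ℝ (⊤ : ℕ∞) η → Differentiable ℝ fun y => η (h y) :=
    fun hη => (hη.differentiable (by simp)).comp hhd
  have comp_pd : ∀ {η : ℝ → ℝ}, ContDiff ℝ (⊤ : ℕ∞) η → ∀ i,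
      pd (fun y => η (h y)) i = fun y => deriv η (h y) * l i y := by
    intro η hη i
    funext y
    rw [pd_comp (hη.differentiable (by simp)) hhd, hpdh]
  set φ : E3 → ℝ := fun x => χ (h x) with hφ
  have hφs : ContDiff ℝ (⊤ : ℕ∞) φ := h0.comp hhs
  have hsupp : tsupport φ ⊆ Metric.closedBall 0 τ := by
    refine closure_minimal (fun x hx => ?_) Metric.isClosed_closedBall
    by_contra hn
    refine hx ?_
    refine Real.smoothTransition.zero_of_nonpos ?_
    rw [hhx]
    have : τ < ‖x‖ := by simpa using hn
    refine div_nonpos_of_nonpos_of_nonneg ?_ hL0.le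
    nlinarith
  have d1 : ∀ i, pd φ i = fun x => deriv χ (h x) * l i x := comp_pd h0
  have d2 : ∀ i j, pd (pd φ i) j = fun x => deriv (deriv χ) (h x) * l j x * l i x +
      deriv χ (h x) * pd (l i) j x := by
    intro i j
    funext x
    rw [d1, pd_mul_apply (comp_d h1 x) (hld i x), comp_pd h1]
  have d3 : ∀ i j k x, pd (pd (pd φ i) j) k x =
      (deriv (deriv (deriv χ)) (h x) * l k x * l j x + deriv (deriv χ) (h x) * pd (l j) k x) * l i x
        + deriv (deriv χ) (h x) * l j x * pd (l i) k x + deriv (deriv χ) (h x) * l k x * pd (l i) j x := by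
    intro i j k x
    have g2 : DifferentiableAt ℝ (fun x => deriv (deriv χ) (h x)) x := comp_d h2 x
    have g1 : DifferentiableAt ℝ (fun x => deriv χ (h x)) x := comp_d h1 x
    have g3 : DifferentiableAt ℝ (pd (l i) j) x := by rw [hpdl]; exact differentiableAt_const _
    have g4 : DifferentiableAt ℝ (fun x => deriv (deriv χ) (h x) * l j x) x := g2.mul (hld j x)
    have g5 : DifferentiableAt ℝ (fun x => deriv (deriv χ) (h x) * l j x * l i x) x :=
      g4.mul (hld i x)
    have g6 : DifferentiableAt ℝ (fun x => deriv χ (h x) * pd (l i) j x) x := g1.mul g3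
    have e1 := pd_mul_apply g4 (hld i x) k
    have e2 := pd_mul_apply g2 (hld j x) k
    have e3 := pd_mul_apply g1 g3 k
    have e4 : pd (pd (l i) j) k x = 0 := by rw [hpdl i j, pd_const]
    rw [d2, pd_add_apply g5 g6, e1, e2, e3, e4, comp_pd h2, comp_pd h1, mul_zero, add_zero]
  have hl1 : ∀ i x, ‖x‖ ≤ τ → |l i x| ≤ 2 / e := by
    intro i x hx
    have hxi : |x i| ≤ ‖x‖ := by simpa using PiLp.norm_apply_le x i
    simp only [hl]
    rw [abs_mul, abs_neg, abs_of_pos (by positivity), le_div_iff₀ he0]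
    calc 2 * L⁻¹ * |x i| * e ≤ 2 * L⁻¹ * τ * e := by gcongr; exact hxi.trans hx
      _ = 2 * (L⁻¹ * (e * τ)) := by ring
      _ ≤ 2 * (L⁻¹ * L) := by gcongr
      _ = 2 := by rw [inv_mul_cancel₀ hL0.ne', mul_one]
  have hl2 : ∀ i j x, |pd (l i) j x| ≤ 2 / e ^ 2 := by
    intro i j x
    rw [hpdl]
    dsimp only
    rw [abs_mul, abs_neg, abs_of_pos (by positivity), le_div_iff₀ (by positivity)]
    have : |(if j = i then (1:ℝ) else 0)| ≤ 1 := by split_ifs <;> simp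
    calc 2 * L⁻¹ * |if j = i then (1:ℝ) else 0| * e ^ 2 ≤ 2 * L⁻¹ * 1 * L := by gcongr
      _ = 2 := by field_simp
  have far : ∀ x, ¬ ‖x‖ ≤ τ → x ∉ tsupport φ := fun x hx hx' => hx (by simpa using hsupp hx')
  have he2 : t - s = 2 * e := by rw [he]; ring
  have hKe : ∀ n : ℕ, 0 ≤ (1 + 8 * K1 + 112 * K2 + 64 * K3) / (t - s) ^ n := fun n => by
    rw [he2]; positivity
  refine ⟨φ, hφs, ?_, fun x => Real.smoothTransition.nonneg _, fun x => Real.smoothTransition.le_one _,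
    fun x hx => ?_, hsupp.trans (Metric.closedBall_subset_ball hτt), fun i x => ?_, fun i j x => ?_,
    fun i j k x => ?_⟩
  · exact (isCompact_closedBall _ _).of_isClosed_subset (isClosed_tsupport _) hsupp
  · refine Real.smoothTransition.one_of_one_le ?_
    rw [hhx, le_div_iff₀ hL0, hL]
    have : ‖x‖ < s := by simpa using hx
    nlinarith [norm_nonneg x]
  · by_cases hx : ‖x‖ ≤ τ
    · rw [d1]
      calc |deriv χ (h x) * l i x| ≤ K1 * (2 / e) := by
            rw [abs_mul]; exact mul_le_mul (hK1 _) (hl1 i x hx) (abs_nonneg _) K1n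
        _ = (4 * K1) / (t - s) := by rw [he2]; field_simp; ring
        _ ≤ _ := by
          refine div_le_div_of_nonneg_right ?_ (by linarith)
          linarith
    · rw [pd_eq_zero_of_notMem_tsupport (far x hx), abs_zero]
      simpa using hKe 1
  · by_cases hx : ‖x‖ ≤ τ
    · rw [d2]
      calc |deriv (deriv χ) (h x) * l j x * l i x + deriv χ (h x) * pd (l i) j x|
          ≤ K2 * (2 / e) * (2 / e) + K1 * (2 / e ^ 2) := by
            refine (abs_add_le _ _).trans ?_
            simp only [abs_mul]
            have := hK1 (h x)
            have := hK2 (h x)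
            have := hl1 i x hx
            have := hl1 j x hx
            have := hl2 i j x
            gcongr
        _ = (16 * K2 + 8 * K1) / (t - s) ^ 2 := by rw [he2]; field_simp; ring
        _ ≤ _ := by
          refine div_le_div_of_nonneg_right ?_ (by positivity)
          linarith
    · rw [pd_eq_zero_of_notMem_tsupport (fun hm => far x hx (tsupport_pd_subset _ hm)), abs_zero]
      exact hKe 2
  · by_cases hx : ‖x‖ ≤ τ
    · rw [d3]
      calc _ ≤ (K3 * (2 / e) * (2 / e) + K2 * (2 / e ^ 2)) * (2 / e) + K2 * (2 / e) * (2 / e ^ 2)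
            + K2 * (2 / e) * (2 / e ^ 2) := by
            have := hK3 (h x)
            have := hK2 (h x)
            have := hl1 i x hx
            have := hl1 j x hx
            have := hl1 k x hx
            have := hl2 i j x
            have := hl2 i k x
            have := hl2 j k x
            refine (abs_add_le _ _).trans (add_le_add ((abs_add_le _ _).trans (add_le_add ?_ ?_)) ?_)
            · rw [abs_mul]
              refine mul_le_mul ((abs_add_le _ _).trans ?_) ‹_› (abs_nonneg _) (by positivity)
              simp only [abs_mul]
              gcongr
            · simp only [abs_mul]
              gcongr
            · simp only [abs_mul]
              gcongr
        _ = (64 * K3 + 96 * K2) / (t - s) ^ 3 := by rw [he2]; field_simp; ring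
        _ ≤ _ := by
          refine div_le_div_of_nonneg_right ?_ (by rw [he2]; positivity)
          linarith
    · rw [pd_eq_zero_of_notMem_tsupport (fun hm => far x hx (tsupport_pd_subset _
        (tsupport_pd_subset _ hm))), abs_zero]
      exact hKe 3

end Cutoff

section MeanZero

open scoped ENNReal

/-- A quantitative weak bound on the gradient of `q` tested against functions supported in a
ball. -/
def GradBound (q : E3 → ℝ) (ρ S Y : ℝ) : Prop :=
  ∀ (i : Fin 3) (w : E3 → ℝ) (D W : ℝ), ContDiff ℝ 1 w →
    (∀ x, x ∉ Metric.ball (0 : E3) ρ → w x = 0) →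
    (∀ k, LpBound 2 (Metric.ball 0 ρ) (pd w k) D) → LpBound 6 (Metric.ball 0 ρ) w W →
    |∫ x, pd q i x * w x| ≤ S * D + Y * W

lemma hasCompactSupport_of_eq_zero {w : E3 → ℝ} {ρ : ℝ}
    (hw : ∀ x, x ∉ Metric.ball (0 : E3) ρ → w x = 0) : HasCompactSupport w := by
  refine HasCompactSupport.intro (isCompact_closedBall (0 : E3) ρ) fun x hx => hw x fun h => ?_
  exact hx (Metric.ball_subset_closedBall h)

lemma tsupport_subset_closedBall_of_eq_zero {w : E3 → ℝ} {ρ : ℝ}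
    (hw : ∀ x, x ∉ Metric.ball (0 : E3) ρ → w x = 0) : tsupport w ⊆ Metric.closedBall 0 ρ := by
  refine closure_minimal (fun x hx => ?_) Metric.isClosed_closedBall
  by_contra h
  exact hx (hw x fun h' => h (Metric.ball_subset_closedBall h'))

/-- The rescaled kernel centred at `z`. -/
noncomputable def scaledKern (η : ℝ) (z x : E3) : ℝ := η⁻¹ ^ 3 * kern (η⁻¹ • z - η⁻¹ • x)

lemma contDiff_scaledKern (η : ℝ) (z : E3) : ContDiff ℝ 1 (scaledKern η z) := by
  have := contDiff_kern (n := 1)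
  unfold scaledKern
  exact contDiff_const.mul (this.comp (by fun_prop))

lemma pd_scaledKern (η : ℝ) (z : E3) (i : Fin 3) :
    pd (scaledKern η z) i = fun x => - η⁻¹ ^ 4 * pd kern i (η⁻¹ • z - η⁻¹ • x) := by
  have h := contDiff_kern (n := 1)
  have hd : ContDiff ℝ 1 (fun x => kern (η⁻¹ • z - η⁻¹ • x)) := h.comp (by fun_prop)
  unfold scaledKern
  rw [pd_const_mul (differentiable_of_contDiff_one hd),
    pd_comp_sub_smul h]
  funext x
  ring

lemma scaledKern_eq_zero {η : ℝ} (hη : 0 < η) {z x : E3} (h : η ≤ ‖z - x‖) :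
    scaledKern η z x = 0 := by
  rw [scaledKern, kern_eq_zero, mul_zero]
  rw [← smul_sub, norm_smul, Real.norm_eq_abs, abs_of_pos (inv_pos.2 hη), inv_mul_eq_div,
    le_div_iff₀ hη, one_mul]
  exact h

lemma exists_kern_bound_univ : ∃ k : ℝ, 0 < k ∧ ∀ y, |kern y| ≤ k ∧ ∀ i, |pd kern i y| ≤ k := by
  obtain ⟨a, ha⟩ := hasCompactSupport_kern.exists_bound_of_continuous continuous_kern
  choose b hb using fun i => (hasCompactSupport_pd hasCompactSupport_kern i).exists_bound_of_continuous
    (continuous_pd (contDiff_kern (n := 1)) i)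
  refine ⟨1 + |a| + ∑ i, |b i|, by positivity, fun y => ⟨?_, fun i => ?_⟩⟩
  · have := ha y
    rw [Real.norm_eq_abs] at this
    have s1 : 0 ≤ ∑ i, |b i| := by positivity
    linarith [le_abs_self a]
  · have := hb i y
    rw [Real.norm_eq_abs] at this
    have h2 := Finset.single_le_sum (f := fun i => |b i|) (fun i _ => abs_nonneg _)
      (Finset.mem_univ i)
    linarith [le_abs_self (b i), abs_nonneg a]

lemma avg_kern_eq_integral {η : ℝ} (hη : 0 < η) (f : E3 → ℝ) (z : E3) :
    avg (fun ω => kern ω.1) (fullShift η) f z = ∫ x, f x * scaledKern η z x := by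
  have e1 : avg (fun ω => kern ω.1) (fullShift η) f z = ∫ y, kern y * f (z - η • y) :=
    setIntegral_avgDom_fst (F := fun y => kern y * f (z - η • y))
      fun y hy => by rw [kern_eq_zero hy.le, zero_mul]
  set F : E3 → ℝ := fun y => kern y * f (z - η • y) with hF
  have e2 : ∫ x, f x * scaledKern η z x = ∫ x, η⁻¹ ^ 3 * F (η⁻¹ • (z - x)) := by
    refine integral_congr_ae (.of_forall fun x => ?_)
    simp only [hF, scaledKern, smul_smul, mul_inv_cancel₀ hη.ne', one_smul, sub_sub_cancel, smul_sub]
    ring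
  rw [e1, e2, integral_const_mul, integral_sub_left_eq_self (fun x => F (η⁻¹ • x)) volume z,
    Measure.integral_comp_smul]
  have : Module.finrank ℝ E3 = 3 := by simp
  rw [this, abs_of_pos (by positivity), smul_eq_mul, ← mul_assoc, mul_inv_cancel₀ (by positivity),
    one_mul]

/-- Pairing of `q` with a mean-zero function, controlled by the weak gradient bound. -/
theorem exists_abs_integral_mul_le_of_integral_eq_zero : ∃ K : ℝ, 1 ≤ K ∧
    ∀ (m s d l S Y : ℝ) (q g : E3 → ℝ) (c₂ c₆ : ℝ), 1 ≤ m → 0 < d → 1 ≤ l → d * l = m ^ 6 →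
    s + d ≤ 2 * m ^ 6 → 0 ≤ S → 0 ≤ Y → ContDiff ℝ 1 q → GradBound q (s + 3 * d / 8) S Y →
    ContDiff ℝ 1 g → tsupport g ⊆ Metric.ball (0 : E3) (s + d / 4) → ∫ x, g x = 0 →
    (∀ k, LpBound 2 (Metric.ball 0 (s + d / 4)) (pd g k) c₂) →
    LpBound 6 (Metric.ball 0 (s + d / 4)) g c₆ →
    |∫ x, q x * g x| ≤ K * l ^ 4 * m ^ 6 * (S * (c₂ + c₆) + Y * c₆) := by
  obtain ⟨V, hV1, hV⟩ := exists_lpBound_ball_compare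
  obtain ⟨V', hV1', hV'⟩ := exists_lpBound_ball_of_bdd
  obtain ⟨k, hk0, hk⟩ := exists_kern_bound
  obtain ⟨k', hk0', hk'⟩ := exists_kern_bound_univ
  have hM := avgMass_nonneg
  refine ⟨1 + 3 * (k * avgMass) + V * (2 * 3 * (V' * (8 ^ 4 * k'))), ?_, ?_⟩
  · have : 0 ≤ k * avgMass := by positivity
    have : 0 ≤ V * (2 * 3 * (V' * (8 ^ 4 * k'))) := by positivity
    linarith
  intro m s d l S Y q g c₂ c₆ hm hd hl hdl hsd hS hY hq hqB hg hgs hgi hc₂ hc₆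
  have hg0 : ∀ x, x ∉ Metric.ball (0 : E3) (s + d / 4) → g x = 0 := fun x hx =>
    image_eq_zero_of_notMem_tsupport fun h => hx (hgs h)
  set η : ℝ := d / 8 with hηd
  have hη : 0 < η := by positivity
  have hη1 : η⁻¹ = 8 * l / m ^ 6 := by rw [hηd, ← hdl]; field_simp
  have hηm : η ≤ m ^ 6 := by
    rw [hηd, ← hdl]; nlinarith
  have hc2 : 0 ≤ c₂ := (hc₂ 0).nonneg
  have hc6 : 0 ≤ c₆ := hc₆.nonneg
  have hgc : HasCompactSupport g := hasCompactSupport_of_eq_zero hg0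
  -- splitting of `q` into its mollification and a remainder
  set Q : E3 → ℝ := avg (fun ω => kern ω.1) (fullShift η) q with hQ
  have hQ1 : ContDiff ℝ 1 Q := contDiff_avg continuous_kern_fst (continuous_fullShift η) hq
  have cT : ∀ i, Continuous (avg (moment i) (rayShift η) (pd q i)) := fun i =>
    continuous_avg (continuous_moment i) (continuous_rayShift η) (continuous_pd hq i)
  have split : ∫ x, q x * g x = (∫ x, g x * Q x) +
      η * ∑ i, ∫ x, g x * avg (moment i) (rayShift η) (pd q i) x := by
    rw [← integral_finsetSum, ← integral_const_mul, ← integral_add]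
    · refine integral_congr_ae (.of_forall fun x => ?_)
      dsimp only
      conv_lhs => rw [eq_avg_add_sum hq η x]
      rw [← Finset.mul_sum]
      ring
    · exact (hg.continuous.mul hQ1.continuous).integrable_of_hasCompactSupport hgc.mul_right
    · refine Integrable.const_mul ?_ _
      exact integrable_finsetSum _ fun i _ =>
        (hg.continuous.mul (cT i)).integrable_of_hasCompactSupport hgc.mul_right
    · exact fun i _ => (hg.continuous.mul (cT i)).integrable_of_hasCompactSupport hgc.mul_right
  have ball_sub : s + 3 * d / 8 = s + d / 4 + η := by rw [hηd]; ring
  -- the remainder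
  have remainder : ∀ i, |∫ x, g x * avg (moment i) (rayShift η) (pd q i) x| ≤
      k * avgMass * (S * c₂ + Y * c₆) := by
    intro i
    rw [integral_mul_avg (continuous_moment i) (continuous_rayShift η) (continuous_pd hq i)
      hg.continuous hgc]
    set θ' : E3 × ℝ → E3 := fun ω => - rayShift η ω with hθ'
    have cθ : Continuous θ' := (continuous_rayShift η).neg
    have nθ : ∀ ω ∈ avgDom, ‖θ' ω‖ ≤ η := fun ω hω => by
      rw [hθ', norm_neg]; exact norm_rayShift_le hη.le ω hω
    have kT : ∀ ω ∈ avgDom, |moment i ω| ≤ k := fun ω hω => (hk ω hω).2.2 i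
    have big : ∀ {p : ℝ≥0∞} {f : E3 → ℝ} {a : ℝ}, (∀ x, x ∉ Metric.ball (0 : E3) (s + d / 4) →
        f x = 0) → LpBound p (Metric.ball 0 (s + d / 4)) f a →
        LpBound p (Metric.ball 0 (s + 3 * d / 8 + η)) f a := fun h0 h =>
      (h.univ_of_eq_zero measurableSet_ball h0).mono_set (Set.subset_univ _)
    have pd0 : ∀ j x, x ∉ Metric.ball (0 : E3) (s + d / 4) → pd g j x = 0 := fun j x hx =>
      pd_eq_zero_of_notMem_tsupport (fun h => hx (hgs h)) j
    have := hqB i (avg (moment i) θ' g) (k * avgMass * c₂) (k * avgMass * c₆)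
      (contDiff_avg (continuous_moment i) cθ hg) ?_ ?_ ?_
    · refine le_trans (le_of_eq ?_) (this.trans (le_of_eq (by ring)))
      simp only [mul_comm]
    · intro x hx
      refine avg_eq_zero fun ω hω => hg0 _ fun hmem => hx ?_
      rw [mem_ball_zero_iff] at hmem ⊢
      have h1 := nθ ω hω
      have h2 : ‖x‖ ≤ ‖x - θ' ω‖ + ‖θ' ω‖ := by simpa using norm_add_le (x - θ' ω) (θ' ω)
      rw [ball_sub]; linarith
    · intro j
      rw [pd_avg (continuous_moment i) cθ hg]
      exact lpBound_avg (by norm_num) (by simp) (continuous_moment i) cθ (continuous_pd hg j) kT nθ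
        hk0.le (big (pd0 j) (hc₂ j))
    · exact lpBound_avg (by norm_num) (by simp) (continuous_moment i) cθ hg.continuous kT nθ
        hk0.le (big hg0 hc₆)
  -- the mollified part
  set G : ℝ := V' * (8 ^ 4 * k') * (l ^ 4 * (S + Y) / m ^ 15) with hG
  have hG0 : 0 ≤ G := by positivity
  have gradQ : ∀ z ∈ Metric.ball (0 : E3) (s + d / 4), ∀ i, |pd Q i z| ≤ G := by
    intro z hz i
    rw [hQ, pd_avg continuous_kern_fst (continuous_fullShift η) hq, avg_kern_eq_integral hη]
    have hR : s + 3 * d / 8 ≤ 2 * m ^ 6 := by linarith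
    have bw := hV' m (s + 3 * d / 8) (by linarith) hR 0 6 3 (by norm_num) (by norm_num)
      (scaledKern η z) (η⁻¹ ^ 3 * k') (contDiff_scaledKern η z).continuous.aestronglyMeasurable
      (by positivity) (fun y _ => by
        rw [scaledKern, abs_mul, abs_of_pos (by positivity)]
        gcongr
        exact (hk' _).1)
    have bdw : ∀ j, LpBound 2 (Metric.ball 0 (s + 3 * d / 8)) (pd (scaledKern η z) j) _ :=
      fun j => hV' m (s + 3 * d / 8) (by linarith) hR 0 2 9 (by norm_num) (by norm_num)
      (pd (scaledKern η z) j) (η⁻¹ ^ 4 * k')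
      (continuous_pd (contDiff_scaledKern η z) j).aestronglyMeasurable
      (by positivity) (fun y _ => by
        rw [pd_scaledKern, abs_mul, abs_neg, abs_of_pos (by positivity)]
        gcongr
        exact (hk' _).2 j)
    refine (hqB i (scaledKern η z) _ _ (contDiff_scaledKern η z) ?_ bdw bw).trans ?_
    · intro x hx
      refine scaledKern_eq_zero hη ?_
      rw [mem_ball_zero_iff] at hx hz
      have : ‖x‖ ≤ ‖z‖ + ‖z - x‖ := by
        have := norm_sub_le z (z - x)
        simpa using this
      linarith
    · have hm0 : 0 < m := by linarith
      rw [hη1, hG]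
      have hl3 : l ^ 3 ≤ l ^ 4 := pow_le_pow_right₀ hl (by norm_num)
      calc S * (V' * m ^ 9 * ((8 * l / m ^ 6) ^ 4 * k')) + Y * (V' * m ^ 3 * ((8 * l / m ^ 6) ^ 3 * k'))
          = V' * k' * (8 ^ 4 * l ^ 4 * S + 8 ^ 3 * l ^ 3 * Y) / m ^ 15 := by field_simp
        _ ≤ V' * k' * (8 ^ 4 * l ^ 4 * S + 8 ^ 4 * l ^ 4 * Y) / m ^ 15 := by gcongr <;> norm_num
        _ = _ := by ring
  have main : |∫ x, g x * Q x| ≤ (2 * m ^ 6 * (3 * G)) * (V * m ^ 15 * c₆) := by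
    have e : ∫ x, g x * Q x = ∫ x, (Q x - Q 0) * g x := by
      have : ∀ x, (Q x - Q 0) * g x = g x * Q x - Q 0 * g x := fun x => by ring
      simp only [this]
      rw [integral_sub, integral_const_mul, hgi, mul_zero, sub_zero]
      · exact (hg.continuous.mul hQ1.continuous).integrable_of_hasCompactSupport hgc.mul_right
      · exact (hg.continuous.integrable_of_hasCompactSupport hgc).const_mul _
    rw [e]
    have h1 := hV m (s + d / 4) (by linarith) (by linarith) 0 1 6 15 (by norm_num) (by norm_num)
      (by norm_num) g c₆ hc₆
    refine (h1.bdd_mul measurableSet_ball (f := fun x => Q x - Q 0) (c := 2 * m ^ 6 * (3 * G))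
      (hQ1.continuous.sub continuous_const).aestronglyMeasurable ?_
      (by positivity)).abs_integral_le_of_eq_zero fun x hx => by rw [hg0 x hx, mul_zero]
    intro x hx
    have hx' := mem_ball_zero_iff.1 hx
    have h0 : (0 : E3) ∈ Metric.ball (0 : E3) (s + d / 4) :=
      Metric.mem_ball_self ((norm_nonneg x).trans_lt hx')
    have := (convex_ball (0 : E3) (s + d / 4)).norm_image_sub_le_of_norm_fderiv_le (𝕜 := ℝ)
      (f := Q) (C := 3 * G) (fun y _ => hQ1.differentiable one_ne_zero y)
      (fun y hy => (norm_fderiv_le_sum y).trans ?_) h0 hx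
    · rw [Real.norm_eq_abs, sub_zero] at this
      refine this.trans ?_
      rw [mul_comm]
      gcongr
      linarith
    · refine (Finset.sum_le_sum fun i _ => gradQ y hy i).trans ?_
      simp
  rw [split]
  have hm0 : 0 < m := by linarith
  have rem2 : |η * ∑ i, ∫ x, g x * avg (moment i) (rayShift η) (pd q i) x| ≤
      m ^ 6 * (3 * (k * avgMass * (S * c₂ + Y * c₆))) := by
    rw [abs_mul, abs_of_pos hη]
    gcongr
    refine (Finset.abs_sum_le_sum_abs _ _).trans ((Finset.sum_le_sum fun i _ => remainder i).trans ?_)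
    simp
  refine (abs_add_le _ _).trans ((add_le_add main rem2).trans ?_)
  have hl4 : 1 ≤ l ^ 4 := one_le_pow₀ hl
  have e1 : 2 * m ^ 6 * (3 * G) * (V * m ^ 15 * c₆) =
      (V * (2 * 3 * (V' * (8 ^ 4 * k')))) * l ^ 4 * m ^ 6 * (S * c₆ + Y * c₆) := by
    rw [hG]; field_simp
  have e2 : m ^ 6 * (3 * (k * avgMass * (S * c₂ + Y * c₆))) =
      (3 * (k * avgMass)) * 1 * m ^ 6 * (S * c₂ + Y * c₆) := by ring
  rw [e1, e2]
  have t1 : S * c₆ + Y * c₆ ≤ S * (c₂ + c₆) + Y * c₆ := by nlinarith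
  have t2 : S * c₂ + Y * c₆ ≤ S * (c₂ + c₆) + Y * c₆ := by nlinarith
  have t0 : 0 ≤ S * (c₂ + c₆) + Y * c₆ := by positivity
  set T := S * (c₂ + c₆) + Y * c₆ with hT
  calc _ ≤ (V * (2 * 3 * (V' * (8 ^ 4 * k')))) * l ^ 4 * m ^ 6 * T
        + (3 * (k * avgMass)) * l ^ 4 * m ^ 6 * T := by gcongr
    _ ≤ (V * (2 * 3 * (V' * (8 ^ 4 * k')))) * l ^ 4 * m ^ 6 * T
        + (3 * (k * avgMass)) * l ^ 4 * m ^ 6 * T + l ^ 4 * m ^ 6 * T := by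
        have : 0 ≤ l ^ 4 * m ^ 6 * T := by positivity
        linarith
    _ = _ := by ring

end MeanZero

section CutoffFlux

open scoped ENNReal

/-- Smooth cutoffs equal to one on the ball of radius `s`, supported in the ball of radius `t`,
with derivatives controlled by powers of `c`. -/
structure IsCutoff (s t c : ℝ) (φ : E3 → ℝ) : Prop where
  contDiff : ContDiff ℝ (⊤ : ℕ∞) φ
  nonneg : ∀ x, 0 ≤ φ x
  le_one : ∀ x, φ x ≤ 1
  eq_one : ∀ x ∈ Metric.ball (0 : E3) s, φ x = 1
  tsupport_subset : tsupport φ ⊆ Metric.ball (0 : E3) t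
  abs_pd : ∀ i x, |pd φ i x| ≤ c
  abs_pd_pd : ∀ i j x, |pd (pd φ i) j x| ≤ c ^ 2
  abs_pd_pd_pd : ∀ i j k x, |pd (pd (pd φ i) j) k x| ≤ c ^ 3

namespace IsCutoff

variable {s t c : ℝ} {φ : E3 → ℝ}

lemma eq_zero (h : IsCutoff s t c φ) {x : E3} (hx : x ∉ Metric.ball (0 : E3) t) : φ x = 0 :=
  image_eq_zero_of_notMem_tsupport fun h' => hx (h.tsupport_subset h')

lemma pd_eq_zero (h : IsCutoff s t c φ) {x : E3} (hx : x ∉ Metric.ball (0 : E3) t) (i : Fin 3) :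
    pd φ i x = 0 :=
  pd_eq_zero_of_notMem_tsupport (fun h' => hx (h.tsupport_subset h')) i

lemma hasCompactSupport (h : IsCutoff s t c φ) : HasCompactSupport φ :=
  hasCompactSupport_of_eq_zero fun _ hx => h.eq_zero hx

lemma contDiff_one (h : IsCutoff s t c φ) : ContDiff ℝ 1 φ := h.contDiff.of_le (by norm_cast)

lemma contDiff_pd (h : IsCutoff s t c φ) (i : Fin 3) : ContDiff ℝ 1 (pd φ i) :=
  (contDiff_pd_top h.contDiff i).of_le (by norm_cast)

lemma contDiff_pd_pd (h : IsCutoff s t c φ) (i j : Fin 3) : ContDiff ℝ 1 (pd (pd φ i) j) :=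
  (contDiff_pd_top (contDiff_pd_top h.contDiff i) j).of_le (by norm_cast)

lemma tsupport_pd (h : IsCutoff s t c φ) (i : Fin 3) : tsupport (pd φ i) ⊆ Metric.ball (0 : E3) t :=
  (tsupport_pd_subset i).trans h.tsupport_subset

lemma abs_le_one (h : IsCutoff s t c φ) (x : E3) : |φ x| ≤ 1 := by
  rw [abs_of_nonneg (h.nonneg x)]; exact h.le_one x

lemma const_nonneg (h : IsCutoff s t c φ) : 0 ≤ c := (abs_nonneg _).trans (h.abs_pd 0 0)

end IsCutoff

theorem exists_isCutoff : ∃ κ : ℝ, 1 ≤ κ ∧ ∀ (m d l s t : ℝ), 0 < m → 0 < d → d * l = m ^ 6 →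
    0 ≤ s → d / 8 ≤ t - s → ∃ φ : E3 → ℝ, IsCutoff s t (κ * l / m ^ 6) φ := by
  obtain ⟨K, hK, h⟩ := exists_cutoff
  refine ⟨8 * K, by linarith, fun m d l s t hm hd hdl hs hst => ?_⟩
  obtain ⟨φ, h1, -, h3, h4, h5, h6, h7, h8, h9⟩ := h s t hs (by linarith)
  have hts : 0 < t - s := by linarith
  have hc : K / (t - s) ≤ 8 * K * l / m ^ 6 := by
    have hl : 8 * K * l / m ^ 6 = K / (d / 8) := by
      have : 0 < m ^ 6 := by positivity
      have hl0 : l ≠ 0 := by rintro rfl; rw [mul_zero] at hdl; linarith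
      rw [← hdl]; field_simp
    rw [hl]
    gcongr
  have hc0 : 0 ≤ K / (t - s) := by positivity
  refine ⟨φ, h1, h3, h4, h5, h6, fun i x => (h7 i x).trans hc, fun i j x => (h8 i j x).trans ?_,
    fun i j k x => (h9 i j k x).trans ?_⟩
  · refine le_trans ?_ (pow_le_pow_left₀ hc0 hc 2)
    rw [div_pow]
    gcongr
    nlinarith
  · refine le_trans ?_ (pow_le_pow_left₀ hc0 hc 3)
    rw [div_pow]
    gcongr
    nlinarith [sq_nonneg K, mul_nonneg (sub_nonneg.2 hK) (sub_nonneg.2 hK)]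

/-- Moving a divergence onto the test function. -/
lemma integral_mul_flux {s t c : ℝ} {φ q : E3 → ℝ} {Ξ : Fin 3 → Fin 3 → E3 → ℝ}
    (hφ : IsCutoff s t c φ) (hq : ContDiff ℝ 1 q) (hΞ : ∀ i j, ContDiff ℝ 1 (Ξ i j)) :
    ∫ x, q x * ∑ j, (∑ i, pd (Ξ i j) i x) * pd φ j x =
      - (∑ i, ∫ x, pd q i x * ∑ j, Ξ i j x * pd φ j x) -
        ∫ x, q x * ∑ i, ∑ j, Ξ i j x * pd (pd φ j) i x := by
  have cs : ∀ j, HasCompactSupport (pd φ j) := fun j => hasCompactSupport_pd hφ.hasCompactSupport j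
  have cs2 : ∀ j i, HasCompactSupport (pd (pd φ j) i) := fun j i => hasCompactSupport_pd (cs j) i
  have cq := hq.continuous
  have cq' := fun i => continuous_pd hq i
  have cΞ := fun i j => (hΞ i j).continuous
  have cΞ' := fun i j => continuous_pd (hΞ i j) i
  have cφ := fun j => (hφ.contDiff_pd j).continuous
  have cφ' := fun j i => (hφ.contDiff_pd_pd j i).continuous
  have key : ∀ i j, ∫ x, pd (Ξ i j) i x * (q x * pd φ j x) =
      - (∫ x, pd q i x * (Ξ i j x * pd φ j x)) - ∫ x, q x * (Ξ i j x * pd (pd φ j) i x) := by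
    intro i j
    rw [integral_pd_mul (hΞ i j) (hq.mul (hφ.contDiff_pd j)) (cs j).mul_left,
      neg_sub_left, ← integral_add]
    · congr 1
      refine integral_congr_ae (.of_forall fun x => ?_)
      dsimp only
      rw [pd_mul_apply (differentiable_of_contDiff_one hq x)
        (differentiable_of_contDiff_one (hφ.contDiff_pd j) x)]
      ring
    · exact (cq.mul ((cΞ i j).mul (cφ' j i))).integrable_of_hasCompactSupport
        (cs2 j i).mul_left.mul_left
    · exact ((cq' i).mul ((cΞ i j).mul (cφ j))).integrable_of_hasCompactSupport
        (cs j).mul_left.mul_left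
  have e1 : ∫ x, q x * ∑ j, (∑ i, pd (Ξ i j) i x) * pd φ j x =
      ∑ i, ∑ j, ∫ x, pd (Ξ i j) i x * (q x * pd φ j x) := by
    simp_rw [Finset.sum_mul, Finset.mul_sum]
    rw [Finset.sum_comm, integral_finsetSum]
    · refine Finset.sum_congr rfl fun j _ => ?_
      rw [integral_finsetSum]
      · refine Finset.sum_congr rfl fun i _ => integral_congr_ae (.of_forall fun x => ?_)
        dsimp only
        ring
      · exact fun i _ => (cq.mul ((cΞ' i j).mul (cφ j))).integrable_of_hasCompactSupport
          (cs j).mul_left.mul_left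
    · exact fun j _ => integrable_finsetSum _ fun i _ =>
        (cq.mul ((cΞ' i j).mul (cφ j))).integrable_of_hasCompactSupport (cs j).mul_left.mul_left
  have e2 : ∀ i, ∫ x, pd q i x * ∑ j, Ξ i j x * pd φ j x =
      ∑ j, ∫ x, pd q i x * (Ξ i j x * pd φ j x) := by
    intro i
    simp_rw [Finset.mul_sum]
    rw [integral_finsetSum]
    exact fun j _ => ((cq' i).mul ((cΞ i j).mul (cφ j))).integrable_of_hasCompactSupport
        (cs j).mul_left.mul_left
  have e3 : ∫ x, q x * ∑ i, ∑ j, Ξ i j x * pd (pd φ j) i x =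
      ∑ i, ∑ j, ∫ x, q x * (Ξ i j x * pd (pd φ j) i x) := by
    simp_rw [Finset.mul_sum]
    have hi : ∀ i j, Integrable fun x => q x * (Ξ i j x * pd (pd φ j) i x) := fun i j =>
      (cq.mul ((cΞ i j).mul (cφ' j i))).integrable_of_hasCompactSupport
        (cs2 j i).mul_left.mul_left
    rw [integral_finsetSum _ fun i _ => integrable_finsetSum _ fun j _ => hi i j]
    exact Finset.sum_congr rfl fun i _ => integral_finsetSum _ fun j _ => hi i j
  rw [e1, e3]
  simp only [e2, key, Finset.sum_sub_distrib, Finset.sum_neg_distrib]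

/-- The flux of `q` through a cutoff layer along a field given by a potential. -/
theorem exists_abs_flux_le (κ : ℝ) (hκ : 1 ≤ κ) : ∃ K : ℝ, 1 ≤ K ∧
    ∀ (m s d l S Y a₂ a₆ : ℝ) (q φ : E3 → ℝ) (Ξ : Fin 3 → Fin 3 → E3 → ℝ),
    1 ≤ m → 0 < d → 1 ≤ l → d * l = m ^ 6 → s + d ≤ 2 * m ^ 6 → 0 ≤ S → 0 ≤ Y →
    ContDiff ℝ 1 q → GradBound q (s + 3 * d / 8) S Y →
    IsCutoff s (s + d / 4) (κ * l / m ^ 6) φ → (∀ i j, ContDiff ℝ 1 (Ξ i j)) →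
    (∫ x, ∑ j, (∑ i, pd (Ξ i j) i x) * pd φ j x = 0) →
    (∀ i j k, LpBound 2 (Metric.ball 0 (s + d / 4)) (pd (Ξ i j) k) a₂) →
    (∀ i j, LpBound 6 (Metric.ball 0 (s + d / 4)) (Ξ i j) a₆) →
    |∫ x, q x * ∑ j, (∑ i, pd (Ξ i j) i x) * pd φ j x| ≤
      K * l ^ 7 / m ^ 6 * (S * (a₂ + a₆) + Y * a₆) := by
  obtain ⟨V, hV1, hV⟩ := exists_lpBound_ball_compare
  obtain ⟨K, hK1, hK⟩ := exists_abs_integral_mul_le_of_integral_eq_zero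
  refine ⟨9 * κ ^ 2 * V + K * (18 * κ ^ 3 * V), ?_, ?_⟩
  · have : 1 ≤ κ ^ 2 * V := one_le_mul_of_one_le_of_one_le (one_le_pow₀ hκ) hV1
    have : 0 ≤ K * (18 * κ ^ 3 * V) := by positivity
    linarith
  intro m s d l S Y a₂ a₆ q φ Ξ hm hd hl hdl hsd hS hY hq hqB hφ hΞ hflux h₂ h₆
  set c : ℝ := κ * l / m ^ 6 with hc
  have hm0 : 0 < m := by linarith
  have hc0 : 0 ≤ c := hφ.const_nonneg
  have ha2 : 0 ≤ a₂ := (h₂ 0 0 0).nonneg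
  have ha6 : 0 ≤ a₆ := (h₆ 0 0).nonneg
  have hΞd := fun i j => differentiable_of_contDiff_one (hΞ i j)
  have hφd := fun i => differentiable_of_contDiff_one (hφ.contDiff_pd i)
  have hφdd := fun i j => differentiable_of_contDiff_one (hφ.contDiff_pd_pd i j)
  have hV6 : ∀ i j, LpBound 2 (Metric.ball 0 (s + d / 4)) (Ξ i j) (V * m ^ 6 * a₆) := fun i j =>
    hV m (s + d / 4) hm0.le (by linarith) 0 2 6 6 (by norm_num) (by norm_num) (by norm_num) _ _
      (h₆ i j)
  have mulc : ∀ {p : ℝ≥0∞} {f g : E3 → ℝ} {a e : ℝ}, LpBound p (Metric.ball 0 (s + d / 4)) f a →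
      Continuous g → (∀ x, |g x| ≤ e) → LpBound p (Metric.ball 0 (s + d / 4))
        (fun x => f x * g x) (e * a) := by
    intro p f g a e hf hg he
    have := hf.bdd_mul measurableSet_ball (f := g) hg.aestronglyMeasurable (fun x _ => he x)
      ((abs_nonneg _).trans (he 0))
    simpa only [mul_comm] using this
  have cφ := fun j => (hφ.contDiff_pd j).continuous
  have cφ2 := fun j i => (hφ.contDiff_pd_pd j i).continuous
  have cφ3 := fun j i k => continuous_pd (hφ.contDiff_pd_pd j i) k
  -- first-order terms
  set w : Fin 3 → E3 → ℝ := fun i x => ∑ j, Ξ i j x * pd φ j x with hw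
  have hw1 : ∀ i, ContDiff ℝ 1 (w i) := fun i =>
    ContDiff.sum fun j _ => (hΞ i j).mul (hφ.contDiff_pd j)
  have hw0 : ∀ i x, x ∉ Metric.ball (0 : E3) (s + d / 4) → w i x = 0 := fun i x hx =>
    Finset.sum_eq_zero fun j _ => by rw [hφ.pd_eq_zero hx, mul_zero]
  have hw6 : ∀ i, LpBound 6 (Metric.ball 0 (s + d / 4)) (w i) (3 * (c * a₆)) := by
    intro i
    have := LpBound.sum (p := 6) (s := Metric.ball 0 (s + d / 4)) (by norm_num) Finset.univ
      fun j _ => mulc (h₆ i j) (cφ j) (hφ.abs_pd j)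
    simpa using this
  have hpw : ∀ i k, pd (w i) k = fun x => ∑ j, (pd (Ξ i j) k x * pd φ j x +
      Ξ i j x * pd (pd φ j) k x) := by
    intro i k
    funext x
    simp only [hw]
    rw [pd_sum_apply (F := fun j y => Ξ i j y * pd φ j y) _
      fun j _ => ((hΞd i j).mul (hφd j)) x]
    exact Finset.sum_congr rfl fun j _ => pd_mul_apply (hΞd i j x) (hφd j x) k
  have hw2 : ∀ i k, LpBound 2 (Metric.ball 0 (s + d / 4)) (pd (w i) k)
      (3 * (c * a₂ + c ^ 2 * (V * m ^ 6 * a₆))) := by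
    intro i k
    rw [hpw]
    have := LpBound.sum (p := 2) (s := Metric.ball 0 (s + d / 4)) (by norm_num) Finset.univ
      fun j _ => (mulc (h₂ i j k) (cφ j) (hφ.abs_pd j)).add (by norm_num)
        (mulc (hV6 i j) (cφ2 j k) (hφ.abs_pd_pd j k))
    simpa [mul_add] using this
  have hpw0 : ∀ i k x, x ∉ Metric.ball (0 : E3) (s + d / 4) → pd (w i) k x = 0 := by
    intro i k x hx
    rw [hpw]
    refine Finset.sum_eq_zero fun j _ => ?_
    rw [hφ.pd_eq_zero hx, pd_eq_zero_of_notMem_tsupport fun h => hx (hφ.tsupport_pd j h)]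
    ring
  have first : ∀ i, |∫ x, pd q i x * w i x| ≤
      S * (3 * (c * a₂ + c ^ 2 * (V * m ^ 6 * a₆))) + Y * (3 * (c * a₆)) := by
    intro i
    refine hqB i (w i) _ _ (hw1 i) (fun x hx => hw0 i x fun h => hx ?_) (fun k => ?_) ?_
    · exact Metric.ball_subset_ball (by linarith) h
    · exact ((hw2 i k).univ_of_eq_zero measurableSet_ball (hpw0 i k)).mono_set (Set.subset_univ _)
    · exact ((hw6 i).univ_of_eq_zero measurableSet_ball (hw0 i)).mono_set (Set.subset_univ _)
  -- second-order terms
  set g : E3 → ℝ := fun x => ∑ i, ∑ j, Ξ i j x * pd (pd φ j) i x with hg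
  have hg1 : ContDiff ℝ 1 g :=
    ContDiff.sum fun i _ => ContDiff.sum fun j _ => (hΞ i j).mul (hφ.contDiff_pd_pd j i)
  have hgs : tsupport g ⊆ Metric.ball (0 : E3) (s + d / 4) := by
    refine subset_trans (closure_minimal (fun x hx => ?_) (isClosed_tsupport φ)) hφ.tsupport_subset
    by_contra h
    refine hx (Finset.sum_eq_zero fun i _ => Finset.sum_eq_zero fun j _ => ?_)
    rw [pd_eq_zero_of_notMem_tsupport fun h' => h (tsupport_pd_subset j h'), mul_zero]
  have hgi : ∫ x, g x = 0 := by
    have := integral_mul_flux hφ (contDiff_const (c := (1 : ℝ))) hΞ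
    simp only [one_mul, pd_const, zero_mul, integral_zero, Finset.sum_const_zero, hflux] at this
    linarith
  have hpg : ∀ k, pd g k = fun x => ∑ i, ∑ j, (pd (Ξ i j) k x * pd (pd φ j) i x +
      Ξ i j x * pd (pd (pd φ j) i) k x) := by
    intro k
    funext x
    rw [hg, pd_sum_apply _ fun i _ =>
      (differentiable_of_contDiff_one (ContDiff.sum fun j _ =>
        (hΞ i j).mul (hφ.contDiff_pd_pd j i))) x]
    refine Finset.sum_congr rfl fun i _ => ?_
    rw [pd_sum_apply (F := fun j y => Ξ i j y * pd (pd φ j) i y) _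
      fun j _ => ((hΞd i j).mul (hφdd j i)) x]
    exact Finset.sum_congr rfl fun j _ => pd_mul_apply (hΞd i j x) (hφdd j i x) k
  have hg6 : LpBound 6 (Metric.ball 0 (s + d / 4)) g (3 * (3 * (c ^ 2 * a₆))) := by
    have := LpBound.sum (p := 6) (s := Metric.ball 0 (s + d / 4)) (by norm_num) Finset.univ
      fun i _ => LpBound.sum (by norm_num) Finset.univ
      fun j _ => mulc (h₆ i j) (cφ2 j i) (hφ.abs_pd_pd j i)
    simpa using this
  have hg2 : ∀ k, LpBound 2 (Metric.ball 0 (s + d / 4)) (pd g k)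
      (3 * (3 * (c ^ 2 * a₂ + c ^ 3 * (V * m ^ 6 * a₆)))) := by
    intro k
    rw [hpg]
    have := LpBound.sum (p := 2) (s := Metric.ball 0 (s + d / 4)) (by norm_num) Finset.univ
      fun i _ => LpBound.sum (by norm_num) Finset.univ
      fun j _ => (mulc (h₂ i j k) (cφ2 j i) (hφ.abs_pd_pd j i)).add (by norm_num)
        (mulc (hV6 i j) (cφ3 j i k) (hφ.abs_pd_pd_pd j i k))
    simpa [mul_add] using this
  have second := hK m s d l S Y q g _ _ hm hd hl hdl hsd hS hY hq hqB hg1 hgs hgi hg2 hg6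
  rw [integral_mul_flux hφ hq hΞ]
  have tri : |-(∑ i, ∫ x, pd q i x * w i x) - ∫ x, q x * g x| ≤
      3 * (S * (3 * (c * a₂ + c ^ 2 * (V * m ^ 6 * a₆))) + Y * (3 * (c * a₆))) +
      K * l ^ 4 * m ^ 6 * (S * (3 * (3 * (c ^ 2 * a₂ + c ^ 3 * (V * m ^ 6 * a₆))) +
        3 * (3 * (c ^ 2 * a₆))) + Y * (3 * (3 * (c ^ 2 * a₆)))) := by
    refine (abs_sub _ _).trans (add_le_add ?_ second)
    rw [abs_neg]
    refine (Finset.abs_sum_le_sum_abs _ _).trans ((Finset.sum_le_sum fun i _ => first i).trans (le_of_eq ?_))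
    simp
    ring
  refine tri.trans ?_
  set T := S * (a₂ + a₆) + Y * a₆ with hT
  have hl0 : 0 < l := by linarith
  set e : ℝ := κ * l with he
  have he1 : 1 ≤ e := one_le_mul_of_one_le_of_one_le hκ hl
  have hce : c * m ^ 6 = e := by rw [hc]; field_simp
  have hVe : 1 ≤ V * e := one_le_mul_of_one_le_of_one_le hV1 he1
  have b1 : c * a₂ + c ^ 2 * (V * m ^ 6 * a₆) ≤ c * (V * e) * (a₂ + a₆) := by
    have : c ^ 2 * (V * m ^ 6 * a₆) = c * (V * e) * a₆ := by rw [← hce]; ring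
    rw [this, mul_add]
    gcongr
    exact le_mul_of_one_le_right hc0 hVe
  have b2 : c ^ 2 * a₂ + c ^ 3 * (V * m ^ 6 * a₆) ≤ c ^ 2 * (V * e) * (a₂ + a₆) := by
    have : c ^ 3 * (V * m ^ 6 * a₆) = c ^ 2 * (V * e) * a₆ := by rw [← hce]; ring
    rw [this, mul_add]
    gcongr
    exact le_mul_of_one_le_right (by positivity) hVe
  have b3 : c * a₆ ≤ c * (V * e) * a₆ := by
    gcongr
    exact le_mul_of_one_le_right hc0 hVe
  have b4 : c ^ 2 * a₆ ≤ c ^ 2 * (V * e) * a₆ := by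
    gcongr
    exact le_mul_of_one_le_right (by positivity) hVe
  have b5 : c ^ 2 * (V * e) * a₆ ≤ c ^ 2 * (V * e) * (a₂ + a₆) := by
    gcongr
    linarith
  have hT0 : 0 ≤ T := by positivity
  calc _ ≤ 3 * (S * (3 * (c * (V * e) * (a₂ + a₆))) + Y * (3 * (c * (V * e) * a₆))) +
      K * l ^ 4 * m ^ 6 * (S * (3 * (3 * (c ^ 2 * (V * e) * (a₂ + a₆))) +
        3 * (3 * (c ^ 2 * (V * e) * (a₂ + a₆)))) + Y * (3 * (3 * (2 * (c ^ 2 * (V * e) * a₆))))) := by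
        have b6 := b4.trans b5
        have b7 : c ^ 2 * a₆ ≤ 2 * (c ^ 2 * (V * e) * a₆) :=
          b4.trans (le_mul_of_one_le_left (by positivity) (by norm_num))
        apply add_le_add <;> refine mul_le_mul_of_nonneg_left ?_ (by positivity)
        · exact add_le_add (mul_le_mul_of_nonneg_left (by linarith) hS)
            (mul_le_mul_of_nonneg_left (by linarith) hY)
        · exact add_le_add (mul_le_mul_of_nonneg_left (by linarith) hS)
            (mul_le_mul_of_nonneg_left (by linarith) hY)
    _ = (9 * κ ^ 2 * V) * l ^ 2 / m ^ 6 * T + K * (18 * κ ^ 3 * V) * l ^ 7 / m ^ 6 * T := by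
        rw [hT, he, hc]
        field_simp
        ring
    _ ≤ (9 * κ ^ 2 * V) * l ^ 7 / m ^ 6 * T + K * (18 * κ ^ 3 * V) * l ^ 7 / m ^ 6 * T := by
        gcongr
        norm_num
    _ = _ := by ring

end CutoffFlux

section LocalEstimates

open scoped ENNReal

lemma holderTriple_six_three_two : ENNReal.HolderTriple 6 3 2 := by
  constructor
  rw [← ENNReal.toReal_eq_toReal_iff' (by simp) (by simp)]
  rw [ENNReal.toReal_add (by simp) (by simp)]
  norm_num

lemma holderTriple_three_two : ENNReal.HolderTriple 3 2 (6 / 5) := by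
  constructor
  rw [← ENNReal.toReal_eq_toReal_iff' (by simp) (by simp)]
  rw [ENNReal.toReal_add (by simp) (by simp)]
  norm_num

lemma holderTriple_six_div_five_six : ENNReal.HolderTriple (6 / 5) 6 1 := by
  constructor
  rw [← ENNReal.toReal_eq_toReal_iff' (by simp) (by simp)]
  rw [ENNReal.toReal_add (by simp) (by simp)]
  norm_num

lemma hasDerivAt_mul_abs (x : ℝ) : HasDerivAt (fun y : ℝ => y * |y|) (2 * |x|) x := by
  rcases lt_trichotomy x 0 with h | rfl | h
  · have e := (hasDerivAt_id x).mul (hasDerivAt_abs_neg h)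
    have e2 : 1 * |x| + id x * -1 = 2 * |x| := by rw [abs_of_neg h, id]; ring
    rw [e2] at e
    exact e
  · rw [hasDerivAt_iff_tendsto_slope_zero]
    have : Filter.Tendsto (fun t : ℝ => |t|) (nhdsWithin 0 {0}ᶜ) (nhds (2 * |0|)) := by
      have := (continuous_abs (G := ℝ)).tendsto 0
      simp only [abs_zero, mul_zero] at this ⊢
      exact this.mono_left nhdsWithin_le_nhds
    refine this.congr' ?_
    filter_upwards [self_mem_nhdsWithin] with t ht
    have : t ≠ 0 := ht
    simp [this]
  · have e := (hasDerivAt_id x).mul (hasDerivAt_abs_pos h)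
    have e2 : 1 * |x| + id x * 1 = 2 * |x| := by rw [abs_of_pos h, id]; ring
    rw [e2] at e
    exact e

lemma contDiff_mul_abs : ContDiff ℝ 1 fun y : ℝ => y * |y| := by
  rw [contDiff_one_iff_deriv]
  refine ⟨fun x => (hasDerivAt_mul_abs x).differentiableAt, ?_⟩
  have : deriv (fun y : ℝ => y * |y|) = fun x => 2 * |x| := funext fun x => (hasDerivAt_mul_abs x).deriv
  rw [this]
  fun_prop

lemma pd_mul_abs_comp {f : E3 → ℝ} (hf : Differentiable ℝ f) (i : Fin 3) (x : E3) :
    pd (fun y => f y * |f y|) i x = 2 * |f x| * pd f i x := by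
  have := ((hasDerivAt_mul_abs (f x)).comp_hasFDerivAt x (hf x).hasFDerivAt).fderiv
  simp only [pd]
  have e : (fun y => f y * |f y|) = (fun y : ℝ => y * |y|) ∘ f := rfl
  rw [e, this]
  simp

lemma le_add_sqrt_of_sq_le {N P Q : ℝ} (hP : 0 ≤ P) (hQ : 0 ≤ Q) (h : N ^ 2 ≤ P * N + Q) :
    N ≤ P + √Q := by
  by_contra! hlt
  have h1 := Real.sq_sqrt hQ
  have h2 := Real.sqrt_nonneg Q
  nlinarith

/-- Cubic integrability of a divergence from bounds on its potential and its gradient. -/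
theorem exists_lpBound_three : ∃ V : ℝ, 1 ≤ V ∧ ∀ (m s t c a S : ℝ) (u φ : E3 → ℝ)
    (G : Fin 3 → E3 → ℝ), 0 ≤ m → t ≤ 2 * m ^ 6 → IsCutoff s t c φ → ContDiff ℝ 1 u →
    (∀ i, ContDiff ℝ 1 (G i)) → (∀ x, u x = ∑ i, pd (G i) i x) →
    (∀ i, LpBound 6 (Metric.ball 0 t) (G i) a) → (∀ i, LpBound 2 (Metric.ball 0 t) (pd u i) S) →
    LpBound 3 (Metric.ball 0 s) u (9 * V * c * m ^ 3 * a + 3 * √(a * S)) := by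
  obtain ⟨V, hV1, hV⟩ := exists_lpBound_ball_compare
  refine ⟨V, hV1, ?_⟩
  intro m s t c a S u φ G hm ht hφ hu hG huG hGa hS
  have := holderTriple_six_three_two
  have := holderTriple_three_two
  have ha : 0 ≤ a := (hGa 0).nonneg
  have hS0 : 0 ≤ S := (hS 0).nonneg
  have hc : 0 ≤ c := hφ.const_nonneg
  set U : E3 → ℝ := fun x => φ x * u x with hU
  have hU1 : ContDiff ℝ 1 U := hφ.contDiff_one.mul hu
  have hUc : HasCompactSupport U := hφ.hasCompactSupport.mul_right
  set F : E3 → ℝ := fun x => φ x * (U x * |U x|) with hF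
  have hF1 : ContDiff ℝ 1 F := hφ.contDiff_one.mul (contDiff_mul_abs.comp hU1)
  have hFc : HasCompactSupport F := hφ.hasCompactSupport.mul_right
  have hpF : ∀ i x, pd F i x = 3 * (pd φ i x * (U x * |U x|)) + 2 * (φ x ^ 2 * (|U x| * pd u i x)) := by
    intro i x
    have dU := differentiable_of_contDiff_one hU1
    have dφ := differentiable_of_contDiff_one hφ.contDiff_one
    have du := differentiable_of_contDiff_one hu
    have dUU : Differentiable ℝ fun x => U x * |U x| :=
      differentiable_of_contDiff_one (contDiff_mul_abs.comp hU1)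
    rw [hF, pd_mul_apply (dφ x) (dUU x), pd_mul_abs_comp dU]
    have : pd U i x = pd φ i x * u x + φ x * pd u i x := pd_mul_apply (dφ x) (du x) i
    rw [this, hU]
    ring
  set I : ℝ := ∫ x, |U x| ^ 3 with hI
  have hI0 : 0 ≤ I := integral_nonneg fun x => by positivity
  obtain ⟨N, hN0, hN3⟩ : ∃ N : ℝ, 0 ≤ N ∧ N ^ 3 = I :=
    ⟨I ^ ((3 : ℕ) : ℝ)⁻¹, Real.rpow_nonneg hI0 _, Real.rpow_inv_natCast_pow hI0 three_ne_zero⟩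
  have hUint : Integrable fun x => |U x| ^ 3 :=
    (hU1.continuous.abs.pow 3).integrable_of_hasCompactSupport
      (hasCompactSupport_of_eq_zero (ρ := t) fun x hx => by simp [hU, hφ.eq_zero hx])
  have hU3 : LpBound 3 Set.univ U N := by
    have := LpBound.of_integral_pow_le (n := 3) (s := Set.univ) (f := U) three_ne_zero hN0
      hU1.continuous.aestronglyMeasurable hUint.integrableOn (by rw [setIntegral_univ, hN3])
    rwa [Nat.cast_ofNat] at this
  have hU3t : LpBound 3 (Metric.ball 0 t) U N := hU3.mono_set (Set.subset_univ _)
  have cU := hU1.continuous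
  have cφ := hφ.contDiff_one.continuous
  have cu' := continuous_pd hu
  have ident : I = - ∑ i, (3 * (∫ x, pd φ i x * (G i x * (U x * |U x|))) +
      2 * ∫ x, φ x ^ 2 * (G i x * |U x| * pd u i x)) := by
    have e1 : I = ∑ i, ∫ x, pd (G i) i x * F x := by
      rw [← integral_finsetSum]
      · refine integral_congr_ae (.of_forall fun x => ?_)
        dsimp only
        rw [← Finset.sum_mul, ← huG]
        simp only [hF, hU]
        rw [pow_succ, sq_abs, abs_mul, abs_of_nonneg (hφ.nonneg x)]
        have := abs_mul_abs_self (u x)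
        ring
      · exact fun i _ => ((continuous_pd (hG i) i).mul hF1.continuous).integrable_of_hasCompactSupport
          hFc.mul_left
    rw [e1, ← Finset.sum_neg_distrib]
    refine Finset.sum_congr rfl fun i _ => ?_
    have cG := (hG i).continuous
    rw [integral_pd_mul (hG i) hF1 hFc, ← integral_const_mul, ← integral_const_mul, ← integral_add]
    · congr 1
      refine integral_congr_ae (.of_forall fun x => ?_)
      dsimp only
      rw [hpF]
      ring
    · refine Integrable.const_mul (Continuous.integrable_of_hasCompactSupport ?_ ?_) _
      · exact (continuous_pd hφ.contDiff_one i).mul (cG.mul (cU.mul cU.abs))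
      · exact (hasCompactSupport_pd hφ.hasCompactSupport i).mul_right
    · refine Integrable.const_mul (Continuous.integrable_of_hasCompactSupport ?_ ?_) _
      · exact (cφ.pow 2).mul ((cG.mul cU.abs).mul (cu' i))
      · exact hasCompactSupport_of_eq_zero fun x hx => by rw [hφ.eq_zero hx]; ring
  have t1 : ∀ i, |∫ x, pd φ i x * (G i x * (U x * |U x|))| ≤ c * (V * m ^ 3 * (a * N * N)) := by
    intro i
    have h1 : LpBound 2 (Metric.ball 0 t) (fun x => G i x * U x) (a * N) := (hGa i).mul hU3t
    have h2 : LpBound (6 / 5) (Metric.ball 0 t) (fun x => |U x| * (G i x * U x)) (N * (a * N)) :=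
      hU3t.abs.mul h1
    have h3 := hV m t hm ht 0 1 (6 / 5) 3 (by
      rw [ENNReal.le_div_iff_mul_le (by simp) (by simp)]; norm_num) (by norm_num) (by norm_num) _ _ h2
    have h4 := h3.bdd_mul measurableSet_ball (f := pd φ i)
      (continuous_pd hφ.contDiff_one i).aestronglyMeasurable (fun x _ => hφ.abs_pd i x) hc
    have h5 := h4.abs_integral_le_of_eq_zero fun x hx => by rw [hφ.pd_eq_zero hx, zero_mul]
    refine le_trans (le_of_eq ?_) (h5.trans (le_of_eq (by ring)))
    congr 1
    refine integral_congr_ae (.of_forall fun x => ?_)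
    dsimp only
    ring
  have t2 : ∀ i, |∫ x, φ x ^ 2 * (G i x * |U x| * pd u i x)| ≤ 1 * (a * N * S) := by
    intro i
    have h1 : LpBound 2 (Metric.ball 0 t) (fun x => G i x * |U x|) (a * N) := (hGa i).mul hU3t.abs
    have h2 : LpBound 1 (Metric.ball 0 t) (fun x => G i x * |U x| * pd u i x) (a * N * S) :=
      h1.mul (hS i)
    refine (h2.bdd_mul measurableSet_ball (f := fun x => φ x ^ 2)
      (cφ.pow 2).aestronglyMeasurable (fun x _ => ?_) zero_le_one).abs_integral_le_of_eq_zero ?_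
    · rw [abs_pow]; exact pow_le_one₀ (abs_nonneg _) (hφ.abs_le_one x)
    · intro x hx; rw [hφ.eq_zero hx]; ring
  have main : N ^ 3 ≤ 9 * V * c * m ^ 3 * a * N ^ 2 + 6 * (a * S) * N := by
    rw [hN3, ident]
    refine (neg_le_abs _).trans ((Finset.abs_sum_le_sum_abs _ _).trans
      ((Finset.sum_le_sum (g := fun _ => 3 * (c * (V * m ^ 3 * (a * N * N))) + 2 * (1 * (a * N * S)))
        fun i _ => ?_).trans (le_of_eq ?_)))
    · refine (abs_add_le _ _).trans ?_
      rw [abs_mul, abs_mul, abs_of_pos (three_pos : (0 : ℝ) < 3), abs_of_pos (two_pos : (0 : ℝ) < 2)]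
      have := t1 i
      have := t2 i
      linarith
    · simp
      ring
  have hNle : N ≤ 9 * V * c * m ^ 3 * a + 3 * √(a * S) := by
    have hP : 0 ≤ 9 * V * c * m ^ 3 * a := by positivity
    rcases hN0.eq_or_lt with h0 | h0
    · rw [← h0]; positivity
    have h2 : N ^ 2 ≤ 9 * V * c * m ^ 3 * a * N + 9 * (a * S) := by
      have haS : 0 ≤ a * S := by positivity
      refine le_of_mul_le_mul_right ?_ h0
      nlinarith [mul_nonneg haS h0.le]
    have h3 := le_add_sqrt_of_sq_le hP (by positivity) h2
    have h4 : √(9 * (a * S)) = 3 * √(a * S) := by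
      rw [Real.sqrt_mul (by norm_num), show (9 : ℝ) = 3 ^ 2 by norm_num, Real.sqrt_sq (by norm_num)]
    rwa [h4] at h3
  refine ((hU3.mono_set (Set.subset_univ _)).congr measurableSet_ball fun x hx => ?_).mono hNle
  simp only [hU]
  rw [hφ.eq_one x hx, one_mul]

theorem exists_lpBound_six : ∃ K : ℝ, 1 ≤ K ∧ ∀ (m s t c S X : ℝ) (u φ : E3 → ℝ),
    0 ≤ m → t ≤ 2 * m ^ 6 → IsCutoff s t c φ → ContDiff ℝ 1 u →
    (∀ i, LpBound 2 (Metric.ball 0 t) (pd u i) S) → LpBound 3 (Metric.ball 0 t) u X →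
    LpBound 6 (Metric.ball 0 s) u (K * (S + c * m ^ 3 * X)) := by
  obtain ⟨V, hV1, hV⟩ := exists_lpBound_ball_compare
  set κ : ℝ := (SNormLESNormFDerivOfEqConst ℝ (volume : Measure E3) 2).toReal with hκ
  have hκ0 : 0 ≤ κ := NNReal.coe_nonneg _
  refine ⟨1 + κ * (3 * V), by nlinarith, ?_⟩
  intro m s t c S X u φ hm ht hφ hu hS hX
  have hc : 0 ≤ c := hφ.const_nonneg
  have hS0 : 0 ≤ S := (hS 0).nonneg
  have hX0 : 0 ≤ X := hX.nonneg
  set U : E3 → ℝ := fun x => φ x * u x with hU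
  have hU1 : ContDiff ℝ 1 U := hφ.contDiff_one.mul hu
  have hUc : HasCompactSupport U := hφ.hasCompactSupport.mul_right
  have h2 : ∀ i, LpBound 2 Set.univ (pd U i) (c * (V * m ^ 3 * X) + 1 * S) := by
    intro i
    have e : pd U i = fun x => pd φ i x * u x + φ x * pd u i x := funext fun x =>
      pd_mul_apply (differentiable_of_contDiff_one hφ.contDiff_one x)
        (differentiable_of_contDiff_one hu x) i
    have b1 := (hV m t hm ht 0 2 3 3 (by norm_num) (by norm_num) (by norm_num) _ _ hX).bdd_mul
      measurableSet_ball (f := pd φ i) (continuous_pd hφ.contDiff_one i).aestronglyMeasurable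
      (fun x _ => hφ.abs_pd i x) hc
    have b2 := (hS i).bdd_mul measurableSet_ball (f := φ) hφ.contDiff_one.continuous.aestronglyMeasurable
      (fun x _ => hφ.abs_le_one x) zero_le_one
    rw [e]
    refine (b1.add (by norm_num) b2).univ_of_eq_zero measurableSet_ball fun x hx => ?_
    rw [hφ.eq_zero hx, hφ.pd_eq_zero hx]; ring
  have hsum := LpBound.sum (p := 2) (by norm_num) Finset.univ fun i _ => (h2 i).abs
  have gns := eLpNorm_le_eLpNorm_fderiv_of_eq (μ := (volume : Measure E3)) hU1 hUc (p := 2) (p' := 6)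
    (by norm_num) (by simp) (by simp; norm_num)
  have hgrad : eLpNorm (fderiv ℝ U) 2 volume ≤ ENNReal.ofReal (3 * (c * (V * m ^ 3 * X) + 1 * S)) := by
    have := hsum.le
    rw [Measure.restrict_univ] at this
    refine (eLpNorm_mono fun x => ?_).trans (this.trans (ENNReal.ofReal_le_ofReal (le_of_eq (by simp; ring))))
    rw [Real.norm_eq_abs]
    exact (norm_fderiv_le_sum x).trans (le_abs_self _)
  have h6 : LpBound 6 Set.univ U (κ * (3 * (c * (V * m ^ 3 * X) + 1 * S))) := by
    refine ⟨hU1.continuous.aestronglyMeasurable, by positivity, ?_⟩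
    rw [Measure.restrict_univ, ENNReal.ofReal_mul hκ0, hκ, ENNReal.ofReal, Real.toNNReal_coe]
    exact gns.trans (mul_le_mul_right hgrad _)
  refine ((h6.mono_set (Set.subset_univ _)).congr measurableSet_ball (f := u) fun x hx => ?_).mono ?_
  · simp only [hU]; rw [hφ.eq_one x hx, one_mul]
  · have t1 : S ≤ V * S := le_mul_of_one_le_left hS0 hV1
    have t0 : 0 ≤ S + c * m ^ 3 * X := by positivity
    calc κ * (3 * (c * (V * m ^ 3 * X) + 1 * S)) ≤ κ * (3 * (c * (V * m ^ 3 * X) + V * S)) := by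
          gcongr
      _ = κ * (3 * V) * (S + c * m ^ 3 * X) := by ring
      _ ≤ _ := by nlinarith

end LocalEstimates

section Elsasser

open scoped ENNReal

/-- The stationary MHD system in Elsasser variables. -/
structure ElsasserSystem (Z : Bool → Fin 3 → E3 → ℝ) (p : E3 → ℝ) : Prop where
  contDiff : ∀ σ j, ContDiff ℝ (⊤ : ℕ∞) (Z σ j)
  contDiff_pressure : ContDiff ℝ (⊤ : ℕ∞) p
  momentum : ∀ σ j x, pd p j x =
    (∑ i, pd (pd (Z σ j) i) i x) - ∑ i, Z (!σ) i x * pd (Z σ j) i x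
  div_eq_zero : ∀ σ x, ∑ j, pd (Z σ j) j x = 0

/-- The energy density of a vector field. -/
noncomputable def energyDensity (u : Fin 3 → E3 → ℝ) (x : E3) : ℝ := 2⁻¹ * ∑ j, u j x * u j x

lemma contDiff_energyDensity {u : Fin 3 → E3 → ℝ} (hu : ∀ j, ContDiff ℝ 1 (u j)) :
    ContDiff ℝ 1 (energyDensity u) :=
  contDiff_const.mul (ContDiff.sum fun j _ => (hu j).mul (hu j))

lemma pd_energyDensity {u : Fin 3 → E3 → ℝ} (hu : ∀ j, ContDiff ℝ 1 (u j)) (i : Fin 3) :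
    pd (energyDensity u) i = fun x => ∑ j, u j x * pd (u j) i x := by
  funext x
  have hd := fun j => differentiable_of_contDiff_one (hu j)
  have hd2 : Differentiable ℝ fun x => ∑ j, u j x * u j x :=
    differentiable_of_contDiff_one (ContDiff.sum fun j _ => (hu j).mul (hu j))
  have : energyDensity u = fun x => 2⁻¹ * ∑ j, u j x * u j x := rfl
  rw [this, pd_const_mul hd2]
  dsimp only
  rw [pd_sum_apply (F := fun j y => u j y * u j y) _ fun j _ => ((hd j).mul (hd j)) x,
    Finset.mul_sum]
  refine Finset.sum_congr rfl fun j _ => ?_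
  rw [pd_mul_apply (hd j x) (hd j x)]
  ring

lemma gradBound_energyDensity {u : Fin 3 → E3 → ℝ} (hu : ∀ j, ContDiff ℝ 1 (u j)) {ρ Y : ℝ}
    (hY : ∀ i j, LpBound (6 / 5) (Metric.ball 0 ρ) (fun x => u j x * pd (u j) i x) Y) :
    GradBound (energyDensity u) ρ 0 (3 * Y) := by
  intro i w D W hw hw0 _ hW
  have := holderTriple_six_div_five_six
  have hsum := LpBound.sum (p := 6 / 5) (by
    rw [ENNReal.le_div_iff_mul_le (by simp) (by simp)]; norm_num) Finset.univ fun j _ => hY i j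
  have h1 : LpBound 1 _ _ _ := hsum.mul hW
  rw [pd_energyDensity hu]
  have h2 := h1.abs_integral_le_of_eq_zero fun x hx => by rw [hw0 x hx, mul_zero]
  refine h2.trans (le_of_eq ?_)
  simp

lemma pd_eq_zero_of_eq_zero {w : E3 → ℝ} {ρ : ℝ} (hw : ContDiff ℝ 1 w)
    (hw0 : ∀ x, x ∉ Metric.ball (0 : E3) ρ → w x = 0) {x : E3} (hx : x ∉ Metric.ball (0 : E3) ρ)
    (i : Fin 3) : pd w i x = 0 := by
  have h1 : closure (Metric.closedBall (0 : E3) ρ)ᶜ ⊆ {y | pd w i y = 0} :=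
    closure_minimal (fun y hy => pd_eq_zero_of_notMem_tsupport
      (fun h => hy (tsupport_subset_closedBall_of_eq_zero hw0 h)) i)
      (isClosed_eq (continuous_pd hw i) continuous_const)
  rw [closure_compl, interior_closedBall'] at h1
  exact h1 hx

/-- Transport by a divergence-free field is skew-symmetric. -/
lemma integral_mul_transport {b : Fin 3 → E3 → ℝ} {φ q : E3 → ℝ} (hb : ∀ i, ContDiff ℝ 1 (b i))
    (hdiv : ∀ x, ∑ i, pd (b i) i x = 0) (hφ : ContDiff ℝ 1 φ) (hφc : HasCompactSupport φ)
    (hq : ContDiff ℝ 1 q) :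
    ∫ x, φ x * ∑ i, b i x * pd q i x = - ∫ x, q x * ∑ i, b i x * pd φ i x := by
  have cb := fun i => (hb i).continuous
  have e1 : ∫ x, φ x * ∑ i, b i x * pd q i x = ∑ i, ∫ x, pd q i x * (φ x * b i x) := by
    simp_rw [Finset.mul_sum]
    rw [integral_finsetSum]
    · refine Finset.sum_congr rfl fun i _ => integral_congr_ae (.of_forall fun x => ?_)
      dsimp only
      ring
    · exact fun i _ => (hφ.continuous.mul ((cb i).mul (continuous_pd hq i))).integrable_of_hasCompactSupport
        hφc.mul_right
  have e2 : ∀ i, ∫ x, pd q i x * (φ x * b i x) =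
      - ∫ x, q x * (pd φ i x * b i x + φ x * pd (b i) i x) := by
    intro i
    rw [integral_pd_mul hq (hφ.mul (hb i)) hφc.mul_right]
    congr 1
    refine integral_congr_ae (.of_forall fun x => ?_)
    dsimp only
    rw [pd_mul_apply (differentiable_of_contDiff_one hφ x) (differentiable_of_contDiff_one (hb i) x)]
  rw [e1]
  simp_rw [e2]
  rw [Finset.sum_neg_distrib, ← integral_finsetSum]
  · congr 1
    refine integral_congr_ae (.of_forall fun x => ?_)
    dsimp only
    rw [← Finset.mul_sum, Finset.sum_add_distrib, ← Finset.mul_sum, hdiv, mul_zero, add_zero]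
    simp only [mul_comm]
  · intro i _
    have : ∀ x, q x * (pd φ i x * b i x + φ x * pd (b i) i x) =
      pd φ i x * (q x * b i x) + φ x * (q x * pd (b i) i x) := fun x => by ring
    simp_rw [this]
    refine Integrable.add ?_ ?_
    · exact ((continuous_pd hφ i).mul (hq.continuous.mul (cb i))).integrable_of_hasCompactSupport
        (hasCompactSupport_pd hφc i).mul_right
    · exact (hφ.continuous.mul (hq.continuous.mul (continuous_pd (hb i) i))).integrable_of_hasCompactSupport
        hφc.mul_right

lemma integral_flux_eq_zero {b : Fin 3 → E3 → ℝ} {φ : E3 → ℝ} (hb : ∀ i, ContDiff ℝ 1 (b i))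
    (hdiv : ∀ x, ∑ i, pd (b i) i x = 0) (hφ : ContDiff ℝ 1 φ) (hφc : HasCompactSupport φ) :
    ∫ x, ∑ i, b i x * pd φ i x = 0 := by
  have := integral_mul_transport hb hdiv hφ hφc (contDiff_const (c := (1 : ℝ)))
  simp only [pd_const, mul_zero, Finset.sum_const_zero, integral_zero, one_mul] at this
  linarith

namespace ElsasserSystem

variable {Z : Bool → Fin 3 → E3 → ℝ} {p : E3 → ℝ}

lemma contDiff_one (h : ElsasserSystem Z p) (σ : Bool) (j : Fin 3) : ContDiff ℝ 1 (Z σ j) :=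
  (h.contDiff σ j).of_le (by norm_cast)

lemma contDiff_one_pressure (h : ElsasserSystem Z p) : ContDiff ℝ 1 p :=
  h.contDiff_pressure.of_le (by norm_cast)

lemma contDiff_one_pd (h : ElsasserSystem Z p) (σ : Bool) (j i : Fin 3) :
    ContDiff ℝ 1 (pd (Z σ j) i) :=
  (contDiff_pd_top (h.contDiff σ j) i).of_le (by norm_cast)

lemma gradBound_pressure (h : ElsasserSystem Z p) {ρ S Y : ℝ}
    (hS : ∀ σ j i, LpBound 2 (Metric.ball 0 ρ) (pd (Z σ j) i) S)
    (hY : ∀ σ τ i j k, LpBound (6 / 5) (Metric.ball 0 ρ) (fun x => Z σ i x * pd (Z τ j) k x) Y) :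
    GradBound p ρ (3 * S) (3 * Y) := by
  intro j w D W hw hw0 hD hW
  have := holderTriple_six_div_five_six
  have hwc : HasCompactSupport w := hasCompactSupport_of_eq_zero hw0
  have cZ := fun σ j => (h.contDiff_one σ j).continuous
  have cZ' := fun σ j i => (h.contDiff_one_pd σ j i).continuous
  have e : ∫ x, pd p j x * w x = - (∑ i, ∫ x, pd (Z true j) i x * pd w i x) -
      ∑ i, ∫ x, Z false i x * pd (Z true j) i x * w x := by
    have e1 : ∀ i, - ∫ x, pd (Z true j) i x * pd w i x = ∫ x, pd (pd (Z true j) i) i x * w x :=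
      fun i => (integral_pd_mul (h.contDiff_one_pd true j i) hw hwc i).symm
    rw [← Finset.sum_neg_distrib]
    simp_rw [e1]
    have i1 : ∀ i, Integrable fun x => pd (pd (Z true j) i) i x * w x := fun i =>
      ((continuous_pd (h.contDiff_one_pd true j i) i).mul hw.continuous).integrable_of_hasCompactSupport
        hwc.mul_left
    have i2 : ∀ i, Integrable fun x => Z false i x * pd (Z true j) i x * w x := fun i =>
      (((cZ false i).mul (cZ' true j i)).mul hw.continuous).integrable_of_hasCompactSupport
        hwc.mul_left
    rw [← integral_finsetSum _ fun i _ => i1 i, ← integral_finsetSum _ fun i _ => i2 i,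
      ← integral_sub (integrable_finsetSum _ fun i _ => i1 i)
        (integrable_finsetSum _ fun i _ => i2 i)]
    refine integral_congr_ae (.of_forall fun x => ?_)
    dsimp only
    rw [h.momentum true j x, sub_mul, Finset.sum_mul, Finset.sum_mul]
    rfl
  have b1 : ∀ i, |∫ x, pd (Z true j) i x * pd w i x| ≤ S * D := fun i => by
    have h1 : LpBound 1 _ _ _ := (hS true j i).mul (hD i)
    exact h1.abs_integral_le_of_eq_zero fun x hx => by
      rw [pd_eq_zero_of_eq_zero hw hw0 hx, mul_zero]
  have b2 : ∀ i, |∫ x, Z false i x * pd (Z true j) i x * w x| ≤ Y * W := fun i => by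
    have h1 : LpBound 1 _ _ _ := (hY false true i j i).mul hW
    exact h1.abs_integral_le_of_eq_zero fun x hx => by rw [hw0 x hx, mul_zero]
  rw [e]
  refine (abs_sub _ _).trans ?_
  rw [abs_neg]
  refine (add_le_add ((Finset.abs_sum_le_sum_abs _ _).trans (Finset.sum_le_sum fun i _ => b1 i))
    ((Finset.abs_sum_le_sum_abs _ _).trans (Finset.sum_le_sum fun i _ => b2 i))).trans (le_of_eq ?_)
  simp
  ring

lemma energy_identity (h : ElsasserSystem Z p) (σ : Bool) {φ : E3 → ℝ}
    (hφ : ContDiff ℝ 1 φ) (hφc : HasCompactSupport φ) :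
    ∫ x, φ x * ∑ j, ∑ i, pd (Z σ j) i x ^ 2 =
      - (∑ i, ∫ x, pd (energyDensity (Z σ)) i x * pd φ i x) +
      (∫ x, energyDensity (Z σ) x * ∑ i, Z (!σ) i x * pd φ i x) +
      ∫ x, p x * ∑ i, Z σ i x * pd φ i x := by
  have hZ := h.contDiff_one σ
  have he := contDiff_energyDensity hZ
  have cZ := fun j => (hZ j).continuous
  have cZ' := fun j i => (h.contDiff_one_pd σ j i).continuous
  have cφ := hφ.continuous
  have t1 := integral_mul_transport (h.contDiff_one σ) (h.div_eq_zero σ) hφ hφc h.contDiff_one_pressure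
  have t2 := integral_mul_transport (h.contDiff_one (!σ)) (h.div_eq_zero (!σ)) hφ hφc he
  have t3 : ∀ i j, ∫ x, pd (pd (Z σ j) i) i x * (φ x * Z σ j x) =
      - (∫ x, Z σ j x * pd (Z σ j) i x * pd φ i x) - ∫ x, φ x * pd (Z σ j) i x ^ 2 := by
    intro i j
    rw [integral_pd_mul (h.contDiff_one_pd σ j i) (hφ.mul (hZ j)) hφc.mul_right, neg_sub_left,
      ← integral_add]
    · congr 1
      refine integral_congr_ae (.of_forall fun x => ?_)
      dsimp only
      rw [pd_mul_apply (differentiable_of_contDiff_one hφ x) (differentiable_of_contDiff_one (hZ j) x)]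
      ring
    · exact (cφ.mul ((cZ' j i).pow 2)).integrable_of_hasCompactSupport hφc.mul_right
    · exact (((cZ j).mul (cZ' j i)).mul (continuous_pd hφ i)).integrable_of_hasCompactSupport
        (hasCompactSupport_pd hφc i).mul_left
  have i3 : ∀ i j, Integrable fun x => pd (pd (Z σ j) i) i x * (φ x * Z σ j x) := fun i j =>
    ((continuous_pd (h.contDiff_one_pd σ j i) i).mul (cφ.mul (cZ j))).integrable_of_hasCompactSupport
      hφc.mul_right.mul_left
  have t4 : ∫ x, φ x * ∑ j, Z σ j x * pd p j x =
      (∑ i, ∑ j, ∫ x, pd (pd (Z σ j) i) i x * (φ x * Z σ j x)) -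
        ∫ x, φ x * ∑ i, Z (!σ) i x * pd (energyDensity (Z σ)) i x := by
    simp_rw [← integral_finsetSum Finset.univ fun j _ => i3 _ j]
    rw [← integral_finsetSum _ fun i _ => integrable_finsetSum _ fun j _ => i3 i j, ← integral_sub]
    · refine integral_congr_ae (.of_forall fun x => ?_)
      dsimp only
      simp only [pd_energyDensity hZ, h.momentum σ, Fin.sum_univ_three]
      ring
    · exact integrable_finsetSum _ fun i _ => integrable_finsetSum _ fun j _ => i3 i j
    · refine Continuous.integrable_of_hasCompactSupport (cφ.mul ?_) hφc.mul_right
      exact continuous_finsetSum _ fun i _ => ((h.contDiff_one (!σ) i).continuous).mul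
        (continuous_pd he i)
  have t5 : ∀ i, ∫ x, pd (energyDensity (Z σ)) i x * pd φ i x =
      ∑ j, ∫ x, Z σ j x * pd (Z σ j) i x * pd φ i x := by
    intro i
    rw [pd_energyDensity hZ, ← integral_finsetSum]
    · simp_rw [Finset.sum_mul]
    · exact fun j _ => (((cZ j).mul (cZ' j i)).mul (continuous_pd hφ i)).integrable_of_hasCompactSupport
        (hasCompactSupport_pd hφc i).mul_left
  have t6 : ∫ x, φ x * ∑ j, ∑ i, pd (Z σ j) i x ^ 2 = ∑ i, ∑ j, ∫ x, φ x * pd (Z σ j) i x ^ 2 := by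
    have i6 : ∀ i j, Integrable fun x => φ x * pd (Z σ j) i x ^ 2 := fun i j =>
      (cφ.mul ((cZ' j i).pow 2)).integrable_of_hasCompactSupport hφc.mul_right
    rw [Finset.sum_comm]
    simp_rw [Finset.mul_sum]
    rw [integral_finsetSum _ fun j _ => integrable_finsetSum _ fun i _ => i6 i j]
    exact Finset.sum_congr rfl fun j _ => integral_finsetSum _ fun i _ => i6 i j
  simp only [t3, Finset.sum_sub_distrib, Finset.sum_neg_distrib] at t4
  rw [t6]
  simp only [t5]
  linarith

end ElsasserSystem

end Elsasser

section LocalEstimates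

open scoped ENNReal

/-- Bounds for potentials `Q` and for the gradient of the fields `Z` on the ball of radius `t`. -/
structure LocalBound (A m t S : ℝ) (Z : Bool → Fin 3 → E3 → ℝ)
    (Q : Bool → Fin 3 → Fin 3 → E3 → ℝ) : Prop where
  contDiff : ∀ σ i j, ContDiff ℝ (⊤ : ℕ∞) (Q σ i j)
  eq_div : ∀ σ j x, Z σ j x = ∑ i, pd (Q σ i j) i x
  potential : ∀ σ i j, LpBound 6 (Metric.ball 0 t) (Q σ i j) (A * m ^ 4)
  gradient : ∀ σ j i, LpBound 2 (Metric.ball 0 t) (pd (Z σ j) i) S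

lemma LocalBound.nonneg {A m t S : ℝ} {Z : Bool → Fin 3 → E3 → ℝ}
    {Q : Bool → Fin 3 → Fin 3 → E3 → ℝ} (h : LocalBound A m t S Z Q) : 0 ≤ S :=
  (h.gradient true 0 0).nonneg

/-- Interior bounds for the fields. -/
lemma exists_interior_bounds (A : ℝ) (hA : 1 ≤ A) : ∃ K : ℝ, 1 ≤ K ∧
    ∀ (m s d l S : ℝ) (Z : Bool → Fin 3 → E3 → ℝ) (Q : Bool → Fin 3 → Fin 3 → E3 → ℝ),
    1 ≤ m → 0 < d → 1 ≤ l → d * l = m ^ 6 → 0 ≤ s → s + d ≤ 2 * m ^ 6 →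
    (∀ σ j, ContDiff ℝ 1 (Z σ j)) → LocalBound A m (s + d) S Z Q →
    (∀ σ j, LpBound 3 (Metric.ball 0 (s + 7 * d / 8)) (Z σ j) (K * (l * m + m ^ 2 * √S))) ∧
    ∀ σ j, LpBound 6 (Metric.ball 0 (s + 3 * d / 4)) (Z σ j) (K * (l ^ 2 * (S + 1))) := by
  obtain ⟨V, hV1, hV⟩ := exists_lpBound_three
  obtain ⟨K, hK1, hK⟩ := exists_lpBound_six
  obtain ⟨κ, hκ1, hκ⟩ := exists_isCutoff
  set K₁ : ℝ := 9 * V * κ * A + 3 * A with hK₁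
  have hK₁0 : 1 ≤ K₁ := by
    have : 0 ≤ 9 * V * κ * A := by positivity
    linarith
  have hK₂ : K₁ ≤ 6 * K * κ * K₁ := by
    have : 1 ≤ K * κ := one_le_mul_of_one_le_of_one_le hK1 hκ1
    nlinarith
  refine ⟨6 * K * κ * K₁, hK₁0.trans hK₂, fun m s d l S Z Q hm hd hl hdl hs hsd hZ h => ?_⟩
  have hm0 : 0 < m := by linarith
  have hS := h.nonneg
  obtain ⟨φ, hφ⟩ := hκ m d l (s + 7 * d / 8) (s + d) hm0 hd hdl (by positivity) (by linarith)
  obtain ⟨ψ, hψ⟩ := hκ m d l (s + 3 * d / 4) (s + 7 * d / 8) hm0 hd hdl (by positivity)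
    (by linarith)
  have hx : ∀ σ j, LpBound 3 (Metric.ball 0 (s + 7 * d / 8)) (Z σ j)
      (K₁ * (l * m + m ^ 2 * √S)) := fun σ j => by
    refine (hV m _ _ _ (A * m ^ 4) S (Z σ j) φ (fun i => Q σ i j) hm0.le hsd hφ (hZ σ j)
      (fun i => (h.contDiff σ i j).of_le (by norm_cast)) (h.eq_div σ j)
      (fun i => h.potential σ i j) (h.gradient σ j)).mono ?_
    have e1 : √(A * m ^ 4 * S) = √A * m ^ 2 * √S := by
      rw [Real.sqrt_mul (by positivity), Real.sqrt_mul (by positivity)]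
      congr 2
      rw [show m ^ 4 = (m ^ 2) ^ 2 by ring, Real.sqrt_sq (by positivity)]
    have e2 : √A ≤ A := by
      rw [Real.sqrt_le_left (by linarith)]
      nlinarith
    have e3 : 9 * V * (κ * l / m ^ 6) * m ^ 3 * (A * m ^ 4) = 9 * V * κ * A * (l * m) := by
      field_simp
    rw [e1, e3, hK₁]
    have h1 : 0 ≤ m ^ 2 * √S := by positivity
    have h2 : 0 ≤ A * (l * m) := by positivity
    have h3 : 0 ≤ 9 * V * κ * A * (m ^ 2 * √S) := by positivity
    have h4 : √A * (m ^ 2 * √S) ≤ A * (m ^ 2 * √S) := by gcongr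
    nlinarith
  refine ⟨fun σ j => (hx σ j).mono (by gcongr), fun σ j => ?_⟩
  refine (hK m _ _ _ S _ (Z σ j) ψ hm0.le (by linarith) hψ (hZ σ j)
    (fun i => (h.gradient σ j i).mono_set (Metric.ball_subset_ball (by linarith)))
    (hx σ j)).mono ?_
  have e1 : κ * l / m ^ 6 * m ^ 3 * (K₁ * (l * m + m ^ 2 * √S)) =
      κ * K₁ * l * (l / m ^ 2 + √S / m) := by
    field_simp
  have e2 : √S ≤ S + 1 := by
    rw [Real.sqrt_le_left (by linarith)]
    nlinarith
  have e3 : l / m ^ 2 ≤ l := div_le_self (by linarith) (one_le_pow₀ hm)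
  have e4 : √S / m ≤ l * (S + 1) := (div_le_self (Real.sqrt_nonneg _) hm).trans
    (e2.trans (le_mul_of_one_le_left (by linarith) hl))
  have e5 : l ≤ l * (S + 1) := le_mul_of_one_le_right (by linarith) (by linarith)
  rw [e1]
  have e6 : κ * K₁ * l * (l / m ^ 2 + √S / m) ≤ κ * K₁ * l * (l * (S + 1) + l * (S + 1)) := by
    gcongr
    exact e3.trans e5
  have e7 : S ≤ κ * K₁ * (l ^ 2 * (S + 1)) := by
    have h1 : 1 ≤ κ * K₁ := one_le_mul_of_one_le_of_one_le hκ1 hK₁0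
    have h2 : S + 1 ≤ l ^ 2 * (S + 1) := le_mul_of_one_le_left (by linarith) (one_le_pow₀ hl)
    have h3 : l ^ 2 * (S + 1) ≤ κ * K₁ * (l ^ 2 * (S + 1)) :=
      le_mul_of_one_le_left (by positivity) h1
    linarith
  have e8 : 0 ≤ κ * K₁ * (l ^ 2 * (S + 1)) := by positivity
  calc K * (S + κ * K₁ * l * (l / m ^ 2 + √S / m))
      ≤ K * (3 * (κ * K₁ * (l ^ 2 * (S + 1)))) := by
        gcongr
        linarith
    _ ≤ K * (6 * (κ * K₁ * (l ^ 2 * (S + 1)))) := by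
        gcongr
        norm_num
    _ = _ := by ring

/-- Regularised potentials at scale `μ * m ^ 4`. -/
lemma exists_regular_potential (A : ℝ) (hA : 1 ≤ A) : ∃ K : ℝ, 1 ≤ K ∧
    ∀ (m s d l S μ : ℝ) (Z : Bool → Fin 3 → E3 → ℝ) (Q : Bool → Fin 3 → Fin 3 → E3 → ℝ),
    1 ≤ m → 0 < d → 1 ≤ l → d * l = m ^ 6 → 0 ≤ s → s + d ≤ 2 * m ^ 6 → 0 < μ →
    8 * (μ * l) ≤ m ^ 2 → (∀ σ j, ContDiff ℝ 1 (Z σ j)) → LocalBound A m (s + d) S Z Q →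
    ∀ σ, ∃ H : Fin 3 → Fin 3 → E3 → ℝ, (∀ i j, ContDiff ℝ 1 (H i j)) ∧
      (∀ j x, Z σ j x = ∑ i, pd (H i j) i x) ∧
      (∀ i j, LpBound 6 (Metric.ball 0 (s + d / 4)) (H i j)
        (K * l ^ 2 * (m ^ 4 * (1 + μ * (S + 1))))) ∧
      ∀ i j k, LpBound 2 (Metric.ball 0 (s + d / 4)) (pd (H i j) k)
        (K * l ^ 2 * (m ^ 6 * (1 / μ) + m ^ 4 * (1 + μ * (S + 1)))) := by
  obtain ⟨V, hV1, hV⟩ := exists_lpBound_ball_compare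
  obtain ⟨W, hW1, hW⟩ := exists_interior_bounds A hA
  obtain ⟨K, hK1, hK⟩ := exists_smoothed_potential
  refine ⟨K * (V * A * W), one_le_mul_of_one_le_of_one_le hK1 (one_le_mul_of_one_le_of_one_le
    (one_le_mul_of_one_le_of_one_le hV1 hA) hW1),
    fun m s d l S μ Z Q hm hd hl hdl hs hsd hμ hμl hZ h σ => ?_⟩
  have hm0 : 0 < m := by linarith
  have hS := h.nonneg
  set δ : ℝ := μ * m ^ 4 with hδ
  have hδ0 : 0 < δ := by positivity
  have hδd : 8 * δ ≤ d := by
    have h1 : 8 * (μ * l) * m ^ 4 ≤ m ^ 2 * m ^ 4 := by gcongr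
    have h2 : 8 * δ * l ≤ d * l := by
      rw [hdl, hδ]
      calc _ = 8 * (μ * l) * m ^ 4 := by ring
        _ ≤ _ := h1
        _ = _ := by ring
    exact le_of_mul_le_mul_right h2 (by linarith)
  choose H hH1 hH2 hH3 hH4 using fun j => hK (Z σ j) (fun i => Q σ i j)
    (fun i => (h.contDiff σ i j).of_le (by norm_cast)) (hZ σ j) (h.eq_div σ j) δ hδ0
  have hsub : ∀ {ρ : ℝ}, s + d / 2 ≤ ρ →
      Metric.ball (0 : E3) (s + d / 4 + δ) ⊆ Metric.ball 0 ρ := fun {ρ} hρ =>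
    Metric.ball_subset_ball (by linarith)
  have hQ : ∀ i j, LpBound 6 (Metric.ball 0 (s + d / 4 + δ)) (Q σ i j) (A * m ^ 4) := fun i j =>
    (h.potential σ i j).mono_set (hsub (by linarith))
  have hl2 : 1 ≤ l ^ 2 := one_le_pow₀ hl
  have c1 : A ≤ V * A * W * l ^ 2 := by
    calc A = 1 * A * 1 * 1 := by ring
      _ ≤ V * A * W * l ^ 2 := by gcongr
  have c2 : V * A ≤ V * A * W * l ^ 2 := by
    calc V * A = V * A * 1 * 1 := by ring
      _ ≤ V * A * W * l ^ 2 := by gcongr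
  have c3 : W * l ^ 2 ≤ V * A * W * l ^ 2 := by
    calc W * l ^ 2 = 1 * 1 * W * l ^ 2 := by ring
      _ ≤ V * A * W * l ^ 2 := by gcongr
  have c4 : 1 ≤ V * A * W * l ^ 2 := hA.trans c1
  refine ⟨fun i j => H j i, fun i j => hH1 j i, hH2, fun i j => ?_, fun i j k => ?_⟩
  · refine (hH3 j 6 _ _ _ i (by norm_num) (by norm_num) (hQ i j)
      (((hW m s d l S Z Q hm hd hl hdl hs hsd hZ h).2 σ j).mono_set (hsub (by linarith)))).mono ?_
    calc K * (A * m ^ 4 + δ * (W * (l ^ 2 * (S + 1))))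
        = K * (A * m ^ 4 + (W * l ^ 2) * (m ^ 4 * (μ * (S + 1)))) := by rw [hδ]; ring
      _ ≤ K * (V * A * W * l ^ 2 * m ^ 4 + V * A * W * l ^ 2 * (m ^ 4 * (μ * (S + 1)))) := by gcongr
      _ = _ := by ring
  · have hQ2 : LpBound 2 (Metric.ball 0 (s + d / 4 + δ)) (Q σ i j) (V * m ^ 6 * (A * m ^ 4)) :=
      hV m _ hm0.le (by linarith) 0 2 6 6 (by norm_num)
        (by norm_num [ENNReal.toReal_ofNat]) (by norm_num) _ _ (hQ i j)
    refine (hH4 j 2 _ _ _ i k (by norm_num) (by norm_num) hQ2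
      ((h.gradient σ j k).mono_set (hsub (by linarith)))).mono ?_
    calc K * (δ⁻¹ * (V * m ^ 6 * (A * m ^ 4)) + δ * S)
        = K * (V * A * (m ^ 6 * (1 / μ)) + 1 * (m ^ 4 * (μ * S))) := by
          rw [hδ]; field_simp
      _ ≤ K * (V * A * W * l ^ 2 * (m ^ 6 * (1 / μ)) +
            V * A * W * l ^ 2 * (m ^ 4 * (1 + μ * (S + 1)))) := by
          gcongr
          nlinarith
      _ = _ := by ring

/-- The local energy estimate. -/
theorem exists_energy_estimate (A : ℝ) (hA : 1 ≤ A) : ∃ K : ℝ, 1 ≤ K ∧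
    ∀ (m s d l S μ Y : ℝ) (Z : Bool → Fin 3 → E3 → ℝ) (p : E3 → ℝ)
    (Q : Bool → Fin 3 → Fin 3 → E3 → ℝ), ElsasserSystem Z p →
    1 ≤ m → 0 < d → 1 ≤ l → d * l = m ^ 6 → 0 ≤ s → s + d ≤ 2 * m ^ 6 → 0 < μ →
    8 * (μ * l) ≤ m ^ 2 → LocalBound A m (s + d) S Z Q →
    (∀ σ τ i j k, LpBound (6 / 5) (Metric.ball 0 (s + 3 * d / 8))
      (fun x => Z σ i x * pd (Z τ j) k x) Y) →
    ∀ σ, ∫ x in Metric.ball 0 s, ∑ j, ∑ i, pd (Z σ j) i x ^ 2 ≤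
      K * l ^ 9 * (S * (1 / μ + (1 + μ * (S + 1)) / m ^ 2) +
        Y * ((1 + μ * (S + 1)) / m ^ 2)) := by
  obtain ⟨κ, hκ1, hκ⟩ := exists_isCutoff
  obtain ⟨V, hV1, hV⟩ := exists_lpBound_ball_of_bdd
  obtain ⟨F, hF1, hF⟩ := exists_abs_flux_le κ hκ1
  obtain ⟨G, hG1, hG⟩ := exists_regular_potential A hA
  refine ⟨9 * V * κ + 12 * F * G, by
    have : 1 ≤ V * κ := one_le_mul_of_one_le_of_one_le hV1 hκ1
    have : 0 ≤ 12 * F * G := by positivity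
    linarith, ?_⟩
  intro m s d l S μ Y Z p Q hsys hm hd hl hdl hs hsd hμ hμl h hY σ
  have hm0 : 0 < m := by linarith
  have hS := h.nonneg
  have hY0 : 0 ≤ Y := (hY true true 0 0 0).nonneg
  have hZ := hsys.contDiff_one
  obtain ⟨φ, hφ⟩ := hκ m d l s (s + d / 4) hm0 hd hdl hs (by linarith)
  have hmu : 0 ≤ 1 / μ := by positivity
  set T : ℝ := (1 + μ * (S + 1)) / m ^ 2 with hT
  have hT0 : 0 ≤ T := by positivity
  have hTm : m ^ 6 * T = m ^ 4 * (1 + μ * (S + 1)) := by rw [hT]; field_simp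
  have hp := hsys.gradBound_pressure (ρ := s + 3 * d / 8) (fun σ j i =>
    (h.gradient σ j i).mono_set (Metric.ball_subset_ball (by linarith))) hY
  have he := gradBound_energyDensity (u := Z σ) (hZ σ) (ρ := s + 3 * d / 8)
    fun i j => hY σ σ j j i
  have hsub : Metric.ball (0 : E3) (s + d / 4) ⊆ Metric.ball 0 (s + 3 * d / 8) :=
    Metric.ball_subset_ball (by linarith)
  -- the diffusion term
  have t1 : ∀ i, |∫ x, pd (energyDensity (Z σ)) i x * pd φ i x| ≤ 3 * Y * (V * κ * (l * T)) := by
    intro i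
    have hw : ContDiff ℝ 1 (pd φ i) := hφ.contDiff_pd i
    obtain ⟨D, hD⟩ : ∃ D, ∀ k, LpBound 2 (Metric.ball 0 (s + 3 * d / 8)) (pd (pd φ i) k) D := by
      choose D hD using fun k => LpBound.exists_of_continuous (p := 2)
        (continuous_pd hw k) 0 (s + 3 * d / 8)
      refine ⟨∑ k, D k, fun k => (hD k).mono ?_⟩
      exact Finset.single_le_sum (fun k _ => (hD k).nonneg) (Finset.mem_univ k)
    have hW : LpBound 6 (Metric.ball 0 (s + 3 * d / 8)) (pd φ i) (V * m ^ 3 * (κ * l / m ^ 6)) :=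
      hV m _ hm0.le (by linarith) 0 6 3 (by norm_num [ENNReal.toReal_ofNat]) (by norm_num) _ _
        hw.continuous.aestronglyMeasurable hφ.const_nonneg fun x _ => hφ.abs_pd i x
    refine (he i (pd φ i) D _ hw (fun x hx => hφ.pd_eq_zero (fun h' => hx (hsub h')) i) hD hW).trans ?_
    rw [zero_mul, zero_add]
    refine mul_le_mul_of_nonneg_left ?_ (by positivity)
    have e1 : V * m ^ 3 * (κ * l / m ^ 6) = V * κ * (l * (1 / m ^ 3)) := by field_simp
    rw [e1]
    gcongr
    rw [hT, div_le_div_iff₀ (by positivity) (by positivity)]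
    have : m ^ 2 ≤ m ^ 3 := pow_le_pow_right₀ hm (by norm_num)
    have : 0 ≤ μ * (S + 1) * m ^ 3 := by positivity
    nlinarith
  -- the flux terms
  have fl : ∀ (τ : Bool) (q : E3 → ℝ) (S' : ℝ), 0 ≤ S' → S' ≤ 3 * S → ContDiff ℝ 1 q →
      GradBound q (s + 3 * d / 8) S' (3 * Y) →
      ∫ x, q x * ∑ i, Z τ i x * pd φ i x ≤ F * l ^ 9 * G * (6 * S * (1 / μ + T) + 3 * Y * T) := by
    intro τ q S' hS' hS'S hq hqB
    obtain ⟨H, hH1, hH2, hH3, hH4⟩ := hG m s d l S μ Z Q hm hd hl hdl hs hsd hμ hμl hZ h τ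
    have h0 := integral_flux_eq_zero (hZ τ) (hsys.div_eq_zero τ) hφ.contDiff_one
      hφ.hasCompactSupport
    have h1 := hF m s d l S' (3 * Y) _ _ q φ H hm hd hl hdl hsd hS' (by positivity) hq hqB hφ hH1
      (by simpa only [← hH2] using h0) hH4 hH3
    simp only [← hH2] at h1
    refine ((le_abs_self _).trans h1).trans ?_
    rw [← hTm]
    calc F * l ^ 7 / m ^ 6 * (S' * (G * l ^ 2 * (m ^ 6 * (1 / μ) + m ^ 6 * T) +
          G * l ^ 2 * (m ^ 6 * T)) + 3 * Y * (G * l ^ 2 * (m ^ 6 * T)))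
        = F * l ^ 9 * G * (S' * (1 / μ + 2 * T) + 3 * Y * T) := by
          field_simp
          try ring
      _ ≤ F * l ^ 9 * G * (3 * S * (2 * (1 / μ + T)) + 3 * Y * T) := by
          gcongr
          linarith
      _ = _ := by ring
  have cint : Continuous fun x => ∑ j, ∑ i, pd (Z σ j) i x ^ 2 :=
    continuous_finsetSum _ fun j _ => continuous_finsetSum _ fun i _ =>
      (continuous_pd (hZ σ j) i).pow 2
  have low : ∫ x in Metric.ball 0 s, ∑ j, ∑ i, pd (Z σ j) i x ^ 2 ≤
      ∫ x, φ x * ∑ j, ∑ i, pd (Z σ j) i x ^ 2 := by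
    have e : ∫ x in Metric.ball 0 s, ∑ j, ∑ i, pd (Z σ j) i x ^ 2 =
        ∫ x in Metric.ball 0 s, φ x * ∑ j, ∑ i, pd (Z σ j) i x ^ 2 :=
      setIntegral_congr_fun measurableSet_ball fun x hx => by
        rw [hφ.eq_one x hx, one_mul]
    rw [e]
    refine setIntegral_le_integral ((hφ.contDiff_one.continuous.mul cint).integrable_of_hasCompactSupport
      hφ.hasCompactSupport.mul_right) (.of_forall fun x => ?_)
    have := hφ.nonneg x
    have : 0 ≤ ∑ j, ∑ i, pd (Z σ j) i x ^ 2 := by positivity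
    show 0 ≤ φ x * _
    positivity
  have id := hsys.energy_identity σ hφ.contDiff_one hφ.hasCompactSupport
  have f1 := fl (!σ) (energyDensity (Z σ)) 0 le_rfl (by positivity) (contDiff_energyDensity (hZ σ)) he
  have f2 := fl σ p (3 * S) (by positivity) le_rfl hsys.contDiff_one_pressure hp
  have d1 : - (∑ i, ∫ x, pd (energyDensity (Z σ)) i x * pd φ i x) ≤
      9 * V * κ * (l ^ 9 * (Y * T)) := by
    refine (neg_le_abs _).trans ((Finset.abs_sum_le_sum_abs _ _).trans
      ((Finset.sum_le_sum fun i _ => t1 i).trans ?_))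
    have : l ≤ l ^ 9 := le_self_pow₀ hl (by norm_num)
    simp only [Finset.sum_const, Finset.card_univ, Fintype.card_fin, nsmul_eq_mul]
    calc _ = 9 * V * κ * (l * (Y * T)) := by push_cast; ring
      _ ≤ _ := by gcongr
  refine low.trans (id.le.trans ((add_le_add (add_le_add d1 f1) f2).trans ?_))
  have h1 : 0 ≤ V * κ * l ^ 9 * (S * (1 / μ + T)) := by positivity
  have h2 : 0 ≤ F * G * l ^ 9 * (Y * T) := by positivity
  calc _ = 9 * V * κ * (l ^ 9 * (Y * T)) + 12 * (F * G * l ^ 9 * (S * (1 / μ + T))) +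
        6 * (F * G * l ^ 9 * (Y * T)) := by ring
    _ ≤ 9 * V * κ * (l ^ 9 * (Y * T)) + 12 * (F * G * l ^ 9 * (S * (1 / μ + T))) +
        12 * (F * G * l ^ 9 * (Y * T)) + 9 * (V * κ * l ^ 9 * (S * (1 / μ + T))) := by linarith
    _ = _ := by ring

end LocalEstimates

section Liouville

open scoped ENNReal

/-- A hole-filling iteration. -/
lemma le_of_half_le_add {f : ℝ → ℝ} {r K B : ℝ} {n : ℕ} (hr : 0 < r)
    (hf0 : ∀ s ∈ Set.Ico r (2 * r), 0 ≤ f s) (hfB : ∀ s ∈ Set.Ico r (2 * r), f s ≤ B)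
    (h : ∀ s t, r ≤ s → s < t → t ≤ 2 * r → f s ≤ 2⁻¹ * f t + K * (r / (t - s)) ^ n) :
    f r ≤ 3 * (4 * (n + 1)) ^ n * K := by
  set q : ℝ := 4 * (n + 1) with hq
  have hq0 : 4 ≤ q := by
    have : (0 : ℝ) ≤ n := n.cast_nonneg
    linarith
  set g : ℝ → ℝ := fun s => (2 * r - s) ^ n * f s with hg
  have hB0 : 0 ≤ B := (hf0 r ⟨le_rfl, by linarith⟩).trans (hfB r ⟨le_rfl, by linarith⟩)
  have hθ : 3 / 4 ≤ (1 - 1 / q) ^ n := by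
    have h1 := one_add_mul_le_pow (a := -(1 / q)) (by
      have : 1 / q ≤ 1 := by rw [div_le_one (by linarith)]; linarith
      linarith) n
    rw [← sub_eq_add_neg] at h1
    refine le_trans ?_ h1
    have : n * (1 / q) ≤ 1 / 4 := by
      rw [mul_one_div, div_le_div_iff₀ (by linarith) (by norm_num)]
      linarith
    linarith
  have hmem : r ∈ Set.Ico r (2 * r) := ⟨le_rfl, by linarith⟩
  have hbdd : BddAbove (g '' Set.Ico r (2 * r)) := by
    refine ⟨r ^ n * B, ?_⟩
    rintro _ ⟨s, hs, rfl⟩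
    have h1 := hs.1
    have h2 := hs.2
    exact mul_le_mul (pow_le_pow_left₀ (by linarith) (by linarith) n) (hfB s hs) (hf0 s hs)
      (by positivity)
  set M := sSup (g '' Set.Ico r (2 * r)) with hM
  have key : ∀ s ∈ Set.Ico r (2 * r), g s ≤ 2 / 3 * M + K * (r * q) ^ n := by
    intro s hs
    have h1 := hs.1
    have h2 := hs.2
    set e := 2 * r - s with he
    have he0 : 0 < e := by linarith
    have hqe : e / q ≤ e / 4 := by gcongr
    have hqe0 : 0 < e / q := by positivity
    set t := s + e / q with ht
    have htm : t ∈ Set.Ico r (2 * r) := ⟨by linarith, by linarith⟩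
    have h3 := h s t h1 (by linarith) htm.2.le
    have h4 : g t ≤ M := le_csSup hbdd ⟨t, htm, rfl⟩
    have h5 : g t = (1 - 1 / q) ^ n * (e ^ n * f t) := by
      rw [hg]
      dsimp only
      have : 2 * r - t = (1 - 1 / q) * e := by rw [ht, he]; ring
      rw [this, mul_pow, mul_assoc]
    have h6 : 3 / 4 * (e ^ n * f t) ≤ M := by
      rw [h5] at h4
      refine le_trans ?_ h4
      have := hf0 t htm
      gcongr
    have h7 : e ^ n * (r / (t - s)) ^ n = (r * q) ^ n := by
      rw [← mul_pow, ht]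
      congr 1
      have : q ≠ 0 := by linarith
      have : e ≠ 0 := he0.ne'
      rw [add_sub_cancel_left]
      field_simp
    calc g s = e ^ n * f s := rfl
      _ ≤ e ^ n * (2⁻¹ * f t + K * (r / (t - s)) ^ n) := by gcongr
      _ = 2⁻¹ * (e ^ n * f t) + K * (e ^ n * (r / (t - s)) ^ n) := by ring
      _ ≤ _ := by rw [h7]; linarith
  have hM1 : M ≤ 2 / 3 * M + K * (r * q) ^ n := by
    refine csSup_le ⟨g r, r, hmem, rfl⟩ ?_
    rintro _ ⟨s, hs, rfl⟩
    exact key s hs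
  have h8 : g r ≤ 3 * (K * (r * q) ^ n) := by
    have : g r ≤ M := le_csSup hbdd ⟨r, hmem, rfl⟩
    linarith
  have h9 : r ^ n * f r ≤ r ^ n * (3 * q ^ n * K) := by
    have e1 : g r = r ^ n * f r := by rw [hg]; dsimp only; congr 2; ring
    rw [← e1]
    refine h8.trans (le_of_eq ?_)
    rw [mul_pow]; ring
  exact le_of_mul_le_mul_left h9 (by positivity)

/-- Squared length of the gradient of all the fields. -/
noncomputable def gradSq (Z : Bool → Fin 3 → E3 → ℝ) (x : E3) : ℝ :=
  ∑ σ, ∑ j, ∑ i, pd (Z σ j) i x ^ 2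

/-- The Dirichlet energy on a centred ball. -/
noncomputable def gradEnergy (Z : Bool → Fin 3 → E3 → ℝ) (ρ : ℝ) : ℝ :=
  ∫ x in Metric.ball 0 ρ, gradSq Z x

lemma gradSq_nonneg (Z : Bool → Fin 3 → E3 → ℝ) (x : E3) : 0 ≤ gradSq Z x := by
  unfold gradSq; positivity

lemma sq_pd_le_gradSq (Z : Bool → Fin 3 → E3 → ℝ) (σ : Bool) (j i : Fin 3) (x : E3) :
    pd (Z σ j) i x ^ 2 ≤ gradSq Z x := by
  have h1 : pd (Z σ j) i x ^ 2 ≤ ∑ i, pd (Z σ j) i x ^ 2 :=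
    Finset.single_le_sum (f := fun i => pd (Z σ j) i x ^ 2) (fun _ _ => sq_nonneg _)
      (Finset.mem_univ i)
  have h2 : ∑ i, pd (Z σ j) i x ^ 2 ≤ ∑ j, ∑ i, pd (Z σ j) i x ^ 2 :=
    Finset.single_le_sum (f := fun j => ∑ i, pd (Z σ j) i x ^ 2) (fun _ _ => by positivity)
      (Finset.mem_univ j)
  have h3 : ∑ j, ∑ i, pd (Z σ j) i x ^ 2 ≤ gradSq Z x :=
    Finset.single_le_sum (f := fun σ => ∑ j, ∑ i, pd (Z σ j) i x ^ 2) (fun _ _ => by positivity)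
      (Finset.mem_univ σ)
  exact h1.trans (h2.trans h3)

variable {Z : Bool → Fin 3 → E3 → ℝ} {A : ℝ} {p : E3 → ℝ}

lemma continuous_gradSq (hZ : ∀ σ j, ContDiff ℝ 1 (Z σ j)) : Continuous (gradSq Z) :=
  continuous_finsetSum _ fun σ _ => continuous_finsetSum _ fun j _ =>
    continuous_finsetSum _ fun i _ => (continuous_pd (hZ σ j) i).pow 2

lemma integrableOn_ball_of_continuous {f : E3 → ℝ} (hf : Continuous f) (ρ : ℝ) :
    IntegrableOn f (Metric.ball 0 ρ) :=
  (hf.continuousOn.integrableOn_compact (isCompact_closedBall 0 ρ)).mono_set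
    Metric.ball_subset_closedBall

lemma gradEnergy_nonneg (Z : Bool → Fin 3 → E3 → ℝ) (ρ : ℝ) : 0 ≤ gradEnergy Z ρ :=
  integral_nonneg (gradSq_nonneg Z)

lemma gradEnergy_mono (hZ : ∀ σ j, ContDiff ℝ 1 (Z σ j)) : Monotone (gradEnergy Z) :=
  fun _ b hab => setIntegral_mono_set (integrableOn_ball_of_continuous (continuous_gradSq hZ) b)
    (.of_forall (gradSq_nonneg Z)) (Metric.ball_subset_ball hab).eventuallyLE

/-- The gradient outside a ball is controlled by the increment of the energy. -/
lemma lpBound_pd_diff (hZ : ∀ σ j, ContDiff ℝ 1 (Z σ j)) {M ρ : ℝ} (hM : M ≤ ρ) (σ : Bool)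
    (j i : Fin 3) : LpBound 2 (Metric.ball 0 ρ \ Metric.ball 0 M) (pd (Z σ j) i)
      √(gradEnergy Z ρ - gradEnergy Z M) := by
  have hc := continuous_pd (hZ σ j) i
  have hUint := fun ρ => integrableOn_ball_of_continuous (continuous_gradSq hZ) ρ
  refine LpBound.of_integral_pow_le (n := 2) two_ne_zero (Real.sqrt_nonneg _)
    hc.aestronglyMeasurable ((integrableOn_ball_of_continuous (hc.abs.pow 2) ρ).mono_set
      Set.sdiff_subset) ?_
  rw [Real.sq_sqrt (sub_nonneg.2 (gradEnergy_mono hZ hM))]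
  have e : gradEnergy Z ρ - gradEnergy Z M = ∫ x in Metric.ball 0 ρ \ Metric.ball 0 M, gradSq Z x := by
    rw [setIntegral_sdiff measurableSet_ball (hUint ρ) (Metric.ball_subset_ball hM)]
    rfl
  rw [e]
  refine setIntegral_mono_on ((integrableOn_ball_of_continuous (hc.abs.pow 2) ρ).mono_set
    Set.sdiff_subset) ((hUint ρ).mono_set Set.sdiff_subset)
    (measurableSet_ball.diff measurableSet_ball) fun x _ => ?_
  rw [sq_abs]
  exact sq_pd_le_gradSq Z σ j i x

lemma lpBound_pd_ball (hZ : ∀ σ j, ContDiff ℝ 1 (Z σ j)) (ρ : ℝ) (σ : Bool)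
    (j i : Fin 3) : LpBound 2 (Metric.ball 0 ρ) (pd (Z σ j) i) √(gradEnergy Z ρ) := by
  rcases le_or_gt 0 ρ with h | h
  · have := lpBound_pd_diff hZ h σ j i
    simpa [gradEnergy] using this
  · rw [Metric.ball_eq_empty.2 h.le]
    refine ⟨by simp, Real.sqrt_nonneg _, by simp⟩

/-- Potentials whose oscillation over a ball of radius `2 * m ^ 6` is at most `A * m ^ 4` in
the unnormalised sixth-power norm. -/
def HasPotentials (A : ℝ) (Z : Bool → Fin 3 → E3 → ℝ) : Prop :=
  ∀ m : ℝ, 1 ≤ m → ∃ Q : Bool → Fin 3 → Fin 3 → E3 → ℝ,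
    (∀ σ i j, ContDiff ℝ (⊤ : ℕ∞) (Q σ i j)) ∧ (∀ σ j x, Z σ j x = ∑ i, pd (Q σ i j) i x) ∧
    ∀ σ i j, LpBound 6 (Metric.ball 0 (2 * m ^ 6)) (Q σ i j) (A * m ^ 4)

lemma HasPotentials.exists_localBound (h : HasPotentials A Z) (hZ : ∀ σ j, ContDiff ℝ 1 (Z σ j))
    {m : ℝ} (hm : 1 ≤ m) : ∃ Q, ∀ t ≤ 2 * m ^ 6, LocalBound A m t √(gradEnergy Z t) Z Q := by
  obtain ⟨Q, h1, h2, h3⟩ := h m hm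
  exact ⟨Q, fun t ht => ⟨h1, h2, fun σ i j => (h3 σ i j).mono_set (Metric.ball_subset_ball ht),
    lpBound_pd_ball hZ t⟩⟩

/-- The energy estimate for the total Dirichlet energy. -/
lemma exists_gradEnergy_le (A : ℝ) (hA : 1 ≤ A) : ∃ K : ℝ, 1 ≤ K ∧
    ∀ (m s d l S μ Y : ℝ) (Z : Bool → Fin 3 → E3 → ℝ) (p : E3 → ℝ)
    (Q : Bool → Fin 3 → Fin 3 → E3 → ℝ), ElsasserSystem Z p →
    1 ≤ m → 0 < d → 1 ≤ l → d * l = m ^ 6 → 0 ≤ s → s + d ≤ 2 * m ^ 6 → 0 < μ →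
    8 * (μ * l) ≤ m ^ 2 → LocalBound A m (s + d) S Z Q →
    (∀ σ τ i j k, LpBound (6 / 5) (Metric.ball 0 (s + 3 * d / 8))
      (fun x => Z σ i x * pd (Z τ j) k x) Y) →
    gradEnergy Z s ≤ K * l ^ 9 * (S * (1 / μ + (1 + μ * (S + 1)) / m ^ 2) +
        Y * ((1 + μ * (S + 1)) / m ^ 2)) := by
  obtain ⟨K, hK1, hK⟩ := exists_energy_estimate A hA
  refine ⟨2 * K, by linarith, fun m s d l S μ Y Z p Q hsys hm hd hl hdl hs hsd hμ hμl h hY => ?_⟩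
  have h1 := hK m s d l S μ Y Z p Q hsys hm hd hl hdl hs hsd hμ hμl h hY
  have h2 : gradEnergy Z s = ∑ σ, ∫ x in Metric.ball 0 s, ∑ j, ∑ i, pd (Z σ j) i x ^ 2 := by
    unfold gradEnergy gradSq
    refine integral_finsetSum _ fun σ _ => integrableOn_ball_of_continuous ?_ s
    exact continuous_finsetSum _ fun j _ => continuous_finsetSum _ fun i _ =>
      (continuous_pd (hsys.contDiff_one σ j) i).pow 2
  rw [h2, Fintype.sum_bool]
  linarith [h1 true, h1 false]

lemma absorb {K W l σ : ℝ} (hK : 1 ≤ K) (hW : 1 ≤ W) (hl : 1 ≤ l) (hσ : 1 ≤ σ) :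
    K * l ^ 9 * (σ ^ 3 * (32 * (K * W * l ^ 10) + 2) + W * l * (2 * σ ^ 3 + 2 * σ ^ 4 /
      (32 * (K * W * l ^ 10)))) ≤ 16⁻¹ * σ ^ 4 + 16⁻¹ * σ ^ 4 + 4096 * (36 * (K ^ 2 * W * l ^ 19)) ^ 4 := by
  have hl0 : 0 < l := by linarith
  have h1 : K * l ^ 9 * (W * l * (2 * σ ^ 4 / (32 * (K * W * l ^ 10)))) = 16⁻¹ * σ ^ 4 := by
    field_simp; try norm_num
  set B := 36 * (K ^ 2 * W * l ^ 19) with hB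
  have h2 : K * l ^ 9 * (σ ^ 3 * (32 * (K * W * l ^ 10) + 2) + W * l * (2 * σ ^ 3)) ≤ B * σ ^ 3 := by
    have e1 : K * l ^ 9 ≤ K ^ 2 * W * l ^ 19 := by
      calc K * l ^ 9 = K * 1 * 1 * (l ^ 9 * 1) := by ring
        _ ≤ K * K * W * (l ^ 9 * l ^ 10) := by gcongr; exact one_le_pow₀ hl
        _ = _ := by ring
    have e2 : K * l ^ 9 * (W * l) ≤ K ^ 2 * W * l ^ 19 := by
      calc K * l ^ 9 * (W * l) = K * 1 * W * (l ^ 10 * 1) := by ring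
        _ ≤ K * K * W * (l ^ 10 * l ^ 9) := by gcongr; exact one_le_pow₀ hl
        _ = _ := by ring
    calc _ = (32 * (K ^ 2 * W * l ^ 19) + 2 * (K * l ^ 9) + 2 * (K * l ^ 9 * (W * l))) * σ ^ 3 := by
          ring
      _ ≤ _ := by gcongr; linarith
  have hB0 : 0 ≤ B := by positivity
  have h3 : B * σ ^ 3 ≤ 16⁻¹ * σ ^ 4 + 4096 * B ^ 4 := by
    rcases le_total σ (16 * B) with h | h
    · have : σ ^ 3 ≤ (16 * B) ^ 3 := by gcongr
      have h4 : B * σ ^ 3 ≤ B * (16 * B) ^ 3 := by gcongr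
      have : 0 ≤ 16⁻¹ * σ ^ 4 := by positivity
      nlinarith
    · have h4 : 16 * B * σ ^ 3 ≤ σ * σ ^ 3 := by gcongr
      have : 0 ≤ 4096 * B ^ 4 := by positivity
      nlinarith
  linarith

set_option maxHeartbeats 800000 in
/-- The total Dirichlet energy is finite. -/
theorem bddAbove_gradEnergy (hA : 1 ≤ A) (hsys : ElsasserSystem Z p) (hP : HasPotentials A Z) :
    BddAbove (Set.range (gradEnergy Z)) := by
  obtain ⟨K, hK1, hK⟩ := exists_gradEnergy_le A hA
  obtain ⟨W, hW1, hW⟩ := exists_interior_bounds A hA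
  have hZ := hsys.contDiff_one
  have hmono := gradEnergy_mono hZ
  have main : ∀ m : ℝ, 1 ≤ m → ∀ s t, m ^ 6 ≤ s → s < t → t ≤ 2 * m ^ 6 →
      gradEnergy Z s ≤ 2⁻¹ * gradEnergy Z t +
        (1 + 4096 * (36 * (K ^ 2 * W)) ^ 4) * (m ^ 6 / (t - s)) ^ 76 := by
    intro m hm s t hs hst ht
    obtain ⟨Q, hQ⟩ := hP.exists_localBound hZ hm
    have hm0 : 0 < m := by linarith
    set d := t - s with hd
    have hd0 : 0 < d := by linarith
    have hsd : s + d = t := by rw [hd]; ring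
    set l := m ^ 6 / d with hl
    have hdl : d * l = m ^ 6 := by rw [hl]; field_simp
    have hl1 : 1 ≤ l := by rw [hl, one_le_div hd0]; linarith
    have hs0 : 0 ≤ s := le_trans (by positivity) hs
    have hloc := hQ t ht
    rw [← hsd] at hloc
    set S := √(gradEnergy Z (s + d)) with hS
    have hS0 : 0 ≤ S := Real.sqrt_nonneg _
    have hS2 : S ^ 2 = gradEnergy Z t := by rw [hS, Real.sq_sqrt (gradEnergy_nonneg Z _), hsd]
    set σ := √(S + 1) with hσ
    have hσ2 : σ ^ 2 = S + 1 := Real.sq_sqrt (by linarith)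
    have hσ1 : 1 ≤ σ := Real.one_le_sqrt.2 (by linarith)
    have hSσ : √S ≤ σ := Real.sqrt_le_sqrt (by linarith)
    set N := 32 * (K * W * l ^ 10) with hN
    have hNl : 8 * l ≤ N := by
      have h1 : l ≤ l ^ 10 := le_self_pow₀ hl1 (by norm_num)
      have h2 : l ^ 10 ≤ K * W * l ^ 10 := le_mul_of_one_le_left (by positivity)
        (one_le_mul_of_one_le_of_one_le hK1 hW1)
      have : 0 ≤ K * W * l ^ 10 := by positivity
      linarith
    have hN1 : 1 ≤ N := by linarith
    set μ := 1 / (N * σ) with hμ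
    have hμ0 : 0 < μ := by positivity
    have hm2 : 1 ≤ m ^ 2 := one_le_pow₀ hm
    have hμl : 8 * (μ * l) ≤ m ^ 2 := by
      have : 8 * (μ * l) = 8 * l / (N * σ) := by rw [hμ]; ring
      rw [this]
      refine le_trans ?_ hm2
      rw [div_le_one (by positivity)]
      nlinarith
    have := holderTriple_three_two
    have h32 := (hW m s d l S Z Q hm hd0 hl1 hdl hs0 (hsd ▸ ht) hZ hloc).1
    have hsub : ∀ ρ : ℝ, s + 3 * d / 8 ≤ ρ →
        Metric.ball (0 : E3) (s + 3 * d / 8) ⊆ Metric.ball 0 ρ := fun ρ hρ =>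
      Metric.ball_subset_ball hρ
    have hY : ∀ σ τ i j k, LpBound (6 / 5) (Metric.ball 0 (s + 3 * d / 8))
        (fun x => Z σ i x * pd (Z τ j) k x) (W * (l * m + m ^ 2 * √S) * S) := fun σ τ i j k =>
      ((h32 σ i).mono_set (hsub _ (by linarith))).mul
        ((hloc.gradient τ j k).mono_set (hsub _ (by linarith)))
    have hmain := hK m s d l S μ _ Z p Q hsys hm hd0 hl1 hdl hs0 (hsd ▸ ht) hμ0 hμl hloc hY
    have e1 : μ * (S + 1) = σ / N := by rw [← hσ2, hμ]; field_simp
    have e2 : 1 / μ = N * σ := by rw [hμ, one_div_one_div]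
    rw [e1, e2] at hmain
    have hSσ2 : S ≤ σ ^ 2 := by linarith
    have b0 : σ / N ≤ σ := div_le_self (by linarith) hN1
    have b1 : (1 + σ / N) / m ^ 2 ≤ 2 * σ := (div_le_self (by positivity) hm2).trans (by linarith)
    have b2 : W * (l * m + m ^ 2 * √S) * S * ((1 + σ / N) / m ^ 2) ≤
        W * l * (2 * σ ^ 3 + 2 * σ ^ 4 / N) := by
      have c1 : l * m + m ^ 2 * √S ≤ l * m ^ 2 * (2 * σ) := by
        have : m ≤ m ^ 2 := le_self_pow₀ hm (by norm_num)
        have c2 : l * m ≤ l * m ^ 2 * σ := by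
          calc l * m = l * m * 1 := by ring
            _ ≤ l * m ^ 2 * σ := by gcongr
        have c3 : m ^ 2 * √S ≤ l * m ^ 2 * σ := by
          calc m ^ 2 * √S = 1 * m ^ 2 * √S := by ring
            _ ≤ _ := by gcongr
        linarith
      calc _ ≤ W * (l * m ^ 2 * (2 * σ)) * σ ^ 2 * ((1 + σ / N) / m ^ 2) := by gcongr
        _ = _ := by field_simp
    have b3 : gradEnergy Z s ≤ K * l ^ 9 * (σ ^ 3 * (N + 2) + W * l * (2 * σ ^ 3 + 2 * σ ^ 4 / N)) := by
      refine hmain.trans (mul_le_mul_of_nonneg_left (add_le_add ?_ b2) (by positivity))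
      calc S * (N * σ + (1 + σ / N) / m ^ 2) ≤ σ ^ 2 * (N * σ + 2 * σ) := by gcongr
        _ = σ ^ 3 * (N + 2) := by ring
    have b4 := b3.trans (absorb hK1 hW1 hl1 hσ1)
    have b5 : σ ^ 4 ≤ 2 * gradEnergy Z t + 2 := by
      rw [← hS2, show σ ^ 4 = (σ ^ 2) ^ 2 by ring, hσ2]
      nlinarith [sq_nonneg (S - 1)]
    have b6 : (36 * (K ^ 2 * W * l ^ 19)) ^ 4 = (36 * (K ^ 2 * W)) ^ 4 * l ^ 76 := by ring
    have b7 : 1 ≤ l ^ 76 := one_le_pow₀ hl1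
    have := gradEnergy_nonneg Z t
    rw [b6] at b4
    rw [add_mul, one_mul, mul_assoc 4096]
    linarith
  refine ⟨3 * (4 * ((76 : ℕ) + 1)) ^ 76 * (1 + 4096 * (36 * (K ^ 2 * W)) ^ 4), ?_⟩
  rintro _ ⟨ρ, rfl⟩
  set m := max 1 ρ with hm
  have hm1 : 1 ≤ m := le_max_left _ _
  refine (hmono (le_max_right 1 ρ)).trans ((hmono (le_self_pow₀ hm1 (by norm_num : 6 ≠ 0))).trans ?_)
  exact le_of_half_le_add (B := gradEnergy Z (2 * m ^ 6)) (by positivity)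
    (fun s _ => gradEnergy_nonneg Z s) (fun s hs => hmono hs.2.le) (main m hm1)

end Liouville

section Vanishing

open scoped ENNReal

variable {Z : Bool → Fin 3 → E3 → ℝ} {A : ℝ} {p : E3 → ℝ}

/-- Smallness of the energy on large balls, with the far-field increment as a parameter. -/
lemma exists_gradEnergy_le_increment (hA : 1 ≤ A) (hsys : ElsasserSystem Z p)
    (hP : HasPotentials A Z) {L : ℝ} (hL : ∀ ρ, gradEnergy Z ρ ≤ L) :
    ∃ K : ℝ, 0 ≤ K ∧ ∀ μ M ρ : ℝ, 1 ≤ μ →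
      gradEnergy Z ρ ≤ K * (1 / μ + μ * √(L - gradEnergy Z M)) := by
  obtain ⟨K, hK1, hK⟩ := exists_gradEnergy_le A hA
  obtain ⟨W, hW1, hW⟩ := exists_interior_bounds A hA
  have hZ := hsys.contDiff_one
  have hmono := gradEnergy_mono hZ
  set S := √L with hS
  have hS0 : 0 ≤ S := Real.sqrt_nonneg _
  set R := 1 + √S with hR
  have hR1 : 1 ≤ R := by have := Real.sqrt_nonneg S; linarith
  refine ⟨K * (S + W * R * (S + 2)), by positivity, fun μ M ρ hμ => ?_⟩
  set τ := √(L - gradEnergy Z M) with hτ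
  have hτ0 : 0 ≤ τ := Real.sqrt_nonneg _
  have hμ0 : 0 < μ := by linarith
  have cprod : ∀ σ τ i j k, Continuous fun x => Z σ i x * pd (Z τ j) k x := fun σ τ i j k =>
    (hZ σ i).continuous.mul (continuous_pd (hZ τ j) k)
  obtain ⟨y, hy⟩ : ∃ y, ∀ σ τ i j k, LpBound (6 / 5) (Metric.ball 0 M)
      (fun x => Z σ i x * pd (Z τ j) k x) y := by
    choose y hy using fun σ τ i j k =>
      LpBound.exists_of_continuous (p := 6 / 5) (cprod σ τ i j k) 0 M
    have hy0 := fun σ τ i j k => (hy σ τ i j k).nonneg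
    refine ⟨∑ q : Bool × Bool × Fin 3 × Fin 3 × Fin 3, y q.1 q.2.1 q.2.2.1 q.2.2.2.1 q.2.2.2.2,
      fun σ τ i j k => (hy σ τ i j k).mono ?_⟩
    exact Finset.single_le_sum
      (f := fun q : Bool × Bool × Fin 3 × Fin 3 × Fin 3 =>
        y q.1 q.2.1 q.2.2.1 q.2.2.2.1 q.2.2.2.2)
      (fun q _ => hy0 _ _ _ _ _) (Finset.mem_univ (σ, τ, i, j, k))
  have hy0 : 0 ≤ y := (hy true true 0 0 0).nonneg
  set c := 1 + μ * (S + 1) with hc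
  have hc0 : 0 ≤ c := by positivity
  have hbound : ∀ m : ℝ, 1 ≤ m → 8 * μ ≤ m → ρ ≤ m → M ≤ m →
      gradEnergy Z ρ ≤ K * (S * (1 / μ + c / m ^ 2) + (y * (c / m ^ 2) + W * R * τ * c)) := by
    intro m hm hμm hρ hM
    obtain ⟨Q, hQ⟩ := hP.exists_localBound hZ hm
    have hm0 : 0 < m := by linarith
    have hmm6 : m ≤ m ^ 6 := le_self_pow₀ hm (by norm_num)
    have hmm2 : m ≤ m ^ 2 := le_self_pow₀ hm (by norm_num)
    set d := m ^ 6 with hd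
    have hd0 : 0 < d := by positivity
    have hdd : d + d = 2 * m ^ 6 := by rw [hd]; ring
    have hloc0 := hQ (d + d) hdd.le
    have hloc : LocalBound A m (d + d) S Z Q := ⟨hloc0.contDiff, hloc0.eq_div, hloc0.potential,
      fun σ j i => (hloc0.gradient σ j i).mono (Real.sqrt_le_sqrt (hL _))⟩
    have h32 := (hW m d d 1 S Z Q hm hd0 le_rfl (by rw [mul_one]) hd0.le hdd.le hZ hloc).1
    have hX : ∀ σ i, LpBound 3 (Metric.ball 0 (d + 3 * d / 8)) (Z σ i) (W * R * m ^ 2) :=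
      fun σ i => ((h32 σ i).mono_set (Metric.ball_subset_ball (by linarith))).mono (by
        rw [mul_assoc]
        refine mul_le_mul_of_nonneg_left ?_ (by positivity)
        rw [hR]
        linarith)
    have := holderTriple_three_two
    have hfar : ∀ σ j i, LpBound 2 (Metric.ball 0 (d + 3 * d / 8) \ Metric.ball 0 M)
        (pd (Z σ j) i) τ := fun σ j i =>
      (lpBound_pd_diff hZ (by linarith) σ j i).mono
        (Real.sqrt_le_sqrt (sub_le_sub_right (hL _) _))
    have hY : ∀ σ τ' i j k, LpBound (6 / 5) (Metric.ball 0 (d + 3 * d / 8))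
        (fun x => Z σ i x * pd (Z τ' j) k x) (y + W * R * m ^ 2 * τ) := fun σ τ' i j k =>
      LpBound.union (by rw [ENNReal.le_div_iff_mul_le (by simp) (by simp)]; norm_num)
        measurableSet_ball measurableSet_ball (hy σ τ' i j k)
        (((hX σ i).mono_set Set.sdiff_subset).mul (hfar τ' j k))
    have hmain := hK m d d 1 S μ _ Z p Q hsys hm hd0 le_rfl (by rw [mul_one]) hd0.le hdd.le hμ0
      (by linarith) hloc hY
    refine (hmono (hρ.trans hmm6)).trans (hmain.trans (le_of_eq ?_))
    rw [hc]
    field_simp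
  have hlim : Filter.Tendsto (fun m : ℝ =>
      K * (S * (1 / μ + c / m ^ 2) + (y * (c / m ^ 2) + W * R * τ * c))) Filter.atTop
      (nhds (K * (S * (1 / μ + 0) + (y * 0 + W * R * τ * c)))) := by
    have h0 : Filter.Tendsto (fun m : ℝ => c / m ^ 2) Filter.atTop (nhds 0) :=
      tendsto_const_nhds.div_atTop (Filter.tendsto_pow_atTop two_ne_zero)
    exact (((h0.const_add _).const_mul _).add ((h0.const_mul _).add_const _)).const_mul _
  have h1 := ge_of_tendsto hlim ((((Filter.eventually_ge_atTop 1).and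
    (Filter.eventually_ge_atTop (8 * μ))).and ((Filter.eventually_ge_atTop ρ).and
    (Filter.eventually_ge_atTop M))).mono fun m h => hbound m h.1.1 h.1.2 h.2.1 h.2.2)
  refine h1.trans ?_
  have h2 : c ≤ (S + 2) * μ := by rw [hc]; nlinarith
  have h3 : 0 ≤ 1 / μ := by positivity
  calc _ = K * (S * (1 / μ) + W * R * τ * c) := by ring
    _ ≤ K * (S * (1 / μ) + W * R * τ * ((S + 2) * μ)) := by gcongr
    _ ≤ K * (S * (1 / μ) + W * R * τ * ((S + 2) * μ)) +
        K * (S * (μ * τ) + W * R * (S + 2) * (1 / μ)) := by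
        have : 0 ≤ K * (S * (μ * τ) + W * R * (S + 2) * (1 / μ)) := by positivity
        linarith
    _ = _ := by ring

/-- The Dirichlet energy vanishes. -/
theorem gradEnergy_eq_zero (hA : 1 ≤ A) (hsys : ElsasserSystem Z p) (hP : HasPotentials A Z)
    (ρ : ℝ) : gradEnergy Z ρ = 0 := by
  have hbdd := bddAbove_gradEnergy hA hsys hP
  set L := ⨆ ρ, gradEnergy Z ρ with hL
  have hLle : ∀ ρ, gradEnergy Z ρ ≤ L := le_ciSup hbdd
  have hLt : Filter.Tendsto (gradEnergy Z) Filter.atTop (nhds L) :=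
    tendsto_atTop_ciSup (gradEnergy_mono hsys.contDiff_one) hbdd
  obtain ⟨K, hK0, hK⟩ := exists_gradEnergy_le_increment hA hsys hP hLle
  have h1 : ∀ μ : ℝ, 1 ≤ μ → gradEnergy Z ρ ≤ K * (1 / μ) := by
    intro μ hμ
    have ht : Filter.Tendsto (fun M => K * (1 / μ + μ * √(L - gradEnergy Z M))) Filter.atTop
        (nhds (K * (1 / μ + μ * √(L - L)))) :=
      (((Real.continuous_sqrt.tendsto _).comp (hLt.const_sub L)).const_mul μ |>.const_add
        (1 / μ)).const_mul K
    rw [sub_self, Real.sqrt_zero, mul_zero, add_zero] at ht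
    exact ge_of_tendsto' ht fun M => hK μ M ρ hμ
  have h2 : Filter.Tendsto (fun μ : ℝ => K * (1 / μ)) Filter.atTop (nhds (K * 0)) :=
    (tendsto_const_nhds.div_atTop Filter.tendsto_id).const_mul K
  rw [mul_zero] at h2
  exact le_antisymm (ge_of_tendsto h2 ((Filter.eventually_ge_atTop 1).mono h1))
    (gradEnergy_nonneg Z ρ)

/-- A function with vanishing partial derivatives is constant. -/
lemma eq_of_pd_eq_zero {f : E3 → ℝ} (hf : ContDiff ℝ 1 f) (h : ∀ i x, pd f i x = 0) (x y : E3) :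
    f x = f y := by
  refine is_const_of_fderiv_eq_zero (𝕜 := ℝ) (differentiable_of_contDiff_one hf) (fun z => ?_) x y
  ext w
  rw [fderiv_eq_sum_pd]
  simp [h]

/-- **Liouville theorem** for the Elsasser system. -/
theorem ElsasserSystem.eq_zero (hA : 1 ≤ A) (hsys : ElsasserSystem Z p) (hP : HasPotentials A Z)
    (σ : Bool) (j : Fin 3) (x : E3) : Z σ j x = 0 := by
  have hZ := hsys.contDiff_one
  have hE := gradEnergy_eq_zero hA hsys hP
  have hpd : ∀ i x, pd (Z σ j) i x = 0 := by
    intro i x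
    have h1 := lpBound_pd_ball hZ (‖x‖ + 1) σ j i
    rw [hE, Real.sqrt_zero] at h1
    have h2 := h1.le
    rw [ENNReal.ofReal_zero, nonpos_iff_eq_zero, eLpNorm_eq_zero_iff h1.meas two_ne_zero] at h2
    exact Measure.eqOn_open_of_ae_eq h2 Metric.isOpen_ball (continuous_pd (hZ σ j) i).continuousOn
      continuousOn_const (by simp)
  have hconst := eq_of_pd_eq_zero (hZ σ j) hpd
  set c := Z σ j x with hc
  obtain ⟨W, hW1, hW⟩ := exists_interior_bounds A hA
  set v := volume.real (Metric.ball (0 : E3) 1) with hv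
  have hv0 : 0 < v := ENNReal.toReal_pos (Metric.measure_ball_pos _ _ one_pos).ne'
    measure_ball_lt_top.ne
  have key : ∀ m : ℝ, 1 ≤ m → |c| ^ 3 * v * m ≤ W ^ 3 := by
    intro m hm
    have hm0 : 0 < m := by linarith
    obtain ⟨Q, hQ⟩ := hP.exists_localBound hZ hm
    have hloc := hQ (m ^ 6 + m ^ 6) (by linarith)
    have h1 := (hW m (m ^ 6) (m ^ 6) 1 _ Z Q hm (by positivity) le_rfl (by ring) (by positivity)
      (by linarith) hZ hloc).1 σ j
    rw [hE, Real.sqrt_zero, Real.sqrt_zero, mul_zero, add_zero, one_mul] at h1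
    have h2 : LpBound (3 : ℕ) (Metric.ball 0 (m ^ 6)) (Z σ j) (W * m) := by
      rw [Nat.cast_ofNat]
      exact h1.mono_set (Metric.ball_subset_ball (by have : 0 < m ^ 6 := by positivity
                                                     linarith))
    have h3 := h2.integral_pow_le (by norm_num)
      (integrableOn_ball_of_continuous ((hZ σ j).continuous.abs.pow 3) _)
    have h4 : ∀ y, |Z σ j y| ^ 3 = |c| ^ 3 := fun y => by rw [hconst y x]
    simp only [h4, setIntegral_const, smul_eq_mul] at h3
    have h5 : volume.real (Metric.ball (0 : E3) (m ^ 6)) = m ^ 18 * v := by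
      rw [Measure.real, Measure.addHaar_ball _ _ (by positivity), ENNReal.toReal_mul,
        ENNReal.toReal_ofReal (by positivity), finrank_euclideanSpace, Fintype.card_fin]
      rw [hv, Measure.real]
      ring
    rw [h5] at h3
    have h6 : m ^ 3 * (|c| ^ 3 * v * m) ≤ m ^ 3 * W ^ 3 := by
      have h7 : m ≤ m ^ 15 := le_self_pow₀ hm (by norm_num)
      calc m ^ 3 * (|c| ^ 3 * v * m) ≤ m ^ 3 * (|c| ^ 3 * v * m ^ 15) := by gcongr
        _ = m ^ 18 * v * |c| ^ 3 := by ring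
        _ ≤ (W * m) ^ 3 := h3
        _ = _ := by ring
    exact le_of_mul_le_mul_left h6 (by positivity)
  by_contra hne
  have hpos : 0 < |c| ^ 3 * v := by positivity
  have h1 := key (1 + W ^ 3 / (|c| ^ 3 * v)) (by
    have : 0 ≤ W ^ 3 / (|c| ^ 3 * v) := by positivity
    linarith)
  rw [mul_add, mul_div_cancel₀ _ hpos.ne'] at h1
  linarith

end Vanishing

section Reduction

open scoped ENNReal

/-- The sign attached to an Elsasser variable. -/
noncomputable def elsasserSign (σ : Bool) : ℝ := if σ then 1 else -1

/-- The Elsasser variables `v + B` and `v - B`. -/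
noncomputable def elsasserField (v B : E3 → Fin 3 → ℝ) (σ : Bool) (j : Fin 3) (x : E3) : ℝ :=
  v x j + elsasserSign σ * B x j

lemma pd_add_const_mul {f g : E3 → ℝ} (hf : ContDiff ℝ 1 f) (hg : ContDiff ℝ 1 g) (c : ℝ)
    (i : Fin 3) : pd (fun y => f y + c * g y) i = fun x => pd f i x + c * pd g i x := by
  funext x
  have hf' := differentiable_of_contDiff_one hf
  have hg' := differentiable_of_contDiff_one hg
  rw [pd_add_apply (hf' x) ((hg'.const_mul c) x), pd_const_mul hg']

lemma pd_sub_const {f : E3 → ℝ} (hf : ContDiff ℝ 1 f) (c : ℝ) (i : Fin 3) :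
    pd (fun y => f y - c) i = pd f i := by
  funext x
  rw [pd_sub_apply (differentiable_of_contDiff_one hf x) (differentiableAt_const c), pd_const,
    sub_zero]

lemma elsasserSystem_of_mhd {v B : E3 → Fin 3 → ℝ} {p : E3 → ℝ}
    (hv : ContDiff ℝ (⊤ : ℕ∞) v) (hB : ContDiff ℝ (⊤ : ℕ∞) B) (hp : ContDiff ℝ (⊤ : ℕ∞) p)
    (heq1 : ∀ x j, -(lap (fun y => v y j) x) + (∑ i, v x i * pd (fun y => v y j) i x)
      = -(pd p j x) + ∑ i, B x i * pd (fun y => B y j) i x)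
    (heq2 : ∀ x j, -(lap (fun y => B y j) x) + (∑ i, v x i * pd (fun y => B y j) i x)
      - (∑ i, B x i * pd (fun y => v y j) i x) = 0)
    (hdivv : ∀ x, divg v x = 0) (hdivB : ∀ x, divg B x = 0) :
    ElsasserSystem (elsasserField v B) p := by
  have hvj : ∀ j, ContDiff ℝ (⊤ : ℕ∞) fun x => v x j := fun j => contDiff_pi.1 hv j
  have hBj : ∀ j, ContDiff ℝ (⊤ : ℕ∞) fun x => B x j := fun j => contDiff_pi.1 hB j
  have hvj1 : ∀ j, ContDiff ℝ 1 fun x => v x j := fun j => (hvj j).of_le (by norm_cast)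
  have hBj1 : ∀ j, ContDiff ℝ 1 fun x => B x j := fun j => (hBj j).of_le (by norm_cast)
  have e1 : ∀ σ j i, pd (elsasserField v B σ j) i =
      fun x => pd (fun y => v y j) i x + elsasserSign σ * pd (fun y => B y j) i x := fun σ j i =>
    pd_add_const_mul (hvj1 j) (hBj1 j) _ i
  have e2 : ∀ σ j i, pd (pd (elsasserField v B σ j) i) i = fun x =>
      pd (pd (fun y => v y j) i) i x + elsasserSign σ * pd (pd (fun y => B y j) i) i x := by
    intro σ j i
    rw [e1]
    exact pd_add_const_mul ((contDiff_pd_top (hvj j) i).of_le (by norm_cast))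
      ((contDiff_pd_top (hBj j) i).of_le (by norm_cast)) _ i
  refine ⟨fun σ j => (hvj j).add (contDiff_const.mul (hBj j)), hp, fun σ j x => ?_, fun σ x => ?_⟩
  · have h1 := heq1 x j
    have h2 := heq2 x j
    have hlap : ∀ f : E3 → ℝ, lap f x = ∑ i, pd (pd f i) i x := fun f => rfl
    simp only [e2, hlap, Fin.sum_univ_three] at h1 h2 ⊢
    simp only [e1, elsasserField]
    cases σ <;> simp only [elsasserSign, Bool.not_true, Bool.not_false, if_true, if_false,
      Bool.false_eq_true] <;> linarith
  · have h1 := hdivv x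
    have h2 := hdivB x
    simp only [divg] at h1 h2
    simp only [e1, Finset.sum_add_distrib, ← Finset.mul_sum, h1, h2, mul_zero, add_zero]

/-- Lebesgue bound of the oscillation of a matrix entry. -/
lemma lpBound_six_of_average_le {F : E3 → Fin 3 → Fin 3 → ℝ} (hF : Continuous F)
    (c : Fin 3 → Fin 3 → ℝ) {C m : ℝ} (hm : 1 ≤ m)
    (h : ⨍ x in Metric.ball (0 : E3) (2 * m ^ 6), ‖(fun i j => F x i j - c i j)‖ ^ 6 ≤
      C * (2 * m ^ 6)) (i j : Fin 3) :
    LpBound 6 (Metric.ball 0 (2 * m ^ 6)) (fun x => F x i j - c i j)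
      ((1 + 16 * volume.real (Metric.ball (0 : E3) 1) * |C|) * m ^ 4) := by
  set v := volume.real (Metric.ball (0 : E3) 1) with hv
  have hv0 : 0 < v := ENNReal.toReal_pos (Metric.measure_ball_pos _ _ one_pos).ne'
    measure_ball_lt_top.ne
  have hm0 : 0 < m := by linarith
  have hvol : volume.real (Metric.ball (0 : E3) (2 * m ^ 6)) = 8 * m ^ 18 * v := by
    rw [Measure.real, Measure.addHaar_ball _ _ (by positivity), ENNReal.toReal_mul,
      ENNReal.toReal_ofReal (by positivity), finrank_euclideanSpace, Fintype.card_fin]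
    rw [hv, Measure.real]
    ring
  have hcij : ∀ i j, Continuous fun x => F x i j - c i j := fun i j =>
    ((continuous_apply_apply i j).comp hF).sub continuous_const
  have hcm : Continuous fun x => (fun i j => F x i j - c i j) :=
    continuous_pi fun i => continuous_pi fun j => hcij i j
  rw [setAverage_eq, smul_eq_mul, hvol, inv_mul_le_iff₀ (by positivity)] at h
  have hle : ∀ x, |F x i j - c i j| ^ 6 ≤ ‖(fun i j => F x i j - c i j)‖ ^ 6 := fun x => by
    refine pow_le_pow_left₀ (abs_nonneg _) ?_ 6
    exact (norm_le_pi_norm (fun j => F x i j - c i j) j).trans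
      (norm_le_pi_norm (fun i j => F x i j - c i j) i)
  have h1 : ∫ x in Metric.ball (0 : E3) (2 * m ^ 6), |F x i j - c i j| ^ 6 ≤
      8 * m ^ 18 * v * (C * (2 * m ^ 6)) :=
    (setIntegral_mono (integrableOn_ball_of_continuous ((hcij i j).abs.pow 6) _)
      (integrableOn_ball_of_continuous (hcm.norm.pow 6) _) hle).trans h
  have h2 : LpBound (6 : ℕ) (Metric.ball 0 (2 * m ^ 6)) (fun x => F x i j - c i j)
      ((1 + 16 * v * |C|) * m ^ 4) := by
    refine LpBound.of_integral_pow_le (by norm_num) (by positivity)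
      (hcij i j).aestronglyMeasurable
      (integrableOn_ball_of_continuous ((hcij i j).abs.pow 6) _) (h1.trans ?_)
    have h3 : 16 * v * C ≤ (1 + 16 * v * |C|) ^ 6 := by
      have h4 : 16 * v * C ≤ 16 * v * |C| := by gcongr; exact le_abs_self C
      have h5 : 1 + 16 * v * |C| ≤ (1 + 16 * v * |C|) ^ 6 :=
        le_self_pow₀ (by have : 0 ≤ 16 * v * |C| := by positivity
                         linarith) (by norm_num)
      linarith
    calc _ = 16 * v * C * m ^ 24 := by ring
      _ ≤ (1 + 16 * v * |C|) ^ 6 * m ^ 24 := by gcongr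
      _ = _ := by ring
  rwa [Nat.cast_ofNat] at h2

lemma hasPotentials_of_oscillation {v B : E3 → Fin 3 → ℝ}
    {Φ Ψ : E3 → Fin 3 → Fin 3 → ℝ} (hΦ : ContDiff ℝ (⊤ : ℕ∞) Φ) (hΨ : ContDiff ℝ (⊤ : ℕ∞) Ψ)
    (hΦv : ∀ x j, matDiv Φ x j = v x j) (hΨB : ∀ x j, matDiv Ψ x j = B x j) {C : ℝ}
    (hosc : ∀ r : ℝ, 1 < r →
      (⨍ x in Metric.ball (0 : E3) r,
        ‖(fun (i j : Fin 3) => Φ x i j - ⨍ y in Metric.ball (0 : E3) r, Φ y i j)‖ ^ 6)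
      + (⨍ x in Metric.ball (0 : E3) r,
        ‖(fun (i j : Fin 3) => Ψ x i j - ⨍ y in Metric.ball (0 : E3) r, Ψ y i j)‖ ^ 6)
      ≤ C * r) :
    HasPotentials (2 * (1 + 16 * volume.real (Metric.ball (0 : E3) 1) * |C|))
      (elsasserField v B) := by
  intro m hm
  have hm6 : 1 ≤ m ^ 6 := one_le_pow₀ hm
  have h := hosc (2 * m ^ 6) (by linarith)
  have nonneg : ∀ G : E3 → Fin 3 → Fin 3 → ℝ,
      0 ≤ ⨍ x in Metric.ball (0 : E3) (2 * m ^ 6), ‖G x‖ ^ 6 := fun G =>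
    integral_nonneg fun x => by positivity
  have hΦij : ∀ i j, ContDiff ℝ (⊤ : ℕ∞) fun x => Φ x i j := fun i j =>
    contDiff_pi.1 (contDiff_pi.1 hΦ i) j
  have hΨij : ∀ i j, ContDiff ℝ (⊤ : ℕ∞) fun x => Ψ x i j := fun i j =>
    contDiff_pi.1 (contDiff_pi.1 hΨ i) j
  have h1 := lpBound_six_of_average_le hΦ.continuous _ hm
    ((le_add_of_nonneg_right (nonneg _)).trans h)
  have h2 := lpBound_six_of_average_le hΨ.continuous _ hm
    ((le_add_of_nonneg_left (nonneg _)).trans h)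
  have hsgn : ∀ σ, |elsasserSign σ| = 1 := by intro σ; cases σ <;> simp [elsasserSign]
  refine ⟨fun σ i j x => (Φ x i j - ⨍ y in Metric.ball (0 : E3) (2 * m ^ 6), Φ y i j) +
    elsasserSign σ * (Ψ x i j - ⨍ y in Metric.ball (0 : E3) (2 * m ^ 6), Ψ y i j),
    fun σ i j => ((hΦij i j).sub contDiff_const).add
      (contDiff_const.mul ((hΨij i j).sub contDiff_const)), fun σ j x => ?_, fun σ i j => ?_⟩
  · have e : ∀ i, pd (fun x => (Φ x i j - ⨍ y in Metric.ball (0 : E3) (2 * m ^ 6), Φ y i j) +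
        elsasserSign σ * (Ψ x i j - ⨍ y in Metric.ball (0 : E3) (2 * m ^ 6), Ψ y i j)) i =
        fun x => pd (fun y => Φ y i j) i x + elsasserSign σ * pd (fun y => Ψ y i j) i x := by
      intro i
      have hf : ContDiff ℝ 1 fun x => Φ x i j := (hΦij i j).of_le (by norm_cast)
      have hg : ContDiff ℝ 1 fun x => Ψ x i j := (hΨij i j).of_le (by norm_cast)
      rw [pd_add_const_mul (hf.sub contDiff_const) (hg.sub contDiff_const), pd_sub_const hf,
        pd_sub_const hg]
    simp only [e, Finset.sum_add_distrib, ← Finset.mul_sum, elsasserField]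
    rw [← hΦv, ← hΨB]
    rfl
  · have h3 := (h1 i j).add (by norm_num) ((h2 i j).const_mul (elsasserSign σ))
    rw [hsgn, one_mul] at h3
    exact h3.mono (le_of_eq (by ring))

end Reduction

/-- **Liouville theorem for stationary MHD (Theorem 1.1).**  If `(v, B, p)` is a smooth
solution of `-Δv + (v·∇)v = -∇p + (B·∇)B`, `-ΔB + (v·∇)B - (B·∇)v = 0`,
`∇·v = ∇·B = 0` in `ℝ³`, and there are smooth matrix potentials `Φ, Ψ` with `∇·Φ = v`,
`∇·Ψ = B` and `⨍_{B(r)} |Φ-Φ_{B(r)}|⁶ + ⨍_{B(r)} |Ψ-Ψ_{B(r)}|⁶ ≤ C r` for all `r > 1`,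
then `v ≡ 0`, `B ≡ 0` and `p` is constant. -/
theorem stmt_11 (v B : E3 → Fin 3 → ℝ) (p : E3 → ℝ)
    (hv : ContDiff ℝ (⊤ : ℕ∞) v) (hB : ContDiff ℝ (⊤ : ℕ∞) B) (hp : ContDiff ℝ (⊤ : ℕ∞) p)
    (heq1 : ∀ x j, -(lap (fun y => v y j) x) + (∑ i, v x i * pd (fun y => v y j) i x)
      = -(pd p j x) + ∑ i, B x i * pd (fun y => B y j) i x)
    (heq2 : ∀ x j, -(lap (fun y => B y j) x) + (∑ i, v x i * pd (fun y => B y j) i x)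
      - (∑ i, B x i * pd (fun y => v y j) i x) = 0)
    (hdivv : ∀ x, divg v x = 0) (hdivB : ∀ x, divg B x = 0)
    (Φ Ψ : E3 → Fin 3 → Fin 3 → ℝ) (hΦ : ContDiff ℝ (⊤ : ℕ∞) Φ) (hΨ : ContDiff ℝ (⊤ : ℕ∞) Ψ)
    (hΦv : ∀ x j, matDiv Φ x j = v x j) (hΨB : ∀ x j, matDiv Ψ x j = B x j)
    (C : ℝ)
    (hosc : ∀ r : ℝ, 1 < r →
      (⨍ x in Metric.ball (0 : E3) r,
        ‖(fun (i j : Fin 3) => Φ x i j - ⨍ y in Metric.ball (0 : E3) r, Φ y i j)‖ ^ 6)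
      + (⨍ x in Metric.ball (0 : E3) r,
        ‖(fun (i j : Fin 3) => Ψ x i j - ⨍ y in Metric.ball (0 : E3) r, Ψ y i j)‖ ^ 6)
      ≤ C * r) :
    (∀ x, v x = 0) ∧ (∀ x, B x = 0) ∧ ∃ cst : ℝ, ∀ x, p x = cst := by
  have hsys := elsasserSystem_of_mhd hv hB hp heq1 heq2 hdivv hdivB
  have hpot := hasPotentials_of_oscillation hΦ hΨ hΦv hΨB hosc
  have hA : 1 ≤ 2 * (1 + 16 * volume.real (Metric.ball (0 : E3) 1) * |C|) := by
    have : 0 ≤ 16 * volume.real (Metric.ball (0 : E3) 1) * |C| := by positivity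
    linarith
  have hZ := hsys.eq_zero hA hpot
  have h1 : ∀ x j, v x j + B x j = 0 := fun x j => by
    simpa [elsasserField, elsasserSign] using hZ true j x
  have h2 : ∀ x j, v x j - B x j = 0 := fun x j => by
    simpa [elsasserField, elsasserSign, sub_eq_add_neg] using hZ false j x
  refine ⟨fun x => funext fun j => ?_, fun x => funext fun j => ?_, p 0, fun x => ?_⟩
  · show v x j = 0
    linarith [h1 x j, h2 x j]
  · show B x j = 0
    linarith [h1 x j, h2 x j]
  · refine eq_of_pd_eq_zero hsys.contDiff_one_pressure (fun j y => ?_) x 0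
    have hz : ∀ σ j, elsasserField v B σ j = fun _ => 0 := fun σ j => funext fun x => hZ σ j x
    have h0 : ∀ i, pd (fun _ : E3 => (0 : ℝ)) i = fun _ => 0 := fun i => funext fun x => by simp [pd]
    rw [hsys.momentum true j y]
    simp [hz, h0]
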